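/- (Chang–Yu) Let q = p^e be a prime power, A = 𝔽_q[θ], K = 𝔽_q(θ), A_+ the set of monic polynomials in A, K_∞ = 𝔽_q((1/θ)), and for an integer n ≥ 1 let ζ(n) = ∑_{a ∈ A_+} a^{−n} ∈ K_∞ be the Carlitz–Goss zeta value. Then all algebraic dependence relations over K among the values ζ(1), ζ(2), ζ(3), … are generated by the Bernoulli–Carlitz relations ζ(m(q−1))/π̃^{m(q−1)} ∈ K (m ≥ 1) and the Frobenius relations ζ(m p^k) = ζ(m)^{p^k} (m, k ≥ 1). Equivalently, for every integer s ≥ 1 the transcendence degree over K of K(π̃, ζ(1), …, ζ(s)) equals 1 + #{1 ≤ n ≤ s : p ∤ n and (q−1) ∤ n}. -/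

import Mathlib

set_option synthInstance.maxHeartbeats 400000
set_option maxHeartbeats 800000

/-- The transcendence degree over `R` of the intermediate field `R(S)`
generated by a subset `S` of a field extension `A` of `R`: the supremum of the
cardinalities of subsets of `R(S)` that are algebraically independent
over `R`. -/
noncomputable def genTrdeg (R A : Type*) [Field R] [Field A] [Algebra R A] (S : Set A) :
    Cardinal :=
  ⨆ s : { s : Set A //
      s ⊆ (IntermediateField.adjoin R S : Set A) ∧ AlgebraicIndependent R ((↑) : s → A) },
    Cardinal.mk s.1

/-- The Carlitz–Goss zeta value `ζ(n) = ∑_{a ∈ A₊} a^{−n}`, the sum running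
over monic polynomials `a ∈ A = 𝔽_q[θ]`, computed in `C`. -/
noncomputable def gossZeta (Fq : Type*) [Field Fq] [Fintype Fq] (C : Type*) [NormedField C]
    [Algebra (RatFunc Fq) C] (n : ℕ) : C :=
  ∑' a : { a : Polynomial Fq // a.Monic },
    (algebraMap (RatFunc Fq) C (algebraMap (Polynomial Fq) (RatFunc Fq) a.1))⁻¹ ^ n

set_option linter.unusedSectionVars false
set_option linter.unusedSimpArgs false

namespace CY

/-- The standing hypotheses on the complete field `L = K_∞`. -/
class KInf (Fq L : Type*) [Field Fq] [Fintype Fq] [NormedField L] [Algebra Fq L]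
    [Algebra (Polynomial Fq) L] : Prop where
  complete : CompleteSpace L
  ultra : IsUltrametricDist L
  tower : IsScalarTower Fq (Polynomial Fq) L
  norm_alg : ∀ a : Polynomial Fq, a ≠ 0 →
    ‖algebraMap (Polynomial Fq) L a‖ = (Fintype.card Fq : ℝ) ^ a.natDegree
  norm_val : ∀ x : L, x ≠ 0 → ∃ k : ℤ, ‖x‖ = (Fintype.card Fq : ℝ) ^ k

section frob
variable (Fq : Type*) [Field Fq] [Fintype Fq]
local notation "q" => Fintype.card Fq

/-- The `q^k`-power Frobenius. -/
noncomputable def frk (R : Type*) [CommRing R] [Algebra Fq R] : ℕ → (R →+* R)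
  | 0 => RingHom.id R
  | k + 1 => (FiniteField.frobeniusAlgHom Fq R : R →+* R).comp (frk R k)

theorem frk_apply (R : Type*) [CommRing R] [Algebra Fq R] (k : ℕ) (x : R) :
    frk Fq R k x = x ^ q ^ k := by
  induction k with
  | zero => simp [frk]
  | succ k ih =>
    simp only [frk, RingHom.comp_apply, ih]
    change (FiniteField.frobeniusAlgHom Fq R) _ = _
    rw [FiniteField.coe_frobeniusAlgHom]
    simp only [← pow_mul, pow_succ]

theorem one_lt_q : 1 < q := Fintype.one_lt_card
theorem q_pos : 0 < q := Fintype.card_pos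
theorem one_lt_qR : (1 : ℝ) < q := by exact_mod_cast one_lt_q Fq
theorem q_posR : (0 : ℝ) < q := by exact_mod_cast q_pos Fq

/-- Frobenius on coefficients of `A[t]`. -/
noncomputable def sp (k : ℕ) : Polynomial (Polynomial Fq) →+* Polynomial (Polynomial Fq) :=
  Polynomial.mapRingHom (frk Fq (Polynomial Fq) k)

theorem coeff_sp (k n : ℕ) (f : Polynomial (Polynomial Fq)) :
    (sp Fq k f).coeff n = (f.coeff n) ^ q ^ k := by
  simp [sp, frk_apply]

theorem sp_zero (f : Polynomial (Polynomial Fq)) : sp Fq 0 f = f := by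
  ext1 n; simp [coeff_sp]

theorem sp_sp (j k : ℕ) (f : Polynomial (Polynomial Fq)) :
    sp Fq j (sp Fq k f) = sp Fq (j + k) f := by
  ext1 n; simp only [coeff_sp, ← pow_mul]; congr 1; ring

theorem sp_injective (k : ℕ) : Function.Injective (sp Fq k) := by
  rw [injective_iff_map_eq_zero]
  intro f hf
  ext1 n
  have h := congrArg (fun g => Polynomial.coeff g n) hf
  simp only [coeff_sp, Polynomial.coeff_zero] at h ⊢
  exact pow_eq_zero_iff (pow_pos (q_pos Fq) k).ne' |>.1 h

end frob

section ps
variable (Fq : Type*) {L : Type*} [Field Fq] [Fintype Fq] [NormedField L] [Algebra Fq L]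
local notation "q" => Fintype.card Fq

/-- Frobenius on coefficients of `L⟦t⟧`. -/
noncomputable def sg (k : ℕ) : PowerSeries L →+* PowerSeries L :=
  PowerSeries.map (frk Fq L k)

theorem coeff_sg (k n : ℕ) (f : PowerSeries L) :
    PowerSeries.coeff n (sg Fq k f) = (PowerSeries.coeff n f) ^ q ^ k := by
  simp [sg, frk_apply]

theorem sg_zero (f : PowerSeries L) : sg Fq 0 f = f := by
  ext1 n; simp [coeff_sg]

theorem sg_sg (j k : ℕ) (f : PowerSeries L) :
    sg Fq j (sg Fq k f) = sg Fq (j + k) f := by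
  ext1 n; simp only [coeff_sg, ← pow_mul]; congr 1; ring

theorem sg_injective (k : ℕ) : Function.Injective (sg Fq k : PowerSeries L → PowerSeries L) := by
  rw [injective_iff_map_eq_zero]
  intro f hf
  ext1 n
  have h := congrArg (PowerSeries.coeff n) hf
  simp only [coeff_sg, map_zero] at h ⊢
  exact pow_eq_zero_iff (pow_pos (q_pos Fq) k).ne' |>.1 h

variable [Algebra (Polynomial Fq) L]

variable (L) in
/-- The embedding `A[t] → L⟦t⟧`. -/
noncomputable def emb : Polynomial (Polynomial Fq) →+* PowerSeries L :=
  (Polynomial.coeToPowerSeries.ringHom (R := L)).comp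
    (Polynomial.mapRingHom (algebraMap (Polynomial Fq) L))

theorem coeff_emb (n : ℕ) (f : Polynomial (Polynomial Fq)) :
    PowerSeries.coeff n (emb Fq L f) = algebraMap (Polynomial Fq) L (f.coeff n) := by
  simp [emb]

theorem emb_sp (k : ℕ) (f : Polynomial (Polynomial Fq)) :
    emb Fq L (sp Fq k f) = sg Fq k (emb Fq L f) := by
  ext1 n; simp [coeff_emb, coeff_sg, coeff_sp]

section kinf
variable [KInf Fq L]

theorem alg_inj : Function.Injective (algebraMap (Polynomial Fq) L) := by
  rw [injective_iff_map_eq_zero]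
  intro a ha
  by_contra h
  have := KInf.norm_alg (L := L) a h
  rw [ha, norm_zero] at this
  exact (pow_pos (q_posR Fq) _).ne this

theorem norm_alg_le (a : Polynomial Fq) (d : ℕ) (h : a.natDegree ≤ d) :
    ‖algebraMap (Polynomial Fq) L a‖ ≤ (q : ℝ) ^ d := by
  by_cases ha : a = 0
  · simp [ha]
  · rw [KInf.norm_alg a ha]
    exact pow_le_pow_right₀ (one_lt_qR Fq).le h

theorem emb_inj : Function.Injective (emb Fq L) := by
  intro f g h
  ext1 n
  have := congrArg (PowerSeries.coeff n) h
  simp only [coeff_emb] at this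
  exact alg_inj Fq this
end kinf
end ps

section bd
variable {L : Type*} [NormedField L]

/-- `f` has coefficients bounded by `β R^{-k}`. -/
def Bd (R β : ℝ) (f : PowerSeries L) : Prop := ∀ k, ‖PowerSeries.coeff k f‖ * R ^ k ≤ β

/-- Evaluation of a power series. -/
noncomputable def ev (a : L) (f : PowerSeries L) : L := ∑' k, PowerSeries.coeff k f * a ^ k

namespace Bd
theorem nonneg {R β : ℝ} {f : PowerSeries L} (h : Bd R β f) : 0 ≤ β :=
  le_trans (by simp) (h 0)

theorem mono {R R' β β' : ℝ} {f : PowerSeries L} (h : Bd R β f) (hR' : 0 ≤ R') (hR : R' ≤ R)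
    (hβ : β ≤ β') : Bd R' β' f := fun k =>
  le_trans (le_trans (mul_le_mul_of_nonneg_left (pow_le_pow_left₀ hR' hR k) (norm_nonneg _)) (h k)) hβ

theorem zero {R β : ℝ} (hβ : 0 ≤ β) : Bd R β (0 : PowerSeries L) := fun k => by simpa using hβ

theorem const {R β : ℝ} (a : L) (h : ‖a‖ ≤ β) : Bd R β (PowerSeries.C a) := by
  intro k
  rw [PowerSeries.coeff_C]
  split_ifs with hk
  · simpa [hk] using h
  · simpa using le_trans (norm_nonneg _) h

theorem one {R : ℝ} : Bd R 1 (1 : PowerSeries L) := by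
  simpa using const (R := R) (1 : L) (by simp)

theorem neg {R β : ℝ} {f : PowerSeries L} (h : Bd R β f) : Bd R β (-f) := fun k => by
  simpa using h k

variable [IsUltrametricDist L]

theorem add {R β : ℝ} (hR : 0 ≤ R) {f g : PowerSeries L} (hf : Bd R β f) (hg : Bd R β g) :
    Bd R β (f + g) := fun k => by
  rw [map_add]
  refine le_trans (mul_le_mul_of_nonneg_right (IsUltrametricDist.norm_add_le_max _ _) (by positivity)) ?_
  rcases max_choice ‖PowerSeries.coeff k f‖ ‖PowerSeries.coeff k g‖ with h | h <;> rw [h]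
  · exact hf k
  · exact hg k

theorem sub {R β : ℝ} (hR : 0 ≤ R) {f g : PowerSeries L} (hf : Bd R β f) (hg : Bd R β g) :
    Bd R β (f - g) := by
  rw [sub_eq_add_neg]; exact hf.add hR hg.neg

theorem sum {R β : ℝ} (hR : 0 ≤ R) (hβ : 0 ≤ β) {ι : Type*} (s : Finset ι) {f : ι → PowerSeries L}
    (h : ∀ i ∈ s, Bd R β (f i)) : Bd R β (∑ i ∈ s, f i) := by
  classical
  induction s using Finset.induction_on with
  | empty => simpa using zero hβ
  | insert a s ha ih =>
    rw [Finset.sum_insert ha]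
    exact (h a (by simp)).add hR (ih fun i hi => h i (by simp [hi]))

theorem mul {R β γ : ℝ} (hR : 0 ≤ R) {f g : PowerSeries L} (hf : Bd R β f) (hg : Bd R γ g) :
    Bd R (β * γ) (f * g) := fun k => by
  rw [PowerSeries.coeff_mul]
  have h0 := hf.nonneg
  have h1 := hg.nonneg
  rcases hR.eq_or_lt with h | h
  · subst h
    rcases Nat.eq_zero_or_pos k with rfl | hk
    · have a := hf 0
      have b := hg 0
      simp only [pow_zero, mul_one] at a b
      simp only [Finset.Nat.antidiagonal_zero, Finset.sum_singleton, norm_mul, pow_zero, mul_one]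
      exact mul_le_mul a b (norm_nonneg _) h0
    · rw [zero_pow hk.ne', mul_zero]; positivity
  · rw [← le_div_iff₀ (by positivity)]
    refine IsUltrametricDist.norm_sum_le_of_forall_le_of_nonneg (by positivity) ?_
    intro i hi
    rw [le_div_iff₀ (by positivity), norm_mul, ← (Finset.HasAntidiagonal.mem_antidiagonal.1 hi), pow_add]
    calc _ = (‖PowerSeries.coeff i.1 f‖ * R ^ i.1) * (‖PowerSeries.coeff i.2 g‖ * R ^ i.2) := by ring
      _ ≤ _ := mul_le_mul (hf _) (hg _) (by positivity) h0

theorem pow {R β : ℝ} (hR : 0 ≤ R) {f : PowerSeries L} (hf : Bd R β f) (n : ℕ) :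
    Bd R (β ^ n) (f ^ n) := by
  induction n with
  | zero => simpa using one
  | succ n ih => rw [pow_succ, pow_succ]; exact ih.mul hR hf

theorem sg {Fq : Type*} [Field Fq] [Fintype Fq] [Algebra Fq L] {R β : ℝ} (hR : 0 ≤ R)
    {f : PowerSeries L} (hf : Bd R β f) (n : ℕ) :
    Bd (R ^ Fintype.card Fq ^ n) (β ^ Fintype.card Fq ^ n) (sg Fq n f) := fun k => by
  rw [coeff_sg, norm_pow, ← pow_mul, mul_comm _ k, pow_mul, ← mul_pow]
  exact pow_le_pow_left₀ (by positivity) (hf k) _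

/-- Inverse of a power series with constant coefficient dominating. -/
theorem of_mul_eq {R γ β : ℝ} (hR : 0 < R) {f g h : PowerSeries L} (hγ : 0 < γ)
    (h0 : ‖PowerSeries.coeff 0 f‖ = γ) (hf : Bd R γ f) (hh : Bd R (γ * β) h) (e : f * g = h) :
    Bd R β g := by
  intro k
  induction k using Nat.strong_induction_on with
  | _ k ih =>
    have hk := congrArg (PowerSeries.coeff k) e
    rw [PowerSeries.coeff_mul, Finset.Nat.sum_antidiagonal_eq_sum_range_succ_mk,
      Finset.sum_range_succ'] at hk
    simp only [Nat.sub_zero] at hk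
    have hk' : PowerSeries.coeff 0 f * PowerSeries.coeff k g = PowerSeries.coeff k h -
      ∑ i ∈ Finset.range k, PowerSeries.coeff (i + 1) f * PowerSeries.coeff (k - (i + 1)) g := by
      rw [← hk]; ring
    have hβ : 0 ≤ β := by
      have := hh.nonneg
      by_contra hc
      push Not at hc
      nlinarith
    have hb : ‖PowerSeries.coeff 0 f * PowerSeries.coeff k g‖ ≤ γ * β / R ^ k := by
      rw [hk', sub_eq_add_neg]
      refine le_trans (IsUltrametricDist.norm_add_le_max _ _) (max_le ?_ ?_)
      · rw [le_div_iff₀ (by positivity)]; exact hh k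
      · rw [norm_neg]
        refine IsUltrametricDist.norm_sum_le_of_forall_le_of_nonneg (by positivity) ?_
        intro i hi
        have hi' := Finset.mem_range.1 hi
        rw [le_div_iff₀ (by positivity), norm_mul]
        have e1 : R ^ k = R ^ (i + 1) * R ^ (k - (i + 1)) := by
          rw [← pow_add]; congr 1; omega
        rw [e1]
        calc _ = (‖PowerSeries.coeff (i+1) f‖ * R ^ (i+1)) *
              (‖PowerSeries.coeff (k-(i+1)) g‖ * R ^ (k-(i+1))) := by ring
          _ ≤ _ := mul_le_mul (hf _) (ih _ (by omega)) (by positivity) hγ.le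
    rw [norm_mul, h0, le_div_iff₀ (by positivity), mul_assoc] at hb
    exact le_of_mul_le_mul_left hb hγ

end Bd

theorem summable_norm_ev {R β : ℝ} {f : PowerSeries L} (h : Bd R β f) {a : L} (ha : ‖a‖ < R) :
    Summable fun k => ‖PowerSeries.coeff k f * a ^ k‖ := by
  have hR : 0 < R := lt_of_le_of_lt (norm_nonneg _) ha
  refine Summable.of_nonneg_of_le (fun _ => norm_nonneg _) (fun k => ?_)
    ((summable_geometric_of_lt_one (r := ‖a‖ / R) (by positivity) ((div_lt_one hR).2 ha)).mul_left β)
  rw [norm_mul, norm_pow, div_pow, mul_div_assoc', le_div_iff₀ (by positivity)]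
  calc _ = (‖PowerSeries.coeff k f‖ * R ^ k) * ‖a‖ ^ k := by ring
    _ ≤ _ := mul_le_mul_of_nonneg_right (h k) (by positivity)

section ev
variable [CompleteSpace L] [IsUltrametricDist L]

theorem ev_add {R β γ : ℝ} {f g : PowerSeries L} (hf : Bd R β f) (hg : Bd R γ g) {a : L}
    (ha : ‖a‖ < R) : ev a (f + g) = ev a f + ev a g := by
  rw [ev, ev, ev, ← (summable_norm_ev hf ha).of_norm.tsum_add (summable_norm_ev hg ha).of_norm]
  simp [add_mul]

theorem ev_mul {R β γ : ℝ} {f g : PowerSeries L} (hf : Bd R β f) (hg : Bd R γ g) {a : L}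
    (ha : ‖a‖ < R) : ev a (f * g) = ev a f * ev a g := by
  rw [ev, ev, ev, tsum_mul_tsum_eq_tsum_sum_antidiagonal_of_summable_norm
    (summable_norm_ev hf ha) (summable_norm_ev hg ha)]
  refine tsum_congr fun n => ?_
  rw [PowerSeries.coeff_mul, Finset.sum_mul]
  refine Finset.sum_congr rfl fun i hi => ?_
  rw [← Finset.HasAntidiagonal.mem_antidiagonal.1 hi, pow_add]; ring

theorem ev_poly (a : L) (f : Polynomial L) : ev a (f : PowerSeries L) = f.eval a := by
  rw [ev, Polynomial.eval_eq_sum_range, tsum_eq_sum (s := Finset.range (f.natDegree + 1))]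
  · simp
  · intro b hb
    simp at hb
    simp [Polynomial.coeff_eq_zero_of_natDegree_lt (show f.natDegree < b by omega)]

theorem ev_zero (a : L) : ev a (0 : PowerSeries L) = 0 := by simp [ev]
theorem ev_one (a : L) : ev a (1 : PowerSeries L) = 1 := by
  have := ev_poly a (1 : Polynomial L); simpa using this
theorem ev_C (a c : L) : ev a (PowerSeries.C c) = c := by
  have := ev_poly a (Polynomial.C c); simpa using this
theorem ev_X (a : L) : ev a PowerSeries.X = a := by
  have := ev_poly a (Polynomial.X); simpa using this

theorem ev_sum {R : ℝ} {a : L} (ha : ‖a‖ < R) {ι : Type*} (s : Finset ι)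
    {f : ι → PowerSeries L} {β : ι → ℝ} (h : ∀ i ∈ s, Bd R (β i) (f i)) :
    ev a (∑ i ∈ s, f i) = ∑ i ∈ s, ev a (f i) := by
  rw [ev]
  simp only [map_sum, Finset.sum_mul]
  rw [Summable.tsum_finsetSum fun i hi => (summable_norm_ev (h i hi) ha).of_norm]
  rfl

theorem ev_pow {R β : ℝ} {f : PowerSeries L} (hf : Bd R β f) {a : L} (ha : ‖a‖ < R) (n : ℕ) :
    ev a (f ^ n) = ev a f ^ n := by
  have hR : 0 ≤ R := (norm_nonneg a).trans ha.le
  induction n with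
  | zero => simp [ev_one]
  | succ n ih => rw [pow_succ, pow_succ, ev_mul (hf.pow hR n) hf ha, ih]

theorem norm_ev_le {R β : ℝ} {f : PowerSeries L} (hf : Bd R β f) {a : L} (ha : ‖a‖ ≤ R) :
    ‖ev a f‖ ≤ β := by
  refine IsUltrametricDist.norm_tsum_le_of_forall_le fun k => ?_
  rw [norm_mul, norm_pow]
  exact le_trans (mul_le_mul_of_nonneg_left (pow_le_pow_left₀ (norm_nonneg _) ha k) (norm_nonneg _)) (hf k)

theorem ev_sg {Fq : Type*} [Field Fq] [Fintype Fq] [Algebra Fq L] {R β : ℝ}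
    {f : PowerSeries L} (hf : Bd R β f) {a : L} (ha : ‖a‖ < R) (n : ℕ) :
    ev (a ^ Fintype.card Fq ^ n) (sg Fq n f) = ev a f ^ Fintype.card Fq ^ n := by
  have hc : Continuous (frk Fq L n) := by
    have : (frk Fq L n : L → L) = fun x => x ^ Fintype.card Fq ^ n := by
      funext x; exact frk_apply Fq L n x
    rw [this]; fun_prop
  rw [← frk_apply Fq L n, ← frk_apply Fq L n, ev, ev,
    (summable_norm_ev hf ha).of_norm.map_tsum (frk Fq L n) hc]
  refine tsum_congr fun k => ?_
  rw [coeff_sg, map_mul, map_pow, frk_apply Fq L n (PowerSeries.coeff k f)]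

/-- Division by `t - a` at a zero `a`. -/
theorem ev_div {R β : ℝ} {E : PowerSeries L} (hE : Bd R β E) {a : L} (ha : ‖a‖ < R)
    (h0 : ev a E = 0) :
    ∃ G : PowerSeries L, E = (PowerSeries.X - PowerSeries.C a) * G ∧ Bd R (β / R) G := by
  have hR : 0 < R := lt_of_le_of_lt (norm_nonneg _) ha
  have hs : ∀ i, Summable fun l => PowerSeries.coeff (l + i) E * a ^ l := by
    intro i
    by_cases ha0 : a = 0
    · subst ha0
      refine summable_of_ne_finset_zero (s := {0}) fun l hl => ?_
      simp only [Finset.mem_singleton] at hl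
      simp [hl]
    · have := (summable_nat_add_iff i).2 (summable_norm_ev hE ha).of_norm
      refine (this.mul_right ((a ^ i)⁻¹)).congr fun l => ?_
      rw [pow_add]; field_simp
  set G : PowerSeries L := PowerSeries.mk fun i => ∑' l, PowerSeries.coeff (l + (i + 1)) E * a ^ l with hG
  have key : ∀ i, (∑' l, PowerSeries.coeff (l + i) E * a ^ l) =
      PowerSeries.coeff i E + a * PowerSeries.coeff i G := by
    intro i
    rw [(hs i).tsum_eq_zero_add, hG, PowerSeries.coeff_mk, ← tsum_mul_left]
    congr 1
    · simp
    · refine tsum_congr fun l => ?_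
      rw [pow_succ, show l + 1 + i = l + (i + 1) by ring]; ring
  refine ⟨G, ?_, ?_⟩
  · ext i
    rw [sub_mul, map_sub, PowerSeries.coeff_C_mul]
    cases i with
    | zero =>
      have := key 0
      rw [ev] at h0
      simp only [add_zero] at this
      rw [h0] at this
      rw [PowerSeries.coeff_zero_X_mul]
      linear_combination -this
    | succ i =>
      rw [PowerSeries.coeff_succ_X_mul]
      have := key (i + 1)
      have h2 : PowerSeries.coeff i G = ∑' l, PowerSeries.coeff (l + (i + 1)) E * a ^ l := by
        rw [hG, PowerSeries.coeff_mk]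
      rw [h2, this]; ring
  · intro k
    rw [hG, PowerSeries.coeff_mk, le_div_iff₀ hR, mul_assoc, ← pow_succ, ← le_div_iff₀ (by positivity)]
    refine IsUltrametricDist.norm_tsum_le_of_forall_le fun l => ?_
    rw [le_div_iff₀ (by positivity), norm_mul, norm_pow]
    calc _ ≤ ‖PowerSeries.coeff (l + (k + 1)) E‖ * R ^ l * R ^ (k + 1) := by gcongr
      _ = ‖PowerSeries.coeff (l + (k + 1)) E‖ * R ^ (l + (k + 1)) := by rw [pow_add R l]; ring
      _ ≤ β := hE _

end ev
end bd

section poly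
variable (Fq : Type*) {L : Type*} [Field Fq] [Fintype Fq] [NormedField L] [Algebra Fq L]
  [Algebra (Polynomial Fq) L] [KInf Fq L]
local notation "q" => Fintype.card Fq

theorem ev_emb (a : Polynomial Fq) (f : Polynomial (Polynomial Fq)) :
    ev (algebraMap (Polynomial Fq) L a) (emb Fq L f) = algebraMap (Polynomial Fq) L (f.eval a) := by
  have := KInf.complete (L := L) Fq
  have := KInf.ultra (L := L) Fq
  rw [emb, RingHom.comp_apply, Polynomial.coeToPowerSeries.ringHom_apply, ev_poly,
    Polynomial.coe_mapRingHom, Polynomial.eval_map_algebraMap, Polynomial.aeval_algebraMap_apply]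
  simp

theorem Bd_emb {R : ℝ} (hR : 1 ≤ R) (f : Polynomial (Polynomial Fq)) (x d : ℕ)
    (hd : f.natDegree ≤ d) (hx : ∀ k, (f.coeff k).natDegree ≤ x) :
    Bd R ((q : ℝ) ^ x * R ^ d) (emb Fq L f) := by
  intro k
  have hq := q_posR Fq
  rw [coeff_emb]
  by_cases h : d < k
  · rw [Polynomial.coeff_eq_zero_of_natDegree_lt (by omega)]
    simp; positivity
  · exact mul_le_mul (norm_alg_le Fq _ _ (hx k)) (pow_le_pow_right₀ hR (by omega))
      (by positivity) (by positivity)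
end poly
end CY

namespace CY

theorem siegel (F : Type*) [Field F] {κ τ : Type*} [Fintype κ] [Fintype τ] (n : κ → ℕ) (m : τ → ℕ)
    (T : (κ → Polynomial F) →ₗ[F] (τ → Polynomial F))
    (hT : ∀ u : κ → Polynomial F, (∀ k, u k ∈ Polynomial.degreeLT F (n k)) →
      ∀ t, T u t ∈ Polynomial.degreeLT F (m t))
    (hlt : ∑ t, m t < ∑ k, n k) :
    ∃ u : κ → Polynomial F, u ≠ 0 ∧ (∀ k, u k ∈ Polynomial.degreeLT F (n k)) ∧ T u = 0 := by
  let V := ∀ k, Polynomial.degreeLT F (n k)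
  let W := ∀ t, Polynomial.degreeLT F (m t)
  let inc : V →ₗ[F] (κ → Polynomial F) :=
    { toFun := fun v k => (v k : Polynomial F)
      map_add' := fun v w => rfl
      map_smul' := fun c v => rfl }
  let G : V →ₗ[F] W :=
    { toFun := fun v t => ⟨T (inc v) t, hT _ (fun k => (v k).2) t⟩
      map_add' := fun v w => by
        funext t; apply Subtype.ext
        simp
        rfl
      map_smul' := fun c v => by
        funext t; apply Subtype.ext
        simp
        rfl }
  have : ∀ a, Module.Finite F (Polynomial.degreeLT F a) := fun a =>
    Module.Finite.equiv (Polynomial.degreeLTEquiv F a).symm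
  have fr : ∀ a, Module.finrank F (Polynomial.degreeLT F a) = a := fun a => by
    rw [LinearEquiv.finrank_eq (Polynomial.degreeLTEquiv F a)]; simp
  have h1 : Module.finrank F V = ∑ k, n k := by
    rw [Module.finrank_pi_fintype]; exact Finset.sum_congr rfl fun k _ => fr _
  have h2 : Module.finrank F W = ∑ t, m t := by
    rw [Module.finrank_pi_fintype]; exact Finset.sum_congr rfl fun k _ => fr _
  have h3 : LinearMap.ker G ≠ ⊥ := by
    apply LinearMap.ker_ne_bot_of_finrank_lt
    rw [h1, h2]; exact hlt
  obtain ⟨v, hv, hv0⟩ := Submodule.exists_mem_ne_zero_of_ne_bot h3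
  refine ⟨inc v, ?_, fun k => (v k).2, ?_⟩
  · intro h
    apply hv0
    funext k; apply Subtype.ext
    exact congrFun h k
  · funext t
    have := congrFun (LinearMap.mem_ker.1 hv) t
    exact congrArg Subtype.val this

theorem mem_degLT {F : Type*} [Field F] {n : ℕ} {a : Polynomial F} (hn : 0 < n) :
    a ∈ Polynomial.degreeLT F n ↔ a.natDegree < n := by
  rw [Polynomial.mem_degreeLT]
  by_cases h : a = 0
  · subst h; simp [hn]
  · rw [Polynomial.natDegree_lt_iff_degree_lt h]

section zeros
variable {L : Type*} [NormedField L] [CompleteSpace L] [IsUltrametricDist L]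

theorem zeros_bound {R : ℝ} (a : ℕ → L) (ha : Function.Injective a) (ha0 : ∀ j, a j ≠ 0) (n : ℕ) :
    ∀ (N : ℕ) (E : PowerSeries L) (β : ℝ), Bd R β E → (∀ j < N, ‖a j‖ < R) →
      (∀ j < N, ev (a j) E = 0) → (∀ m < n, PowerSeries.coeff m E = 0) →
      ‖PowerSeries.coeff n E‖ * R ^ n ≤ (∏ j ∈ Finset.range N, ‖a j‖) * (β / R ^ N) := by
  intro N
  induction N with
  | zero => intro E β hE _ _ _; simpa using hE n
  | succ N ih =>
    intro E β hE haR hz hn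
    obtain ⟨G, hG, hGb⟩ := ev_div hE (haR N (by omega)) (hz N (by omega))
    have hRpos : 0 < R := lt_of_le_of_lt (norm_nonneg _) (haR N (by omega))
    have hlin : ∃ γ, Bd R γ (PowerSeries.X - PowerSeries.C (a N) : PowerSeries L) := by
      have h1 : Bd R R (PowerSeries.X : PowerSeries L) := by
        intro k
        rw [PowerSeries.coeff_X]
        split_ifs with h
        · simp [h]
        · simpa using hRpos.le
      have h2 : Bd R R (PowerSeries.C (a N) : PowerSeries L) := Bd.const _ (haR N (by omega)).le
      exact ⟨R, h1.sub hRpos.le h2⟩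
    obtain ⟨γ, hγ⟩ := hlin
    have h1 : Bd R γ (PowerSeries.C (a N) : PowerSeries L) → True := fun _ => trivial
    have hGz : ∀ j < N, ev (a j) G = 0 := by
      intro j hj
      have h := hz j (by omega)
      rw [hG, ev_mul hγ hGb (haR j (by omega))] at h
      have e1 : ev (a j) (PowerSeries.X - PowerSeries.C (a N) : PowerSeries L) = a j - a N := by
        have := ev_poly (a j) (Polynomial.X - Polynomial.C (a N) : Polynomial L)
        simpa using this
      rw [e1] at h
      rcases mul_eq_zero.1 h with h | h
      · exact absurd (ha (sub_eq_zero.1 h)) (by omega)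
      · exact h
    have hco : ∀ m, PowerSeries.coeff m E =
        (if m = 0 then 0 else PowerSeries.coeff (m - 1) G) - a N * PowerSeries.coeff m G := by
      intro m
      rw [hG, sub_mul, map_sub, PowerSeries.coeff_C_mul]
      cases m with
      | zero => simp
      | succ m => rw [PowerSeries.coeff_succ_X_mul]; simp
    have hGn : ∀ m < n, PowerSeries.coeff m G = 0 := by
      intro m
      induction m with
      | zero =>
        intro hm
        have := hn 0 hm
        rw [hco] at this
        simpa [ha0] using this
      | succ m ih2 =>
        intro hm
        have h := hn (m + 1) hm
        rw [hco] at h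
        simp [ih2 (by omega), ha0] at h
        exact h
    have hEn : PowerSeries.coeff n E = - (a N * PowerSeries.coeff n G) := by
      rw [hco]
      split_ifs with h
      · simp
      · rw [hGn (n - 1) (by omega)]; simp
    have := ih G (β / R) hGb (fun j hj => haR j (by omega)) hGz hGn
    rw [hEn, norm_neg, norm_mul, Finset.prod_range_succ]
    calc _ = ‖a N‖ * (‖PowerSeries.coeff n G‖ * R ^ n) := by ring
      _ ≤ ‖a N‖ * ((∏ j ∈ Finset.range N, ‖a j‖) * (β / R / R ^ N)) :=
        mul_le_mul_of_nonneg_left this (norm_nonneg _)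
      _ = _ := by rw [pow_succ, div_div, mul_comm R]; ring

end zeros

theorem coeff_mul_low {R : Type*} [CommRing R] {f g : PowerSeries R} {m n : ℕ}
    (hf : ∀ i < m, PowerSeries.coeff i f = 0) (hg : ∀ i < n, PowerSeries.coeff i g = 0) :
    PowerSeries.coeff (m + n) (f * g) = PowerSeries.coeff m f * PowerSeries.coeff n g := by
  rw [PowerSeries.coeff_mul]
  refine Finset.sum_eq_single_of_mem (m, n) (by simp) ?_
  rintro ⟨a, b⟩ hab hne
  have hab' : a + b = m + n := by simpa using hab
  rcases lt_trichotomy a m with h | h | h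
  · simp [hf a h]
  · exfalso; apply hne; ext <;> simp <;> omega
  · simp [hg b (by omega)]

section lin
variable (Fq : Type*) {L : Type*} [Field Fq] [Fintype Fq] [NormedField L] [Algebra Fq L]
  [Algebra (Polynomial Fq) L] [KInf Fq L]
local notation "q" => Fintype.card Fq

theorem additive_lower {l X : ℕ} (α : ℕ → Polynomial Fq) (hα : ∃ i ≤ l, α i ≠ 0)
    (hX : ∀ i, (α i).natDegree ≤ X) {e : L} (he : e ≠ 0) (he1 : ‖e‖ ≤ 1)
    (h : ∑ i ∈ Finset.range (l + 1), algebraMap (Polynomial Fq) L (α i) * e ^ q ^ i = 0) :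
    1 ≤ (q : ℝ) ^ X * ‖e‖ := by
  classical
  have := KInf.ultra (L := L) Fq
  have hex : ∃ i, i ≤ l ∧ α i ≠ 0 := hα
  set i0 := Nat.find hex with hi0
  obtain ⟨h1, h2⟩ := Nat.find_spec hex
  rw [← hi0] at h1 h2
  have hmin : ∀ i < i0, α i = 0 := by
    intro i hi
    have := Nat.find_min hex hi
    by_contra hc
    exact this ⟨by omega, hc⟩
  have hpos : 0 < ‖e‖ := norm_pos_iff.2 he
  rw [← Finset.add_sum_erase _ _ (Finset.mem_range.2 (show i0 < l + 1 by omega))] at h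
  have h3 : ‖algebraMap (Polynomial Fq) L (α i0) * e ^ q ^ i0‖ ≤
      (q : ℝ) ^ X * ‖e‖ ^ (q ^ i0 + 1) := by
    rw [eq_neg_of_add_eq_zero_left h, norm_neg]
    have hq := q_posR Fq
    refine IsUltrametricDist.norm_sum_le_of_forall_le_of_nonneg (by positivity) ?_
    intro i hi
    rcases Finset.mem_erase.1 hi with ⟨hne, -⟩
    rcases lt_or_gt_of_ne hne with hlt | hgt
    · rw [hmin i hlt]; simp; positivity
    · rw [norm_mul, norm_pow]
      refine mul_le_mul (norm_alg_le Fq _ _ (hX i)) ?_ (by positivity) (by positivity)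
      exact pow_le_pow_of_le_one hpos.le he1 (Nat.pow_lt_pow_right (one_lt_q Fq) hgt)
  rw [norm_mul, norm_pow, KInf.norm_alg _ h2, pow_succ] at h3
  have h4 : (1 : ℝ) ≤ (q : ℝ) ^ (α i0).natDegree := one_le_pow₀ (one_lt_qR Fq).le
  have h5 : 0 < ‖e‖ ^ q ^ i0 := by positivity
  nlinarith

variable {ι : Type*} [Fintype ι] [DecidableEq ι]

open Matrix in
theorem li_sg {ψ : ι → PowerSeries L} {Φ : Matrix ι ι (Polynomial (Polynomial Fq))}
    (hσ : ∀ i, sg Fq 1 (ψ i) = ∑ j, emb Fq L (Φ i j) * ψ j) (hdet : Φ.det ≠ 0)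
    (hli : ∀ c : ι → Polynomial (Polynomial Fq), ∑ i, emb Fq L (c i) * ψ i = 0 → c = 0) (k : ℕ) :
    ∀ c : ι → Polynomial (Polynomial Fq), ∑ i, emb Fq L (c i) * sg Fq k (ψ i) = 0 → c = 0 := by
  induction k with
  | zero => simpa [sg_zero] using hli
  | succ k ih =>
    intro c hc
    have e1 : ∀ i, sg Fq (k + 1) (ψ i) = ∑ j, emb Fq L (sp Fq k (Φ i j)) * sg Fq k (ψ j) := by
      intro i
      rw [← sg_sg, hσ, map_sum]
      refine Finset.sum_congr rfl fun j _ => ?_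
      rw [map_mul, emb_sp]
    have h2 : (c ᵥ* (Φ.map (sp Fq k))) = 0 := by
      apply ih
      rw [← hc]
      simp only [e1, Finset.mul_sum]
      rw [Finset.sum_comm]
      refine Finset.sum_congr rfl fun j _ => ?_
      simp only [vecMul, dotProduct, Matrix.map_apply, map_sum, map_mul, Finset.sum_mul]
      refine Finset.sum_congr rfl fun i _ => by ring
    refine Matrix.eq_zero_of_vecMul_eq_zero ?_ h2
    have : (Φ.map (sp Fq k)).det = sp Fq k Φ.det := by
      rw [RingHom.map_det]; rfl
    rw [this]
    intro h
    exact hdet (sp_injective Fq k (by rw [h, map_zero]))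

end lin
end CY

namespace CY
section abp
variable (Fq : Type*) {L : Type*} [Field Fq] [Fintype Fq] [NormedField L] [Algebra Fq L]
  [Algebra (Polynomial Fq) L] [KInf Fq L]
local notation "q" => Fintype.card Fq
local notation "At" => Polynomial (Polynomial Fq)
local notation "θ" => (Polynomial.X : Polynomial Fq)

/-- bidegree bound -/
def BD (x d : ℕ) (f : Polynomial (Polynomial Fq)) : Prop :=
  f.natDegree ≤ d ∧ ∀ k, (f.coeff k).natDegree ≤ x

variable {Fq} in
theorem BD.mono {x d x' d' : ℕ} {f : At} (h : BD Fq x d f) (hx : x ≤ x') (hd : d ≤ d') :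
    BD Fq x' d' f := ⟨h.1.trans hd, fun k => (h.2 k).trans hx⟩

variable {Fq} in
theorem BD.mul {x d x' d' : ℕ} {f g : At} (h : BD Fq x d f) (h' : BD Fq x' d' g) :
    BD Fq (x + x') (d + d') (f * g) := by
  refine ⟨Polynomial.natDegree_mul_le.trans (add_le_add h.1 h'.1), fun k => ?_⟩
  rw [Polynomial.coeff_mul]
  refine Polynomial.natDegree_sum_le_of_forall_le _ _ fun i _ => ?_
  exact Polynomial.natDegree_mul_le.trans (add_le_add (h.2 _) (h'.2 _))

variable {Fq} in
theorem BD.sum {x d : ℕ} {ι : Type*} (s : Finset ι) {f : ι → At} (h : ∀ i ∈ s, BD Fq x d (f i)) :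
    BD Fq x d (∑ i ∈ s, f i) := by
  refine ⟨Polynomial.natDegree_sum_le_of_forall_le _ _ fun i hi => (h i hi).1, fun k => ?_⟩
  rw [Polynomial.finsetSum_coeff]
  exact Polynomial.natDegree_sum_le_of_forall_le _ _ fun i hi => (h i hi).2 k

variable {Fq} in
theorem BD.sp {x d : ℕ} {f : At} (h : BD Fq x d f) (k : ℕ) : BD Fq (q ^ k * x) d (sp Fq k f) := by
  refine ⟨?_, fun n => ?_⟩
  · rw [CY.sp]; exact (Polynomial.natDegree_map_le).trans h.1
  · rw [coeff_sp]
    exact Polynomial.natDegree_pow_le.trans (Nat.mul_le_mul_left _ (h.2 n))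

theorem BD.exists (f : At) : ∃ c, BD Fq c c f := by
  refine ⟨f.natDegree + ∑ k ∈ f.support, (f.coeff k).natDegree, by omega, fun k => ?_⟩
  by_cases h : k ∈ f.support
  · have := Finset.single_le_sum (f := fun k => (f.coeff k).natDegree) (fun _ _ => Nat.zero_le _) h
    omega
  · simp [Polynomial.notMem_support_iff.1 h]

variable {Fq} in
theorem BD.eval {x d : ℕ} {f : At} (h : BD Fq x d f) (e : ℕ) :
    (f.eval (θ ^ e)).natDegree ≤ x + d * e := by
  rw [Polynomial.eval_eq_sum_range]
  refine Polynomial.natDegree_sum_le_of_forall_le _ _ fun i hi => ?_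
  refine Polynomial.natDegree_mul_le.trans (add_le_add (h.2 i) ?_)
  rw [← pow_mul, Polynomial.natDegree_X_pow, mul_comm]
  exact Nat.mul_le_mul_right _ (le_trans (by have := Finset.mem_range.1 hi; omega) h.1)

variable {ι : Type*} [Fintype ι] [DecidableEq ι]

/-- exists a uniform bidegree bound for a finite matrix -/
theorem BD.exists_mat (Φ : Matrix ι ι At) : ∃ c, ∀ i j, BD Fq c c (Φ i j) := by
  choose c hc using fun i j => BD.exists Fq (Φ i j)
  refine ⟨∑ i, ∑ j, c i j, fun i j => ?_⟩
  have h1 : c i j ≤ ∑ i, ∑ j, c i j :=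
    (Finset.single_le_sum (f := fun j => c i j) (fun _ _ => Nat.zero_le _) (Finset.mem_univ j)).trans
      (Finset.single_le_sum (f := fun i => ∑ j, c i j) (fun _ _ => Nat.zero_le _) (Finset.mem_univ i))
  exact (hc i j).mono h1 h1

open Matrix in
/-- the propagated relations -/
noncomputable def rel (Φ' : Matrix ι ι At) (ρ : ι → Polynomial Fq) : ℕ → (ι → Polynomial Fq)
  | 0 => ρ
  | k + 1 => rel Φ' ρ k ᵥ* (Φ'.map fun f => (sp Fq k f).eval θ)

theorem norm_theta : ‖algebraMap (Polynomial Fq) L θ‖ = q := by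
  rw [KInf.norm_alg _ Polynomial.X_ne_zero]; simp

open Matrix in
theorem rel_ne {Φ Φ' : Matrix ι ι At} {s : At} (hΦ : Φ' * Φ = s • (1 : Matrix ι ι At))
    (hs : ∀ k, (sp Fq k s).eval θ ≠ 0) {ρ : ι → Polynomial Fq} (hρ : ρ ≠ 0) (k : ℕ) :
    rel Fq Φ' ρ k ≠ 0 := by
  induction k with
  | zero => exact hρ
  | succ k ih =>
    intro h
    apply ih
    let φ : At →+* Polynomial Fq := (Polynomial.evalRingHom θ).comp (sp Fq k)
    have h1 : (Φ'.map φ) * (Φ.map φ) = (φ s) • (1 : Matrix ι ι (Polynomial Fq)) := by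
      rw [← Matrix.map_mul, hΦ]
      ext1 i j
      simp [Matrix.one_apply, apply_ite φ]
    have h2 : rel Fq Φ' ρ k ᵥ* (Φ'.map φ) = 0 := h
    have h3 : rel Fq Φ' ρ k ᵥ* ((Φ'.map φ) * (Φ.map φ)) = 0 := by
      rw [← Matrix.vecMul_vecMul, h2, Matrix.zero_vecMul]
    rw [h1, Matrix.vecMul_smul, Matrix.vecMul_one] at h3
    exact (smul_eq_zero.1 h3).resolve_left (hs k)

theorem rel_deg {Φ' : Matrix ι ι At} {c0 C : ℕ} (hc : ∀ i j, BD Fq c0 c0 (Φ' i j))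
    {ρ : ι → Polynomial Fq} (hρ : ∀ i, (ρ i).natDegree ≤ C) (hC : 2 * c0 ≤ C) (k : ℕ) (i : ι) :
    (rel Fq Φ' ρ k i).natDegree ≤ C * q ^ k := by
  induction k generalizing i with
  | zero => simpa [rel] using hρ i
  | succ k ih =>
    simp only [rel, Matrix.vecMul, dotProduct, Matrix.map_apply]
    refine Polynomial.natDegree_sum_le_of_forall_le _ _ fun j _ => ?_
    refine Polynomial.natDegree_mul_le.trans ?_
    have h1 := ((hc j i).sp k).eval 1
    rw [pow_one] at h1
    have h2 := ih j
    have hq : 2 ≤ q := one_lt_q Fq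
    have hk : 1 ≤ q ^ k := Nat.one_le_pow _ _ (q_pos Fq)
    calc _ ≤ C * q ^ k + (q ^ k * c0 + c0 * 1) := add_le_add h2 h1
      _ ≤ C * q ^ k + 2 * c0 * q ^ k := by nlinarith
      _ ≤ C * q ^ k + C * q ^ k := by gcongr
      _ ≤ C * q ^ k * q := by nlinarith [Nat.zero_le (C * q ^ k)]
      _ = _ := by rw [pow_succ]; ring

open Matrix in
theorem rel_rel {ψ : ι → PowerSeries L} {R0 B : ℝ} (hR0 : (q : ℝ) < R0)
    (hψ : ∀ i, Bd R0 B (ψ i)) {Φ Φ' : Matrix ι ι At} {s : At}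
    (hσ : ∀ i, sg Fq 1 (ψ i) = ∑ j, emb Fq L (Φ i j) * ψ j)
    (hΦ : Φ' * Φ = s • (1 : Matrix ι ι At)) {ρ : ι → Polynomial Fq}
    (h0 : ∑ i, algebraMap (Polynomial Fq) L (ρ i) * ev (algebraMap (Polynomial Fq) L θ) (ψ i) = 0)
    (k : ℕ) : ∑ i, algebraMap (Polynomial Fq) L (rel Fq Φ' ρ k i) *
      ev (algebraMap (Polynomial Fq) L θ) (sg Fq k (ψ i)) = 0 := by
  have := KInf.complete (L := L) Fq
  have := KInf.ultra (L := L) Fq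
  have hR1 : 1 ≤ R0 := (one_lt_qR Fq).le.trans hR0.le
  have hθ : ‖algebraMap (Polynomial Fq) L θ‖ < R0 := by rw [norm_theta]; exact hR0
  induction k with
  | zero => simpa [sg_zero, rel] using h0
  | succ k ih =>
    have e1 : ∀ i, ∑ j, emb Fq L (sp Fq k (Φ' i j)) * sg Fq (k + 1) (ψ j) =
        emb Fq L (sp Fq k s) * sg Fq k (ψ i) := by
      intro i
      have e2 : ∑ j, emb Fq L (Φ' i j) * sg Fq 1 (ψ j) = emb Fq L s * ψ i := by
        simp only [hσ, Finset.mul_sum]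
        rw [Finset.sum_comm]
        have : ∀ l, ∑ j, emb Fq L (Φ' i j) * (emb Fq L (Φ j l) * ψ l) =
            emb Fq L ((Φ' * Φ) i l) * ψ l := by
          intro l
          rw [Matrix.mul_apply, map_sum, Finset.sum_mul]
          refine Finset.sum_congr rfl fun j _ => ?_
          rw [map_mul, mul_assoc]
        simp only [this, hΦ, Matrix.smul_apply, Matrix.one_apply, smul_eq_mul, mul_ite, mul_one, mul_zero]
        rw [Finset.sum_eq_single i]
        · simp
        · intro b _ hb; simp [hb.symm]
        · simp
      have := congrArg (sg Fq k) e2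
      rw [map_sum, map_mul, ← emb_sp] at this
      rw [← this]
      refine Finset.sum_congr rfl fun j _ => ?_
      rw [map_mul, ← emb_sp, sg_sg]
    have hb : ∀ i k, ∃ β, Bd R0 β (sg Fq k (ψ i)) := fun i k =>
      ⟨_, ((hψ i).sg (Fq := Fq) (by linarith) k).mono (by linarith)
        (le_self_pow₀ hR1 (pow_pos (q_pos Fq) k).ne') le_rfl⟩
    choose b hb using hb
    have hbe : ∀ f : At, ∃ β, Bd R0 β (emb Fq L f) := fun f => by
      obtain ⟨c, hc⟩ := BD.exists Fq f
      exact ⟨_, Bd_emb Fq hR1 f c c hc.1 hc.2⟩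
    choose be hbe using hbe
    have e3 : ∀ i, ∑ j, algebraMap (Polynomial Fq) L ((sp Fq k (Φ' i j)).eval θ) *
        ev (algebraMap (Polynomial Fq) L θ) (sg Fq (k+1) (ψ j)) =
        algebraMap (Polynomial Fq) L ((sp Fq k s).eval θ) *
          ev (algebraMap (Polynomial Fq) L θ) (sg Fq k (ψ i)) := by
      intro i
      have := congrArg (ev (algebraMap (Polynomial Fq) L θ)) (e1 i)
      rw [ev_sum hθ Finset.univ (fun j _ => (hbe (sp Fq k (Φ' i j))).mul (by linarith) (hb j (k+1))),
        ev_mul (hbe _) (hb _ _) hθ, ev_emb] at this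
      rw [← this]
      refine Finset.sum_congr rfl fun j _ => ?_
      rw [ev_mul (hbe _) (hb _ _) hθ, ev_emb]
    calc _ = ∑ i, algebraMap (Polynomial Fq) L (rel Fq Φ' ρ k i) *
        (∑ j, algebraMap (Polynomial Fq) L ((sp Fq k (Φ' i j)).eval θ) *
        ev (algebraMap (Polynomial Fq) L θ) (sg Fq (k+1) (ψ j))) := by
          simp only [rel, Matrix.vecMul, dotProduct, Matrix.map_apply, map_sum, map_mul,
            Finset.sum_mul, Finset.mul_sum]
          rw [Finset.sum_comm]
          refine Finset.sum_congr rfl fun i _ => Finset.sum_congr rfl fun j _ => by ring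
      _ = algebraMap (Polynomial Fq) L ((sp Fq k s).eval θ) * ∑ i,
          algebraMap (Polynomial Fq) L (rel Fq Φ' ρ k i) *
          ev (algebraMap (Polynomial Fq) L θ) (sg Fq k (ψ i)) := by
          rw [Finset.mul_sum]
          refine Finset.sum_congr rfl fun i _ => ?_
          rw [e3]; ring
      _ = 0 := by rw [ih, mul_zero]

theorem sum_geom_le (N : ℕ) : ∑ j ∈ Finset.range N, q ^ j ≤ q ^ N := by
  have hq : 2 ≤ q := one_lt_q Fq
  induction N with
  | zero => simp
  | succ N ih => 
    rw [Finset.sum_range_succ, pow_succ]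
    have := Nat.mul_le_mul_left (q ^ N) hq
    omega

theorem natDegree_lt_or {F : Type*} [Field F] {n : ℕ} (hn : 0 < n) {a : Polynomial F}
    (h : a ∈ Polynomial.degreeLT F n) : a.natDegree ≤ n - 1 := by
  have := (mem_degLT hn).1 h; omega

/-- First Siegel step -/
theorem siegel1 (N d c C : ℕ) (hc : 0 < c) (r : ℕ → ι → Polynomial Fq) (hr0 : ∀ k, r k ≠ 0)
    (hr : ∀ k i, (r k i).natDegree ≤ C * q ^ k)
    (hcount : Fintype.card ι * N * (c + C) + Fintype.card ι * d <
      Fintype.card ι * (d + 1) * c + N * c) :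
    ∃ h : ι → At, h ≠ 0 ∧ (∀ i, BD Fq (c * q ^ N) d (h i)) ∧
      ∀ j < N, ∃ lam : Polynomial Fq, ∀ i, (h i).eval (θ ^ q ^ j) = lam * (r (N - j) i) ^ q ^ j := by
  classical
  set Q := q ^ N with hQ
  have hQpos : 0 < Q := pow_pos (q_pos Fq) N
  have hcQ : 0 < c * Q := Nat.mul_pos hc hQpos
  let T : ((ι × Fin (d + 1)) ⊕ Fin N → Polynomial Fq) →ₗ[Fq] (Fin N × ι → Polynomial Fq) :=
    { toFun := fun u p => (∑ m : Fin (d + 1), u (Sum.inl (p.2, m)) * θ ^ (q ^ (p.1 : ℕ) * (m : ℕ)))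
        - u (Sum.inr p.1) * (r (N - p.1) p.2) ^ q ^ (p.1 : ℕ)
      map_add' := fun u v => by
        funext p
        simp only [Pi.add_apply, add_mul, Finset.sum_add_distrib]
        ring
      map_smul' := fun a u => by
        funext p
        simp only [Pi.smul_apply, smul_mul_assoc, RingHom.id_apply, smul_sub, Finset.smul_sum] }
  obtain ⟨u, hu0, hu, hTu⟩ := siegel Fq (fun _ => c * Q)
    (fun p : Fin N × ι => (c + C) * Q + d * q ^ (p.1 : ℕ)) T (by
      intro u hu p
      rw [mem_degLT (by positivity)]
      have h1 : (∑ m : Fin (d + 1), u (Sum.inl (p.2, m)) * θ ^ (q ^ (p.1 : ℕ) * (m : ℕ))).natDegree ≤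
          (c * Q - 1) + d * q ^ (p.1 : ℕ) := by
        refine Polynomial.natDegree_sum_le_of_forall_le _ _ fun m _ => ?_
        refine Polynomial.natDegree_mul_le.trans (add_le_add (natDegree_lt_or hcQ (hu _)) ?_)
        rw [Polynomial.natDegree_X_pow, mul_comm]
        exact Nat.mul_le_mul_right _ (by omega)
      have h2 : (u (Sum.inr p.1) * (r (N - p.1) p.2) ^ q ^ (p.1 : ℕ)).natDegree ≤
          (c * Q - 1) + C * Q := by
        refine Polynomial.natDegree_mul_le.trans (add_le_add (natDegree_lt_or hcQ (hu _)) ?_)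
        refine Polynomial.natDegree_pow_le.trans ?_
        refine (Nat.mul_le_mul_left _ (hr _ _)).trans (le_of_eq ?_)
        rw [hQ, mul_comm, mul_assoc, ← pow_add]
        congr 2; have := p.1.2; omega
      refine lt_of_le_of_lt (Polynomial.natDegree_sub_le _ _) (max_lt ?_ ?_)
      · refine lt_of_le_of_lt h1 ?_
        rw [add_mul]; omega
      · refine lt_of_le_of_lt h2 ?_
        rw [add_mul]; omega) (by
      simp only [Finset.sum_const, Finset.card_univ, Fintype.card_sum, Fintype.card_prod, Fintype.card_fin,
        smul_eq_mul, Fintype.sum_prod_type]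
      rw [Finset.sum_congr rfl fun (x : Fin N) _ => (mul_add _ _ _), Finset.sum_add_distrib,
        Finset.sum_const, Finset.card_univ, Fintype.card_fin, ← Finset.mul_sum, ← Finset.mul_sum,
        Fin.sum_univ_eq_sum_range (fun j => q ^ j) N]
      have h1 := sum_geom_le Fq N
      rw [← hQ] at h1
      calc _ ≤ N • (Fintype.card ι * ((c + C) * Q)) + Fintype.card ι * (d * Q) := by gcongr
        _ = (Fintype.card ι * N * (c + C) + Fintype.card ι * d) * Q := by rw [smul_eq_mul]; ring
        _ < (Fintype.card ι * (d + 1) * c + N * c) * Q := Nat.mul_lt_mul_of_pos_right hcount hQpos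
        _ = _ := by ring)
  let h : ι → At := fun i => ∑ m : Fin (d + 1), Polynomial.C (u (Sum.inl (i, m))) * Polynomial.X ^ (m : ℕ)
  have hcoe : ∀ i, ∀ m : Fin (d + 1), (h i).coeff m = u (Sum.inl (i, m)) := by
    intro i m
    simp only [h, Polynomial.finsetSum_coeff, Polynomial.coeff_C_mul, Polynomial.coeff_X_pow]
    rw [Finset.sum_eq_single m]
    · simp
    · intro b _ hb
      rw [if_neg, mul_zero]
      intro h; exact hb (Fin.ext h.symm)
    · simp
  have hbd : ∀ i, BD Fq (c * Q) d (h i) := by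
    intro i
    refine BD.sum _ fun m _ => ?_
    refine ⟨(Polynomial.natDegree_C_mul_X_pow_le _ _).trans (by omega), fun k => ?_⟩
    rw [Polynomial.coeff_C_mul, Polynomial.coeff_X_pow]
    split_ifs
    · rw [mul_one]; have := natDegree_lt_or hcQ (hu (Sum.inl (i, m))); omega
    · simp
  have heval : ∀ (j : Fin N) i, (h i).eval (θ ^ q ^ (j : ℕ)) = u (Sum.inr j) * (r (N - j) i) ^ q ^ (j : ℕ) := by
    intro j i
    have := congrFun hTu (j, i)
    simp only [T, LinearMap.coe_mk, AddHom.coe_mk, Pi.zero_apply] at this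
    rw [← sub_eq_zero, ← this]
    simp only [h, Polynomial.eval_finsetSum, Polynomial.eval_mul, Polynomial.eval_C,
      Polynomial.eval_pow, Polynomial.eval_X, ← pow_mul]
  refine ⟨h, ?_, hbd, fun j hj => ⟨u (Sum.inr ⟨j, hj⟩), fun i => heval ⟨j, hj⟩ i⟩⟩
  intro hh
  apply hu0
  funext k
  rcases k with ⟨i, m⟩ | j
  · rw [← hcoe, hh]; simp
  · obtain ⟨i, hi⟩ := Function.ne_iff.1 (hr0 (N - j))
    have := heval j i
    rw [hh] at this
    simp only [Pi.zero_apply, Polynomial.eval_zero] at this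
    exact (mul_eq_zero.1 this.symm).resolve_right (pow_ne_zero _ hi)

/-- Second Siegel step -/
theorem siegel2 (l e d : ℕ) (hl : Fintype.card ι = l) (hl0 : 0 < l) (g : ℕ → ι → At)
    (hg : ∀ i ≤ l, ∀ j, BD Fq e d (g i j)) :
    ∃ a : ℕ → At, (∃ i ≤ l, a i ≠ 0) ∧ (∀ i n, ((a i).coeff n).natDegree ≤ 3 * l * (e + 1)) ∧
      ∀ j, ∑ i ∈ Finset.range (l + 1), a i * g i j = 0 := by
  classical
  set X := 3 * l * (e + 1) with hX
  set T := 3 * l * (d + 1) with hT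
  have hXp : 0 < X := by positivity
  let P : (Fin (l + 1) × Fin T → Polynomial Fq) → ℕ → At := fun u i =>
    if hi : i < l + 1 then ∑ m : Fin T, Polynomial.C (u (⟨i, hi⟩, m)) * Polynomial.X ^ (m : ℕ) else 0
  have hPadd : ∀ u v i, P (u + v) i = P u i + P v i := by
    intro u v i
    simp only [P]
    split_ifs
    · simp [add_mul, Finset.sum_add_distrib]
    · simp
  have hPsmul : ∀ (a : Fq) u i, P (a • u) i = a • P u i := by
    intro a u i
    simp only [P]
    split_ifs
    · rw [Finset.smul_sum]
      refine Finset.sum_congr rfl fun m _ => ?_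
      rw [Pi.smul_apply, ← Polynomial.smul_C, smul_mul_assoc]
    · simp
  let F : (Fin (l + 1) × Fin T → Polynomial Fq) →ₗ[Fq] (ι × Fin (T + d) → Polynomial Fq) :=
    { toFun := fun u p => (∑ i ∈ Finset.range (l + 1), P u i * g i p.1).coeff p.2
      map_add' := fun u v => by
        funext p
        simp only [hPadd, add_mul, Finset.sum_add_distrib, Polynomial.coeff_add, Pi.add_apply]
      map_smul' := fun a u => by
        funext p
        simp only [hPsmul, smul_mul_assoc, ← Finset.smul_sum, Polynomial.coeff_smul, Pi.smul_apply,
          RingHom.id_apply] }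
  have hPb : ∀ u, (∀ k, u k ∈ Polynomial.degreeLT Fq X) → ∀ i, BD Fq (X - 1) (T - 1) (P u i) := by
    intro u hu i
    simp only [P]
    split_ifs with hi
    · refine BD.sum _ fun m _ => ?_
      refine ⟨(Polynomial.natDegree_C_mul_X_pow_le _ _).trans (by omega), fun k => ?_⟩
      rw [Polynomial.coeff_C_mul, Polynomial.coeff_X_pow]
      split_ifs
      · rw [mul_one]; exact natDegree_lt_or hXp (hu _)
      · simp
    · exact ⟨by simp, by simp⟩
  have hTp : 0 < T := by positivity
  have hSb : ∀ u, (∀ k, u k ∈ Polynomial.degreeLT Fq X) → ∀ j,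
      BD Fq (X - 1 + e) (T - 1 + d) (∑ i ∈ Finset.range (l + 1), P u i * g i j) := by
    intro u hu j
    refine BD.sum _ fun i hi => (hPb u hu i).mul (hg i (by have := Finset.mem_range.1 hi; omega) j)
  obtain ⟨u, hu0, hu, hFu⟩ := siegel Fq (fun _ => X) (fun _ => X + e) F (by
      intro u hu p
      rw [mem_degLT (by omega)]
      have := (hSb u hu p.1).2 p.2
      refine lt_of_le_of_lt this (by omega)) (by
      simp only [Finset.sum_const, Finset.card_univ, Fintype.card_prod, Fintype.card_fin,
        smul_eq_mul, hl]
      have e1 : 3 * l * e + 3 * l = X := by rw [hX]; ring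
      have e2 : 3 * l * d + 3 * l = T := by rw [hT]; ring
      have h1 : 3 * l * e < X := by omega
      have h2 : 3 * l * d < T := by omega
      -- 9 l * (l (T+d)(X+e)) < 9 l (l+1) T X
      have h3 : (3 * l * (T + d)) * (3 * l * (X + e)) < ((3 * l + 1) * T) * ((3 * l + 1) * X) := by
        apply Nat.mul_lt_mul'' <;> nlinarith
      have h4 : (3 * l + 1) ^ 2 * (T * X) ≤ 9 * l * (l + 1) * (T * X) := by
        apply Nat.mul_le_mul_right; nlinarith
      nlinarith)
  refine ⟨P u, ?_, ?_, ?_⟩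
  · obtain ⟨⟨i, m⟩, him⟩ := Function.ne_iff.1 hu0
    refine ⟨i, by omega, fun h => him ?_⟩
    have := congrArg (fun f => Polynomial.coeff f (m : ℕ)) h
    simp only [P, i.2, dif_pos, Polynomial.finsetSum_coeff, Polynomial.coeff_C_mul,
      Polynomial.coeff_X_pow, Polynomial.coeff_zero] at this
    rw [Finset.sum_eq_single m] at this
    · simpa using this
    · intro b _ hb
      rw [if_neg, mul_zero]
      intro h; exact hb (Fin.ext h.symm)
    · simp
  · intro i n; exact ((hPb u hu i).2 n).trans (by omega)
  · intro j
    ext1 n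
    rw [Polynomial.coeff_zero]
    by_cases hn : n < T + d
    · exact congrFun hFu (j, ⟨n, hn⟩)
    · exact Polynomial.coeff_eq_zero_of_natDegree_lt (lt_of_le_of_lt (hSb u hu j).1 (by omega))

end abp
end CY

namespace CY
section abp
variable (Fq : Type*) {L : Type*} [Field Fq] [Fintype Fq] [NormedField L] [Algebra Fq L]
  [Algebra (Polynomial Fq) L] [KInf Fq L]
local notation "q" => Fintype.card Fq
local notation "At" => Polynomial (Polynomial Fq)
local notation "θ" => (Polynomial.X : Polynomial Fq)
variable {ι : Type*} [Fintype ι] [DecidableEq ι]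

/-- coefficient vectors of the Frobenius twists of the auxiliary function -/
noncomputable def gv (Φ : Matrix ι ι At) (N : ℕ) (h : ι → At) : ℕ → ι → At
  | 0 => h
  | i + 1 => fun j => ∑ m, sp Fq 1 (gv Φ N h i m) * sp Fq N (Φ m j)

theorem gv_bd {Φ : Matrix ι ι At} {c0 c d N : ℕ} (hc : ∀ i j, BD Fq c0 c0 (Φ i j)) {h : ι → At}
    (hh : ∀ i, BD Fq (c * q ^ N) d (h i)) (i : ℕ) (j : ι) :
    BD Fq ((c + c0) * q ^ i * q ^ N - c0 * q ^ N) (d + c0 * i) (gv Fq Φ N h i j) := by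
  induction i generalizing j with
  | zero => exact (hh j).mono (by rw [pow_zero, mul_one, add_mul]; omega) (by omega)
  | succ i ih =>
    simp only [gv]
    refine BD.sum _ fun m _ => ?_
    refine (((ih m).sp 1).mul ((hc m j).sp N)).mono ?_ (by rw [mul_add, mul_one]; omega)
    have hq : 2 ≤ q := one_lt_q Fq
    have h1 : c0 * q ^ N ≤ (c + c0) * q ^ i * q ^ N := by
      apply Nat.mul_le_mul_right
      have : 1 ≤ q ^ i := Nat.one_le_pow _ _ (q_pos Fq)
      nlinarith
    obtain ⟨y, hy⟩ := Nat.exists_eq_add_of_le h1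
    have e1 : (c + c0) * q ^ (i + 1) * q ^ N = (c0 * q ^ N + y) * q := by rw [← hy, pow_succ]; ring
    rw [e1, hy, Nat.add_sub_cancel_left]
    apply Nat.le_sub_of_add_le
    rw [pow_one, mul_comm (q ^ N) c0]
    nlinarith [Nat.mul_le_mul_left (c0 * q ^ N) hq]

theorem gv_sum {ψ : ι → PowerSeries L} {Φ : Matrix ι ι At}
    (hσ : ∀ i, sg Fq 1 (ψ i) = ∑ j, emb Fq L (Φ i j) * ψ j) (N : ℕ) (h : ι → At) (i : ℕ) :
    sg Fq i (∑ j, emb Fq L (h j) * sg Fq N (ψ j)) =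
      ∑ j, emb Fq L (gv Fq Φ N h i j) * sg Fq N (ψ j) := by
  induction i with
  | zero => simp [sg_zero, gv]
  | succ i ih =>
    rw [show i + 1 = 1 + i by ring, ← sg_sg, ih, map_sum, add_comm 1 i]
    have e1 : ∀ m, sg Fq 1 (sg Fq N (ψ m)) = ∑ j, emb Fq L (sp Fq N (Φ m j)) * sg Fq N (ψ j) := by
      intro m
      rw [sg_sg, add_comm, ← sg_sg, hσ, map_sum]
      refine Finset.sum_congr rfl fun j _ => ?_
      rw [map_mul, emb_sp]
    simp only [map_mul, e1, Finset.mul_sum, gv, map_sum, Finset.sum_mul]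
    rw [Finset.sum_comm]
    refine Finset.sum_congr rfl fun j _ => Finset.sum_congr rfl fun m _ => ?_
    simp only [emb_sp]
    ring

theorem abp {ψ : ι → PowerSeries L} {R0 B : ℝ} (hR0 : (q : ℝ) < R0) (hB : 1 ≤ B)
    (hψ : ∀ i, Bd R0 B (ψ i)) {Φ Φ' : Matrix ι ι At} {s : At}
    (hσ : ∀ i, sg Fq 1 (ψ i) = ∑ j, emb Fq L (Φ i j) * ψ j)
    (hΦ : Φ' * Φ = s • (1 : Matrix ι ι At)) (hs : ∀ k, (sp Fq k s).eval θ ≠ 0)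
    (hli : ∀ c : ι → At, ∑ i, emb Fq L (c i) * ψ i = 0 → c = 0)
    {ρ : ι → Polynomial Fq} (hρ : ρ ≠ 0)
    (h0 : ∑ i, algebraMap (Polynomial Fq) L (ρ i) * ev (algebraMap (Polynomial Fq) L θ) (ψ i) = 0) :
    False := by
  have := KInf.complete (L := L) Fq
  have := KInf.ultra (L := L) Fq
  have hq1 := one_lt_qR Fq
  have hq0 := q_posR Fq
  have hR1 : 1 < R0 := hq1.trans hR0
  have hR00 : 0 < R0 := by linarith
  obtain ⟨i₁, -⟩ := Function.ne_iff.1 hρ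
  obtain ⟨c1, hc1⟩ := BD.exists_mat Fq Φ
  obtain ⟨c2, hc2⟩ := BD.exists_mat Fq Φ'
  set c0 := c1 + c2 with hc0
  have hcΦ : ∀ i j, BD Fq c0 c0 (Φ i j) := fun i j => (hc1 i j).mono (by omega) (by omega)
  have hcΦ' : ∀ i j, BD Fq c0 c0 (Φ' i j) := fun i j => (hc2 i j).mono (by omega) (by omega)
  set C := 2 * c0 + ∑ i, (ρ i).natDegree with hC
  have hρC : ∀ i, (ρ i).natDegree ≤ C := fun i => by
    have := Finset.single_le_sum (f := fun i => (ρ i).natDegree) (fun _ _ => Nat.zero_le _) (Finset.mem_univ i)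
    omega
  set l := Fintype.card ι with hl
  have hl0 : 0 < l := Fintype.card_pos_iff.2 ⟨i₁⟩
  set c := 2 * l * (C + 1) with hc
  have hcpos : 0 < c := by positivity
  set X0 := 3 * l * ((c + c0) * q ^ l + 1) with hX0
  -- choose M
  obtain ⟨M, hM⟩ := pow_unbounded_of_one_lt ((q : ℝ) ^ (X0 + c + 1) * B) hR1
  set N := 2 * l * M with hN
  set d := (2 * l - 1) * M with hd
  have hNd : N = d + M := by
    rw [hN, hd]
    have : 2 * l = (2 * l - 1) + 1 := by omega
    conv_lhs => rw [this]
    ring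
  set Q := q ^ N with hQ
  have hQ1 : 1 ≤ Q := Nat.one_le_pow _ _ (q_pos Fq)
  obtain ⟨h, hne, hbd, hev⟩ := siegel1 Fq N d c C hcpos (rel Fq Φ' ρ) (rel_ne Fq hΦ hs hρ)
    (rel_deg Fq hcΦ' hρC (by omega)) (by
      rw [← hl]
      have e : d + M = 2 * l * M := by omega
      have h1 : l * d ≤ 2 * l * l * M := by
        have : d ≤ 2 * l * M := by omega
        calc l * d ≤ l * (2 * l * M) := Nat.mul_le_mul_left _ this
          _ = _ := by ring
      have h2 : l * c * M = 2 * l * l * M * C + 2 * l * l * M := by rw [hc]; ring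
      have h3 : l * N * (c + C) = l * d * c + l * M * c + 2 * l * l * M * C := by
        rw [mul_add, hNd]
        have : l * (d + M) * C = 2 * l * l * M * C := by rw [e]; ring
        rw [this]; ring
      have h4 : N * c = 2 * (l * c * M) := by rw [hN]; ring
      have h5 : 0 < l * c := by positivity
      have h6 : l * (d + 1) * c = l * d * c + l * c := by ring
      have h7 : l * M * c = l * c * M := by ring
      rw [h3, h4, h6, h7]
      omega)
  set E := ∑ j, emb Fq L (h j) * sg Fq N (ψ j) with hE
  have hdet : Φ.det ≠ 0 := by
    intro hd0
    have := congrArg Matrix.det hΦ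
    rw [Matrix.det_mul, hd0, mul_zero, Matrix.det_smul, Matrix.det_one, mul_one] at this
    have h2 := pow_eq_zero_iff (Fintype.card_pos_iff.2 ⟨i₁⟩).ne' |>.1 this.symm
    have h3 := hs 0
    rw [h2] at h3; simp at h3
  have hE0 : E ≠ 0 := fun h0 => hne (li_sg Fq hσ hdet hli N h h0)
  obtain ⟨n, hn⟩ : ∃ n, PowerSeries.coeff n E ≠ 0 := by
    by_contra hcon
    push Not at hcon
    exact hE0 (PowerSeries.ext hcon)
  classical
  have hex : ∃ n, PowerSeries.coeff n E ≠ 0 := ⟨n, hn⟩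
  clear hn n
  set n := Nat.find hex with hndef
  set e := PowerSeries.coeff n E with he
  have he0 : e ≠ 0 := Nat.find_spec hex
  have hlow : ∀ m < n, PowerSeries.coeff m E = 0 := fun m hm => by
    have := Nat.find_min hex hm
    simpa using this
  set R := R0 ^ Q with hR
  have hRge : 1 ≤ R := one_le_pow₀ hR1.le
  have hEb : Bd R ((q : ℝ) ^ (c * Q) * R ^ d * B ^ Q) E := by
    refine Bd.sum (by linarith) (by positivity) _ fun j _ => ?_
    exact (Bd_emb Fq hRge (h j) _ _ (hbd j).1 (hbd j).2).mul (by linarith)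
      ((hψ j).sg (Fq := Fq) (by linarith) N)
  -- zeros
  have hθ : ‖algebraMap (Polynomial Fq) L θ‖ < R0 := by rw [norm_theta]; exact hR0
  let a : ℕ → L := fun j => algebraMap (Polynomial Fq) L (θ ^ q ^ j)
  have hna : ∀ j, ‖a j‖ = (q : ℝ) ^ q ^ j := by
    intro j; simp only [a]; rw [map_pow, norm_pow, norm_theta]
  have ha0 : ∀ j, a j ≠ 0 := fun j => by
    rw [← norm_pos_iff, hna]; positivity
  have hainj : Function.Injective a := by
    intro i j hij
    have := congrArg norm hij
    rw [hna, hna] at this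
    have h1 := pow_right_injective₀ (by linarith) (by linarith) this
    exact Nat.pow_right_injective (one_lt_q Fq) h1
  have haR : ∀ j < N, ‖a j‖ < R := by
    intro j hj
    rw [hna]
    calc (q : ℝ) ^ q ^ j ≤ (q : ℝ) ^ Q := pow_le_pow_right₀ hq1.le (Nat.pow_le_pow_right (q_pos Fq) hj.le)
      _ < R := pow_lt_pow_left₀ hR0 hq0.le (by omega)
  have hbe : ∀ f : At, ∃ β, Bd R β (emb Fq L f) := fun f => by
    obtain ⟨c, hc⟩ := BD.exists Fq f
    exact ⟨_, Bd_emb Fq hRge f c c hc.1 hc.2⟩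
  choose be hbe using hbe
  have hbs : ∀ j, Bd R (B ^ Q) (sg Fq N (ψ j)) := fun j => (hψ j).sg (Fq := Fq) (by linarith) N
  have hz : ∀ j < N, ev (a j) E = 0 := by
    intro j hj
    obtain ⟨lam, hlam⟩ := hev j hj
    rw [hE, ev_sum (haR j hj) Finset.univ (fun i _ => (hbe (h i)).mul (by linarith) (hbs i))]
    have e1 : ∀ i, ev (a j) (emb Fq L (h i) * sg Fq N (ψ i)) =
        algebraMap (Polynomial Fq) L lam * frk Fq L j (algebraMap (Polynomial Fq) L
          (rel Fq Φ' ρ (N - j) i) * ev (algebraMap (Polynomial Fq) L θ) (sg Fq (N - j) (ψ i))) := by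
      intro i
      rw [ev_mul (hbe _) (hbs i) (haR j hj), ev_emb, hlam, map_mul, map_mul, map_pow, mul_assoc]
      congr 1
      rw [frk_apply, frk_apply]
      congr 1
      have hb2 := (hψ i).sg (Fq := Fq) (by linarith) (N - j)
      rw [← ev_sg (Fq := Fq) hb2 (lt_of_lt_of_le hθ (le_self_pow₀ hR1.le (pow_pos (q_pos Fq) _).ne')),
        sg_sg, show j + (N - j) = N by omega, ← map_pow]
    simp only [e1]
    rw [← Finset.mul_sum, ← map_sum, rel_rel Fq hR0 hψ hσ hΦ h0, map_zero, mul_zero]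
  have hup := zeros_bound a hainj ha0 n N E _ hEb haR hz hlow
  have hprod : ∏ j ∈ Finset.range N, ‖a j‖ ≤ (q : ℝ) ^ Q := by
    simp only [hna]
    rw [Finset.prod_pow_eq_pow_sum]
    exact pow_le_pow_right₀ hq1.le (sum_geom_le Fq N)
  have hup2 : ‖e‖ * (R0 ^ M) ^ Q ≤ ((q : ℝ) ^ (c + 1) * B) ^ Q := by
    have h1 : ‖e‖ ≤ ‖e‖ * R ^ n := le_mul_of_one_le_right (norm_nonneg _) (one_le_pow₀ hRge)
    have h2 : (q : ℝ) ^ (c * Q) * R ^ d * B ^ Q / R ^ N = (q : ℝ) ^ (c * Q) * B ^ Q / (R0 ^ M) ^ Q := by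
      rw [hNd, pow_add, hR]
      have : (R0 ^ Q) ^ M = (R0 ^ M) ^ Q := by rw [← pow_mul, ← pow_mul, mul_comm]
      rw [this]
      field_simp
    rw [h2] at hup
    rw [← le_div_iff₀ (by positivity)]
    calc ‖e‖ ≤ _ := h1.trans hup
      _ ≤ (q : ℝ) ^ Q * ((q : ℝ) ^ (c * Q) * B ^ Q / (R0 ^ M) ^ Q) :=
        mul_le_mul_of_nonneg_right hprod (by positivity)
      _ = _ := by
        rw [mul_pow, ← pow_mul (q : ℝ) (c + 1) Q, add_mul, pow_add, one_mul]; ring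
  -- lower bound
  obtain ⟨α, hα0, hαd, hαs⟩ := siegel2 Fq l ((c + c0) * q ^ l * Q) (d + c0 * l) rfl hl0
    (gv Fq Φ N h) (by
      intro i hi j
      refine (gv_bd Fq hcΦ hbd i j).mono ?_ (by gcongr)
      refine (Nat.sub_le _ _).trans ?_
      have := Nat.pow_le_pow_right (q_pos Fq) hi
      gcongr)
  have hrel : ∑ i ∈ Finset.range (l + 1), emb Fq L (α i) * sg Fq i E = 0 := by
    simp only [hE, gv_sum Fq hσ, Finset.mul_sum]
    rw [Finset.sum_comm]
    refine Finset.sum_eq_zero fun j _ => ?_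
    have := congrArg (emb Fq L) (hαs j)
    rw [map_sum, map_zero] at this
    simp only [← mul_assoc, ← map_mul, ← Finset.sum_mul]
    simp only [this, zero_mul]
  have hex2 : ∃ m, ∃ i ≤ l, (α i).coeff m ≠ 0 := by
    obtain ⟨i, hi, hi0⟩ := hα0
    by_contra hcon
    push Not at hcon
    exact hi0 (Polynomial.ext fun m => by simpa using hcon m i hi)
  set m := Nat.find hex2 with hm
  have hm1 : ∃ i ≤ l, (α i).coeff m ≠ 0 := Nat.find_spec hex2
  have hm2 : ∀ k < m, ∀ i ≤ l, (α i).coeff k = 0 := by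
    intro k hk i hi
    have := Nat.find_min hex2 hk
    push Not at this
    exact this i hi
  have hsum : ∑ i ∈ Finset.range (l + 1),
      algebraMap (Polynomial Fq) L ((α i).coeff m) * e ^ q ^ i = 0 := by
    have := congrArg (PowerSeries.coeff (m + n)) hrel
    rw [map_sum, map_zero] at this
    rw [← this]
    refine Finset.sum_congr rfl fun i hi => ?_
    rw [coeff_mul_low, coeff_emb, coeff_sg]
    · intro k hk; rw [coeff_emb, hm2 k hk i (by have := Finset.mem_range.1 hi; omega), map_zero]
    · intro k hk; rw [coeff_sg, hlow k hk, zero_pow (pow_pos (q_pos Fq) _).ne']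
  have hMq : (q : ℝ) ^ (c + 1) * B ≤ R0 ^ M := by
    refine le_trans ?_ hM.le
    have : (q : ℝ) ^ (c + 1) ≤ (q : ℝ) ^ (X0 + c + 1) := pow_le_pow_right₀ hq1.le (by omega)
    nlinarith
  have he1 : ‖e‖ ≤ 1 := by
    have h1 : ‖e‖ * (R0 ^ M) ^ Q ≤ 1 * (R0 ^ M) ^ Q := by
      rw [one_mul]
      exact hup2.trans (pow_le_pow_left₀ (by positivity) hMq _)
    exact le_of_mul_le_mul_right h1 (by positivity)
  have hlo := additive_lower Fq (fun i => (α i).coeff m) hm1 (fun i => hαd i m) he0 he1 hsum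
  have hX : 3 * l * ((c + c0) * q ^ l * Q + 1) ≤ X0 * Q := by
    rw [hX0, mul_assoc (3 * l)]
    apply Nat.mul_le_mul_left
    nlinarith
  have h1 : (1 : ℝ) ≤ ((q : ℝ) ^ X0) ^ Q * ‖e‖ := by
    refine hlo.trans (mul_le_mul_of_nonneg_right ?_ (norm_nonneg _))
    rw [← pow_mul]
    exact pow_le_pow_right₀ hq1.le hX
  have h2 : (R0 ^ M) ^ Q ≤ ((q : ℝ) ^ (X0 + c + 1) * B) ^ Q := by
    calc (R0 ^ M) ^ Q ≤ (((q : ℝ) ^ X0) ^ Q * ‖e‖) * (R0 ^ M) ^ Q :=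
          le_mul_of_one_le_left (by positivity) h1
      _ = ((q : ℝ) ^ X0) ^ Q * (‖e‖ * (R0 ^ M) ^ Q) := by ring
      _ ≤ ((q : ℝ) ^ X0) ^ Q * ((q : ℝ) ^ (c + 1) * B) ^ Q := by gcongr
      _ = _ := by rw [← mul_pow]; congr 1; rw [add_assoc, pow_add]; ring
  have h3 : ((q : ℝ) ^ (X0 + c + 1) * B) ^ Q < (R0 ^ M) ^ Q :=
    pow_lt_pow_left₀ hM (by positivity) (by omega)
  linarith

end abp
end CY

namespace CY
theorem eval2_aux {S : Type*} [CommRing S] (b H : S) (n D m : ℕ) (h : m ≤ D) :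
    (Polynomial.C (b ^ (n * (D - m))) * (Polynomial.X + Polynomial.C (b ^ n * H)) ^ m).eval₂
      Polynomial.C (Polynomial.C (b ^ n) * (Polynomial.X - Polynomial.C H)) =
      Polynomial.C (b ^ (n * D)) * Polynomial.X ^ m := by
  have e3 : (Polynomial.C (b ^ n) * (Polynomial.X - Polynomial.C H) +
    Polynomial.C (b ^ n * H) : Polynomial S) = Polynomial.C (b ^ n) * Polynomial.X := by
    rw [Polynomial.C_mul]; ring
  rw [Polynomial.eval₂_mul, Polynomial.eval₂_pow, Polynomial.eval₂_C, Polynomial.eval₂_add,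
    Polynomial.eval₂_X, Polynomial.eval₂_C, e3, mul_pow, ← mul_assoc, ← Polynomial.C_pow,
    ← Polynomial.C_mul, ← pow_mul, ← pow_add, ← mul_add]
  congr 4
  omega


theorem exists_bd_prod {L : Type*} [NormedField L] [IsUltrametricDist L] {J : Type*} {R : ℝ}
    (hR : 0 ≤ R) {z : J → PowerSeries L} {β : J → ℝ} (hz : ∀ j, Bd R (β j) (z j)) (μ : J → ℕ)
    (s : Finset J) : ∃ γ, Bd R γ (∏ j ∈ s, z j ^ μ j) := by
  classical
  induction s using Finset.induction_on with
  | empty => exact ⟨1, by simpa using Bd.one⟩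
  | insert a s ha ih =>
    obtain ⟨γ, hγ⟩ := ih
    rw [Finset.prod_insert ha]
    exact ⟨_, ((hz a).pow hR (μ a)).mul hR hγ⟩

theorem ev_prod {L : Type*} [NormedField L] [IsUltrametricDist L] [CompleteSpace L] {J : Type*} {R : ℝ}
    {z : J → PowerSeries L} {β : J → ℝ} (hz : ∀ j, Bd R (β j) (z j)) (μ : J → ℕ) {a : L}
    (ha : ‖a‖ < R) (s : Finset J) :
    ev a (∏ j ∈ s, z j ^ μ j) = ∏ j ∈ s, ev a (z j) ^ μ j := by
  classical
  have hR : 0 ≤ R := (norm_nonneg a).trans ha.le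
  induction s using Finset.induction_on with
  | empty => simp [ev_one]
  | insert b s hb ih =>
    rw [Finset.prod_insert hb, Finset.prod_insert hb]
    obtain ⟨γ, hγ⟩ := exists_bd_prod hR hz μ s
    rw [ev_mul ((hz b).pow hR _) hγ ha, ih, ev_pow (hz b) ha]

section box
variable {J : Type*} [Fintype J] [DecidableEq J] (D : ℕ)

/-- exponent attached to a box index -/
noncomputable def bx (μ : J → Fin (D + 1)) : J →₀ ℕ := Finsupp.equivFunOnFinite.symm fun j => (μ j : ℕ)

theorem bx_apply (μ : J → Fin (D + 1)) (j : J) : bx D μ j = μ j := rfl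

theorem bx_inj : Function.Injective (bx (J := J) D) := by
  intro μ ν h
  funext j
  apply Fin.ext
  exact DFunLike.congr_fun h j

theorem coeff_box {R : Type*} [CommRing R] (c : (J → Fin (D + 1)) → R) (μ : J → Fin (D + 1)) :
    MvPolynomial.coeff (bx D μ) (∑ ν, MvPolynomial.monomial (bx D ν) (c ν)) = c μ := by
  classical
  rw [MvPolynomial.coeff_sum]
  simp only [MvPolynomial.coeff_monomial]
  rw [Finset.sum_eq_single μ]
  · simp
  · intro b _ hb; rw [if_neg]; intro h; exact hb (bx_inj D h)
  · simp

theorem eval_box {R S : Type*} [CommRing R] [CommRing S] (φ : R →+* S) (x : J → S)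
    (c : (J → Fin (D + 1)) → R) :
    MvPolynomial.eval₂ φ x (∑ ν, MvPolynomial.monomial (bx D ν) (c ν)) =
      ∑ ν, φ (c ν) * ∏ j, x j ^ (ν j : ℕ) := by
  classical
  rw [MvPolynomial.eval₂_sum]
  refine Finset.sum_congr rfl fun ν _ => ?_
  rw [MvPolynomial.eval₂_monomial, Finsupp.prod_fintype]
  · rfl
  · intro i; simp

theorem eq_box {R : Type*} [CommRing R] (P : MvPolynomial J R) (hD : ∀ j, P.degreeOf j ≤ D) :
    P = ∑ ν, MvPolynomial.monomial (bx D ν) (P.coeff (bx D ν)) := by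
  classical
  ext m
  by_cases hm : ∃ μ, bx D μ = m
  · obtain ⟨μ, rfl⟩ := hm
    rw [coeff_box]
  · have h1 : P.coeff m = 0 := by
      by_contra hc
      apply hm
      have : ∀ j, m j < D + 1 := fun j => by
        have := MvPolynomial.monomial_le_degreeOf j (MvPolynomial.mem_support_iff.2 hc)
        have := hD j
        omega
      refine ⟨fun j => ⟨m j, this j⟩, ?_⟩
      ext j; rfl
    rw [h1, MvPolynomial.coeff_sum]
    symm
    refine Finset.sum_eq_zero fun μ _ => ?_
    rw [MvPolynomial.coeff_monomial, if_neg]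
    intro h; exact hm ⟨μ, h⟩

theorem box_swap {S : Type*} [CommRing S] (f : J → Fin (D + 1) → S) :
    ∑ ν : J → Fin (D + 1), ∏ j, f j (ν j) = ∏ j, ∑ k, f j k := by
  rw [Finset.prod_univ_sum, Fintype.piFinset_univ]

theorem sum_coeff_fin {R S : Type*} [CommRing R] [CommRing S] (φ : R →+* S) (x : S)
    (f : Polynomial R) (hf : f.natDegree ≤ D) :
    ∑ k : Fin (D + 1), φ (f.coeff k) * x ^ (k : ℕ) = f.eval₂ φ x := by
  rw [Polynomial.eval₂_eq_sum_range' φ (show f.natDegree < D + 1 by omega),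
    Fin.sum_univ_eq_sum_range (fun k => φ (f.coeff k) * x ^ k)]
end box

section algind
variable (Fq : Type*) {L : Type*} [Field Fq] [Fintype Fq] [NormedField L] [Algebra Fq L]
  [Algebra (Polynomial Fq) L] [KInf Fq L]
local notation "q" => Fintype.card Fq
local notation "At" => Polynomial (Polynomial Fq)
local notation "θ" => (Polynomial.X : Polynomial Fq)

/-- `b = t - θ^q` -/
noncomputable def bb : Polynomial (Polynomial Fq) := Polynomial.X - Polynomial.C (θ ^ q)

theorem sp_bb (k : ℕ) : sp Fq k (bb Fq) = Polynomial.X - Polynomial.C (θ ^ q ^ (k + 1)) := by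
  ext1 n
  rw [coeff_sp, bb, ← frk_apply, Polynomial.coeff_sub, map_sub, Polynomial.coeff_sub,
    Polynomial.coeff_X, Polynomial.coeff_C, Polynomial.coeff_C, frk_apply, frk_apply]
  have hk := (pow_pos (q_pos Fq) k).ne'
  congr 1
  · split_ifs <;> simp [hk]
  · split_ifs
    · rw [← pow_mul, pow_succ, mul_comm]
    · simp [hk]

theorem sp_bb_eval (k : ℕ) : (sp Fq k (bb Fq)).eval θ ≠ 0 := by
  rw [sp_bb]
  simp only [Polynomial.eval_sub, Polynomial.eval_X, Polynomial.eval_C]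
  intro h
  have h1 := congrArg Polynomial.natDegree (sub_eq_zero.1 h)
  rw [Polynomial.natDegree_X, Polynomial.natDegree_X_pow] at h1
  have := Nat.one_lt_pow (show k + 1 ≠ 0 by omega) (one_lt_q Fq)
  omega

theorem algind {J : Type*} [Fintype J] {R0 : ℝ} (hR0 : (q : ℝ) < R0)
    (z : J → PowerSeries L) (β : J → ℝ) (hz : ∀ j, Bd R0 (β j) (z j)) (n : J → ℕ) (H : J → At)
    (hσ : ∀ j, sg Fq 1 (z j) = emb Fq L (bb Fq ^ n j) * (z j - emb Fq L (H j)))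
    (hind : ∀ P : MvPolynomial J At, P.eval₂ (emb Fq L) z = 0 → P = 0) :
    ∀ P : MvPolynomial J (Polynomial Fq), P.eval₂ (algebraMap (Polynomial Fq) L)
      (fun j => ev (algebraMap (Polynomial Fq) L θ) (z j)) = 0 → P = 0 := by
  classical
  intro P hP
  by_contra hP0
  have := KInf.complete (L := L) Fq
  have := KInf.ultra (L := L) Fq
  have hR00 : 0 ≤ R0 := (q_posR Fq).le.trans hR0.le
  have hθ : ‖algebraMap (Polynomial Fq) L θ‖ < R0 := by rw [norm_theta]; exact hR0
  set D := ∑ j, P.degreeOf j with hD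
  have hDj : ∀ j, P.degreeOf j ≤ D := fun j =>
    Finset.single_le_sum (f := fun j => P.degreeOf j) (fun _ _ => Nat.zero_le _) (Finset.mem_univ j)
  let pp : J → ℕ → Polynomial At := fun j m =>
    (Polynomial.C (bb Fq ^ n j) * (Polynomial.X - Polynomial.C (H j))) ^ m
  let pp' : J → ℕ → Polynomial At := fun j m =>
    Polynomial.C (bb Fq ^ (n j * (D - m))) * (Polynomial.X + Polynomial.C (bb Fq ^ n j * H j)) ^ m
  have hpp : ∀ j m, m ≤ D → (pp j m).natDegree ≤ D := by
    intro j m hm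
    refine Polynomial.natDegree_pow_le.trans ?_
    have : (Polynomial.C (bb Fq ^ n j) * (Polynomial.X - Polynomial.C (H j))).natDegree ≤ 1 :=
      (Polynomial.natDegree_C_mul_le _ _).trans (Polynomial.natDegree_X_sub_C_le _)
    nlinarith
  have hpp' : ∀ j m, m ≤ D → (pp' j m).natDegree ≤ D := by
    intro j m hm
    refine (Polynomial.natDegree_C_mul_le _ _).trans (Polynomial.natDegree_pow_le.trans ?_)
    have : (Polynomial.X + Polynomial.C (bb Fq ^ n j * H j)).natDegree ≤ 1 :=
      (Polynomial.natDegree_X_add_C _).le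
    nlinarith
  let ι := J → Fin (D + 1)
  let ψ : ι → PowerSeries L := fun μ => ∏ j, z j ^ (μ j : ℕ)
  let Φ : Matrix ι ι At := fun μ ν => ∏ j, (pp j (μ j)).coeff (ν j)
  let Φ' : Matrix ι ι At := fun μ ν => ∏ j, (pp' j (μ j)).coeff (ν j)
  let s : At := ∏ j, bb Fq ^ (n j * D)
  have hb := fun μ : ι => exists_bd_prod hR00 hz (fun j => (μ j : ℕ)) Finset.univ
  choose γ hγ using hb
  have hγ0 : ∀ μ, 0 ≤ γ μ := fun μ => (hγ μ).nonneg
  have hBB : ∀ μ, Bd R0 (1 + ∑ μ, γ μ) (ψ μ) := fun μ => by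
    refine (hγ μ).mono hR00 le_rfl ?_
    have := Finset.single_le_sum (f := γ) (fun i _ => hγ0 i) (Finset.mem_univ μ)
    linarith
  refine abp Fq (ψ := ψ) (Φ := Φ) (Φ' := Φ') (s := s) (ρ := fun μ => P.coeff (bx D μ)) hR0
    (B := 1 + ∑ μ, γ μ) ?_ hBB ?_ ?_ ?_ ?_ ?_ ?_
  · have := Finset.sum_nonneg (fun i (_ : i ∈ Finset.univ) => hγ0 i)
    linarith
  · intro μ
    simp only [ψ, Φ, map_prod, map_pow, hσ, ← Finset.prod_mul_distrib]
    rw [box_swap D (fun j k => emb Fq L ((pp j (μ j)).coeff k) * z j ^ (k : ℕ))]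
    refine Finset.prod_congr rfl fun j _ => ?_
    rw [sum_coeff_fin D (emb Fq L) (z j) (pp j (μ j)) (hpp j _ (by omega))]
    simp [pp, Polynomial.eval₂_mul, Polynomial.eval₂_pow]
  · ext1 μ ν
    rw [Matrix.mul_apply]
    simp only [Φ, Φ', ← Finset.prod_mul_distrib]
    rw [box_swap D (fun j k => (pp' j (μ j)).coeff k * (pp j k).coeff (ν j))]
    have e1 : ∀ j, ∑ k : Fin (D + 1), (pp' j (μ j)).coeff k * (pp j k).coeff (ν j) =
        if μ j = ν j then bb Fq ^ (n j * D) else 0 := by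
      intro j
      have h1 := sum_coeff_fin D Polynomial.C
        (Polynomial.C (bb Fq ^ n j) * (Polynomial.X - Polynomial.C (H j))) (pp' j (μ j))
        (hpp' j _ (by omega))
      have h2 : (pp' j (μ j)).eval₂ Polynomial.C
          (Polynomial.C (bb Fq ^ n j) * (Polynomial.X - Polynomial.C (H j))) =
          Polynomial.C (bb Fq ^ (n j * D)) * Polynomial.X ^ (μ j : ℕ) := by
        exact eval2_aux (bb Fq) (H j) (n j) D (μ j) (by have := (μ j).2; omega)
      rw [h2] at h1
      have h3 := congrArg (fun f => Polynomial.coeff f (ν j : ℕ)) h1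
      simp only [Polynomial.finsetSum_coeff, Polynomial.coeff_C_mul, Polynomial.coeff_X_pow] at h3
      rw [h3]
      simp only [mul_ite, mul_one, mul_zero, Fin.ext_iff]
      congr 1
      exact propext eq_comm
    simp only [e1, Matrix.smul_apply, Matrix.one_apply, smul_eq_mul, mul_ite, mul_one, mul_zero, s]
    rw [Finset.prod_ite_zero]
    congr 1
    simp only [Finset.mem_univ, true_implies]
    exact propext funext_iff.symm
  · intro k
    simp only [s, map_prod, map_pow, Polynomial.eval_prod, Polynomial.eval_pow]
    exact Finset.prod_ne_zero_iff.2 fun j _ => pow_ne_zero _ (sp_bb_eval Fq k)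
  · intro c hc
    have h1 := hind (∑ ν, MvPolynomial.monomial (bx D ν) (c ν)) (by rw [eval_box]; exact hc)
    funext μ
    rw [← coeff_box D c μ, h1]; simp
  · intro h
    apply hP0
    rw [eq_box D P hDj]
    refine Finset.sum_eq_zero fun ν _ => ?_
    have := congrFun h ν
    simp only [Pi.zero_apply] at this
    rw [this, MvPolynomial.monomial_zero]
  · rw [eq_box D P hDj, eval_box] at hP
    rw [← hP]
    refine Finset.sum_congr rfl fun μ _ => ?_
    rw [ev_prod hz (fun j => (μ j : ℕ)) hθ]
end algind
end CY

namespace CY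

theorem pow_of_choose (p : ℕ) (hp : p.Prime) : ∀ a : ℕ, 0 < a →
    (∀ j, 0 < j → j < a → p ∣ a.choose j) → ∃ i, a = p ^ i := by
  intro a
  induction a using Nat.strong_induction_on with
  | _ a ih =>
    intro ha h
    have := Fact.mk hp
    by_cases h1 : a = 1
    · exact ⟨0, by simpa using h1⟩
    have h2 := h 1 one_pos (by omega)
    rw [Nat.choose_one_right] at h2
    obtain ⟨c, rfl⟩ := h2
    have hc : 0 < c := Nat.pos_of_mul_pos_left ha
    obtain ⟨i, hi⟩ := ih c (by nlinarith [hp.two_le]) hc (by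
      intro j hj hjc
      have h3 := h (p * j) (Nat.mul_pos hp.pos hj) (Nat.mul_lt_mul_of_pos_left hjc hp.pos)
      have h4 := @Choose.choose_modEq_choose_mod_mul_choose_div_nat (p * c) (p * j) p _
      simp only [Nat.mul_mod_right, Nat.choose_self, one_mul, Nat.mul_div_cancel_left _ hp.pos] at h4
      exact (Nat.modEq_zero_iff_dvd).1 (h4.symm.trans ((Nat.modEq_zero_iff_dvd).2 h3)))
    exact ⟨i + 1, by rw [hi, pow_succ, mul_comm]⟩

section weights
open MvPolynomial
variable {k J : Type*} [Field k] (w : J → ℕ)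

/-- All monomials have weight `< m`. -/
def Wl (m : ℕ) (P : MvPolynomial J k) : Prop := ∀ κ, coeff κ P ≠ 0 → Finsupp.weight w κ < m

theorem Wl.add {m : ℕ} {P Q : MvPolynomial J k} (hP : Wl w m P) (hQ : Wl w m Q) : Wl w m (P + Q) := by
  intro κ h
  rw [coeff_add] at h
  by_cases h1 : coeff κ P = 0
  · exact hQ κ (by simpa [h1] using h)
  · exact hP κ h1

theorem Wl.neg {m : ℕ} {P : MvPolynomial J k} (hP : Wl w m P) : Wl w m (-P) := by
  intro κ h
  exact hP κ (by simpa using h)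

theorem Wl.sub {m : ℕ} {P Q : MvPolynomial J k} (hP : Wl w m P) (hQ : Wl w m Q) : Wl w m (P - Q) := by
  rw [sub_eq_add_neg]; exact hP.add w (hQ.neg w)

theorem Wl.sum {m : ℕ} {ι : Type*} (s : Finset ι) {P : ι → MvPolynomial J k}
    (hP : ∀ i ∈ s, Wl w m (P i)) : Wl w m (∑ i ∈ s, P i) := by
  intro κ h
  rw [coeff_sum] at h
  obtain ⟨i, hi, h2⟩ := Finset.exists_ne_zero_of_sum_ne_zero h
  exact hP i hi κ h2

theorem Wl.mono {m n : ℕ} {P : MvPolynomial J k} (hP : Wl w m P) (h : m ≤ n) : Wl w n P :=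
  fun κ hκ => (hP κ hκ).trans_le h

theorem Wl.mul {m n : ℕ} {P Q : MvPolynomial J k} (hP : Wl w m P) (hQ : Wl w (n + 1) Q) :
    Wl w (m + n) (P * Q) := by
  classical
  intro κ h
  rw [coeff_mul] at h
  obtain ⟨x, hx, h2⟩ := Finset.exists_ne_zero_of_sum_ne_zero h
  have h3 := hP _ (left_ne_zero_of_mul h2)
  have h4 := hQ _ (right_ne_zero_of_mul h2)
  rw [← (Finset.HasAntidiagonal.mem_antidiagonal.1 hx), map_add]
  omega

theorem Wl.monomial (κ : J →₀ ℕ) (c : k) : Wl w (Finsupp.weight w κ + 1) (monomial κ c) := by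
  classical
  intro μ h
  rw [coeff_monomial] at h
  split_ifs at h with h1
  · rw [h1]; omega
  · exact absurd rfl h

theorem Wl.C (c : k) : Wl w 1 (C c : MvPolynomial J k) := by
  have := Wl.monomial w (0 : J →₀ ℕ) c
  simpa using this

variable (sk : k →+* k) (b : k) (H : J → k)

/-- The twisted Frobenius on polynomials. -/
noncomputable def st : MvPolynomial J k →+* MvPolynomial J k :=
  eval₂Hom (C.comp sk) (fun j => C (b ^ w j) * (X j - C (H j)))

theorem st_C (c : k) : st w sk b H (C c) = C (sk c) := by simp [st]
theorem st_X (j : J) : st w sk b H (X j) = C (b ^ w j) * (X j - C (H j)) := by simp [st]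

theorem st_monomial (hw : ∀ j, 0 < w j) (κ : J →₀ ℕ) (c : k) :
    Wl w (Finsupp.weight w κ)
      (st w sk b H (monomial κ c) - monomial κ (sk c * b ^ Finsupp.weight w κ)) := by
  induction κ using Finsupp.induction_linear generalizing c with
  | zero =>
    intro μ h
    simp [← C_apply, st_C] at h
  | add κ μ hκ hμ =>
    have e1 : monomial (κ + μ) c = monomial κ c * monomial μ (1 : k) := by
      rw [monomial_mul, mul_one]
    have e2 : monomial (κ + μ) (sk c * b ^ Finsupp.weight w (κ + μ)) =
      monomial κ (sk c * b ^ Finsupp.weight w κ) * monomial μ (sk 1 * b ^ Finsupp.weight w μ) := by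
      rw [monomial_mul, map_add, pow_add, map_one]; ring_nf
    rw [e1, e2, map_mul]
    set A := st w sk b H (monomial κ c)
    set B := st w sk b H (monomial μ 1)
    set A' := monomial κ (sk c * b ^ Finsupp.weight w κ)
    set B' := monomial μ (sk 1 * b ^ Finsupp.weight w μ)
    have e3 : A * B - A' * B' = (A - A') * (B - B') + (A - A') * B' + (B - B') * A' := by ring
    rw [e3, map_add]
    refine Wl.add w (Wl.add w ?_ ?_) ?_
    · exact (hκ c).mul w ((hμ 1).mono w (by omega))
    · exact (hκ c).mul w (Wl.monomial w _ _)
    · rw [add_comm]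
      exact (hμ 1).mul w (Wl.monomial w _ _)
  | single j n =>
    induction n generalizing c with
    | zero =>
      intro μ h
      simp [← C_apply, st_C] at h
    | succ n ih =>
      have e1 : monomial (Finsupp.single j (n + 1)) c = monomial (Finsupp.single j n) c * X j := by
        rw [X, monomial_mul, ← Finsupp.single_add, mul_one]
      have e4 : Finsupp.weight w (Finsupp.single j (n + 1)) = Finsupp.weight w (Finsupp.single j n) + w j := by
        rw [Finsupp.single_add, map_add]; simp [Finsupp.weight_single]
      have e2 : monomial (Finsupp.single j (n + 1)) (sk c * b ^ Finsupp.weight w (Finsupp.single j (n + 1))) =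
        monomial (Finsupp.single j n) (sk c * b ^ Finsupp.weight w (Finsupp.single j n)) * (C (b ^ w j) * X j) := by
        rw [X, C_mul_monomial, monomial_mul, ← Finsupp.single_add, e4, pow_add]; ring_nf
      rw [e1, e2, map_mul, st_X, e4]
      set A := st w sk b H (monomial (Finsupp.single j n) c)
      set A' := monomial (Finsupp.single j n) (sk c * b ^ Finsupp.weight w (Finsupp.single j n)) with hA'
      have e3 : A * (C (b ^ w j) * (X j - C (H j))) - A' * (C (b ^ w j) * X j) =
        (A - A') * (C (b ^ w j) * (X j - C (H j))) + (-(A' * C (b ^ w j * H j))) := by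
        rw [C_mul]; ring
      rw [e3]
      refine Wl.add w ?_ (Wl.neg w ?_)
      · refine (ih c).mul w ?_
        have h1 : Wl w (w j + 1) (X j : MvPolynomial J k) := by
          have := Wl.monomial w (Finsupp.single j 1) (1 : k)
          rw [Finsupp.weight_single] at this
          simpa [X] using this
        have := (Wl.C w (b ^ w j)).mul w (h1.sub w ((Wl.C w (H j)).mono w (Nat.le_add_left 1 _)))
        rwa [add_comm] at this
      · have := ((Wl.monomial w (Finsupp.single j n) (sk c * b ^ Finsupp.weight w (Finsupp.single j n))).mul w
          (Wl.C w (b ^ w j * H j)))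
        exact this.mono w (by have := hw j; omega)

theorem st_top (hw : ∀ j, 0 < w j) {m : ℕ} {P : MvPolynomial J k} (hP : Wl w (m + 1) P) :
    Wl w (m + 1) (st w sk b H P) ∧
    ∀ κ, Finsupp.weight w κ = m → coeff κ (st w sk b H P) = sk (coeff κ P) * b ^ m := by
  classical
  set Q : MvPolynomial J k := ∑ κ ∈ P.support, monomial κ (sk (coeff κ P) * b ^ Finsupp.weight w κ) with hQ
  have hQc : ∀ κ, coeff κ Q = sk (coeff κ P) * b ^ Finsupp.weight w κ := by
    intro κ
    rw [hQ, coeff_sum]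
    simp only [coeff_monomial]
    rw [Finset.sum_ite_eq']
    split_ifs with h
    · rfl
    · rw [notMem_support_iff.1 h]; simp
  have h1 : Wl w m (st w sk b H P - Q) := by
    conv => arg 3; rw [P.as_sum, map_sum, hQ, ← Finset.sum_sub_distrib]
    refine Wl.sum w _ fun κ hκ => ?_
    exact (st_monomial w sk b H hw κ _).mono w (by have := hP κ (mem_support_iff.1 hκ); omega)
  constructor
  · have h2 : Wl w (m + 1) Q := by
      intro κ h
      rw [hQc] at h
      exact hP κ (fun h0 => h (by simp [h0]))
    have := (h1.mono w (Nat.le_succ m)).add w h2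
    simpa using this
  · intro κ hκ
    have h3 : coeff κ (st w sk b H P - Q) = 0 := by
      by_contra h
      have := h1 κ h
      omega
    rw [coeff_sub, sub_eq_zero, hQc, hκ] at h3
    exact h3
end weights
end CY

namespace CY

section hasse
open MvPolynomial
open scoped Classical in
/-- Translation in the variable `s`. -/
noncomputable def trn {k J : Type*} [Field k] (s : J) : MvPolynomial J k →+* Polynomial (MvPolynomial J k) :=
  eval₂Hom (Polynomial.C.comp C) (fun j => Polynomial.C (X j) + if j = s then Polynomial.X else 0)

variable {k J : Type*} [Field k] (w : J → ℕ)
/-- Hasse derivative. -/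
noncomputable def hd (s : J) (a : ℕ) (P : MvPolynomial J k) : MvPolynomial J k := (trn s P).coeff a

open scoped Classical in
theorem trn_X (s j : J) : trn s (X j : MvPolynomial J k) =
    Polynomial.C (X j) + if j = s then Polynomial.X else 0 := by simp [trn]
theorem trn_C (s : J) (c : k) : trn s (C c) = Polynomial.C (C c) := by simp [trn]

theorem coeff_hd (s : J) (a : ℕ) (P : MvPolynomial J k) (κ : J →₀ ℕ) :
    coeff κ (hd s a P) = ((κ s + a).choose a : k) * coeff (κ + Finsupp.single s a) P := by
  classical
  induction P using MvPolynomial.induction_on' with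
  | add P Q hP hQ =>
    simp only [hd, map_add, Polynomial.coeff_add, coeff_add] at hP hQ ⊢
    rw [hP, hQ, mul_add]
  | monomial μ c =>
    have e1 : μ = μ.erase s + Finsupp.single s (μ s) := (Finsupp.erase_add_single s μ).symm
    have e2 : (monomial μ c : MvPolynomial J k) = monomial (μ.erase s) c * X s ^ (μ s) := by
      rw [X_pow_eq_monomial, monomial_mul, mul_one, ← e1]
    have e3 : trn s (monomial (μ.erase s) c : MvPolynomial J k) = Polynomial.C (monomial (μ.erase s) c) := by
      rw [monomial_eq, map_mul, trn_C, map_mul, Finsupp.prod, map_prod, map_prod]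
      congr 1
      refine Finset.prod_congr rfl fun j hj => ?_
      have : j ≠ s := fun h => by rw [h] at hj; simp at hj
      rw [map_pow, map_pow, trn_X, if_neg this, add_zero]
    have e4 : hd s a (monomial μ c) = monomial (μ.erase s + Finsupp.single s (μ s - a)) (c * ((μ s).choose a : k)) := by
      rw [hd, e2, map_mul, e3, map_pow, trn_X, if_pos rfl, Polynomial.coeff_C_mul, add_comm (Polynomial.C _),
        Polynomial.coeff_X_add_C_pow, X_pow_eq_monomial]
      rw [← mul_assoc, monomial_mul, mul_one, ← map_natCast (C : k →+* MvPolynomial J k), mul_comm,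
        C_mul_monomial, mul_comm]
    rw [e4, coeff_monomial, coeff_monomial]
    by_cases h : μ = κ + Finsupp.single s a
    · rw [if_pos h, if_pos, h]
      · simp [mul_comm]
      · rw [h]; ext j
        by_cases hj : j = s
        · subst hj; simp
        · simp [hj, Finsupp.single_apply, Ne.symm hj]
    · rw [if_neg h]
      split_ifs with h1
      · by_cases h2 : a ≤ μ s
        · exfalso; apply h
          rw [← h1]
          conv_lhs => rw [e1]
          rw [add_assoc, ← Finsupp.single_add, Nat.sub_add_cancel h2]
        · rw [Nat.choose_eq_zero_of_lt (by omega)]; simp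
      · simp

variable (sk : k →+* k) (b : k) (H : J → k)

theorem trn_st (s : J) (P : MvPolynomial J k) : trn s (st w sk b H P) =
    Polynomial.eval₂RingHom (Polynomial.C.comp (st w sk b H)) (Polynomial.C (C (b ^ w s)) * Polynomial.X)
      (trn s P) := by
  classical
  rw [← RingHom.comp_apply, ← RingHom.comp_apply]
  congr 1
  refine MvPolynomial.ringHom_ext (fun c => ?_) (fun j => ?_)
  · simp [st_C, trn_C]
  · simp only [RingHom.comp_apply, st_X, trn_X, map_mul, map_sub, trn_C, map_add,
      Polynomial.coe_eval₂RingHom, Polynomial.eval₂_C]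
    split_ifs with h
    · subst h
      simp [st_X]; ring
    · simp [st_X]

theorem coeff_twist {R : Type*} [CommRing R] (f : R →+* R) (c : R) (P : Polynomial R) (a : ℕ) :
    (P.eval₂ (Polynomial.C.comp f) (Polynomial.C c * Polynomial.X)).coeff a = f (P.coeff a) * c ^ a := by
  induction P using Polynomial.induction_on' with
  | add P Q hP hQ => rw [Polynomial.eval₂_add, Polynomial.coeff_add, hP, hQ, Polynomial.coeff_add, map_add, add_mul]
  | monomial n x =>
    rw [Polynomial.eval₂_monomial, mul_pow, ← Polynomial.C_pow, RingHom.comp_apply, ← mul_assoc,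
      ← Polynomial.C_mul, Polynomial.coeff_C_mul_X_pow, Polynomial.coeff_monomial]
    by_cases h : n = a
    · simp [h]
    · simp [h, Ne.symm h]

theorem hd_st (s : J) (a : ℕ) (P : MvPolynomial J k) :
    hd s a (st w sk b H P) = st w sk b H (hd s a P) * C (b ^ (w s * a)) := by
  rw [hd, trn_st, Polynomial.coe_eval₂RingHom, coeff_twist, hd, ← C_pow, pow_mul]

theorem hd_C_mul (s : J) (a : ℕ) (c : k) (P : MvPolynomial J k) :
    hd s a (C c * P) = C c * hd s a P := by
  rw [hd, map_mul, trn_C, Polynomial.coeff_C_mul, hd]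

variable {w sk b H} in
theorem hd_eig (hb : b ≠ 0) {m : ℕ} {P : MvPolynomial J k} (hP : Wl w (m + 1) P)
    (h : st w sk b H P = C (b ^ m) * P) (s : J) (a : ℕ) (h0 : hd s a P ≠ 0) :
    w s * a ≤ m ∧ Wl w (m - w s * a + 1) (hd s a P) ∧
      st w sk b H (hd s a P) = C (b ^ (m - w s * a)) * hd s a P := by
  have h1 : ∀ κ, coeff κ (hd s a P) ≠ 0 → Finsupp.weight w κ + w s * a ≤ m := by
    intro κ hκ
    rw [coeff_hd] at hκ
    have := hP _ (right_ne_zero_of_mul hκ)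
    rw [map_add, Finsupp.weight_single] at this
    simp only [smul_eq_mul] at this
    rw [mul_comm]; omega
  obtain ⟨κ, hκ⟩ := ne_zero_iff.1 h0
  have h2 := h1 κ hκ
  refine ⟨by omega, fun μ hμ => by have := h1 μ hμ; omega, ?_⟩
  have h3 := hd_st w sk b H s a P
  rw [h, hd_C_mul] at h3
  have h4 : (C (b ^ (w s * a)) : MvPolynomial J k) ≠ 0 := by
    rw [Ne, C_eq_zero]; exact pow_ne_zero _ hb
  apply mul_right_cancel₀ h4
  rw [← h3, mul_right_comm, ← C_mul, ← pow_add]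
  congr 3; omega
end hasse

section minimal
open MvPolynomial
variable {k M J : Type*} [Field k] [Field M] {w : J → ℕ} {sk : k →+* k} {b : k} {H : J → k}

theorem eval_st {sM : M →+* M} {i : k →+* M} (hi : ∀ c, i (sk c) = sM (i c)) {x : J → M}
    (hx : ∀ j, sM (x j) = i b ^ w j * (x j - i (H j))) (P : MvPolynomial J k) :
    eval₂Hom i x (st w sk b H P) = sM (eval₂Hom i x P) := by
  rw [← RingHom.comp_apply, ← RingHom.comp_apply]
  congr 1
  ext j
  · simp [st_C, hi]
  · simp [st_X, hx]

theorem exists_min {sM : M →+* M} {i : k →+* M} (hi : ∀ c, i (sk c) = sM (i c)) {x : J → M}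
    (hw : ∀ j, 0 < w j)
    (hx : ∀ j, sM (x j) = i b ^ w j * (x j - i (H j))) (P0 : MvPolynomial J k) (hP0 : P0 ≠ 0)
    (hE : eval₂Hom i x P0 = 0) : ∃ (m : ℕ) (P : MvPolynomial J k), P ≠ 0 ∧ eval₂Hom i x P = 0 ∧
      Wl w (m + 1) P ∧ (∀ Q : MvPolynomial J k, Wl w m Q → eval₂Hom i x Q = 0 → Q = 0) ∧
      st w sk b H P = C (b ^ m) * P := by
  classical
  have hex : ∃ m, ∃ P : MvPolynomial J k, P ≠ 0 ∧ eval₂Hom i x P = 0 ∧ Wl w m P := by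
    refine ⟨(P0.support.sup (Finsupp.weight w)) + 1, P0, hP0, hE, fun κ hκ => ?_⟩
    have := Finset.le_sup (f := Finsupp.weight w) (mem_support_iff.2 hκ)
    omega
  have hm := Nat.find_spec hex
  have hmin : ∀ m < Nat.find hex, ∀ Q : MvPolynomial J k, Wl w m Q → eval₂Hom i x Q = 0 → Q = 0 := by
    intro m hm Q h1 h2
    by_contra h3
    exact Nat.find_min hex hm ⟨Q, h3, h2, h1⟩
  generalize Nat.find hex = m' at hm hmin
  obtain ⟨m, rfl⟩ : ∃ m, m' = m + 1 := by
    obtain ⟨P, h1, h2, h3⟩ := hm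
    obtain ⟨κ, hκ⟩ := ne_zero_iff.1 h1
    have := h3 κ hκ
    exact ⟨m' - 1, by omega⟩
  have hmin' := hmin m (by omega)
  have hex2 : ∃ N, ∃ P : MvPolynomial J k, P ≠ 0 ∧ eval₂Hom i x P = 0 ∧ Wl w (m + 1) P ∧
      (P.support.filter (fun κ => Finsupp.weight w κ = m)).card = N := by
    obtain ⟨P, h1, h2, h3⟩ := hm
    exact ⟨_, P, h1, h2, h3, rfl⟩
  obtain ⟨P, hP1, hP2, hP3, hP4⟩ := Nat.find_spec hex2
  have hmin2 := fun N => Nat.find_min hex2 (m := N)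
  generalize Nat.find hex2 = N at hP4 hmin2
  obtain ⟨κ0, hκ0, hκ0m⟩ : ∃ κ, coeff κ P ≠ 0 ∧ Finsupp.weight w κ = m := by
    by_contra! h
    refine hP1 (hmin' P (fun κ hκ => ?_) hP2)
    have := hP3 κ hκ
    have := h κ hκ
    omega
  set P1 := C (coeff κ0 P)⁻¹ * P with hP1d
  have hc1 : ∀ κ, coeff κ P1 = (coeff κ0 P)⁻¹ * coeff κ P := fun κ => coeff_C_mul _ _ _
  have hs1 : ∀ κ, coeff κ P1 ≠ 0 ↔ coeff κ P ≠ 0 := fun κ => by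
    rw [hc1]; simp [hκ0]
  have hW1 : Wl w (m + 1) P1 := fun κ hκ => hP3 κ ((hs1 κ).1 hκ)
  have hE1 : eval₂Hom i x P1 = 0 := by rw [hP1d, map_mul, hP2, mul_zero]
  have hk1 : coeff κ0 P1 = 1 := by rw [hc1]; exact inv_mul_cancel₀ hκ0
  clear_value P1
  refine ⟨m, P1, ?_, hE1, hW1, hmin', ?_⟩
  · intro h; rw [h] at hk1; simp at hk1
  set Q := st w sk b H P1 - C (b ^ m) * P1 with hQ
  rw [← sub_eq_zero]
  by_contra hQ0
  have ht := st_top w sk b H hw hW1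
  have hQW : Wl w (m + 1) Q := by
    refine ht.1.sub w ?_
    intro κ hκ
    rw [coeff_C_mul] at hκ
    exact hW1 κ (right_ne_zero_of_mul hκ)
  have hQE : eval₂Hom i x Q = 0 := by
    rw [hQ, map_sub, eval_st hi hx, map_mul, hE1]; simp
  have hQc : ∀ κ, Finsupp.weight w κ = m → coeff κ Q = (sk (coeff κ P1) - coeff κ P1) * b ^ m := by
    intro κ hκ
    rw [hQ, coeff_sub, coeff_C_mul, ht.2 κ hκ]; ring
  refine hmin2 _ ?_ ⟨Q, hQ0, hQE, hQW, rfl⟩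
  rw [← hP4]
  apply Finset.card_lt_card
  rw [Finset.ssubset_iff_of_subset]
  · refine ⟨κ0, by simp [hκ0, hκ0m], ?_⟩
    simp only [Finset.mem_filter, mem_support_iff, not_and]
    intro h
    rw [hQc _ hκ0m, hk1] at h
    simp at h
  · intro κ
    simp only [Finset.mem_filter, mem_support_iff]
    rintro ⟨h1, h2⟩
    refine ⟨?_, h2⟩
    rw [← hs1]
    intro h3
    rw [hQc κ h2, h3] at h1
    simp at h1
end minimal
end CY

namespace CY

section indep
open MvPolynomial

/-- Constant specialization after twisting: coefficient formula. -/
theorem coeff_spec {k S : Type*} [Field k] [Fintype S] (sk : k →+* k) (B : k) (y : S → k)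
    (P : MvPolynomial (Option S) k) (r : ℕ) :
    (P.eval₂ (Polynomial.C.comp sk) (fun j => Option.elim j (Polynomial.C B * Polynomial.X)
      (fun s => Polynomial.C (y s)))).coeff r =
    ∑ κ ∈ P.support, if κ none = r then sk (coeff κ P) * B ^ r * ∏ s, y s ^ κ (some s) else 0 := by
  rw [eval₂_eq', Polynomial.finsetSum_coeff]
  refine Finset.sum_congr rfl fun κ _ => ?_
  rw [Fintype.prod_option]
  simp only [Option.elim_none, Option.elim_some, RingHom.comp_apply, ← Polynomial.C_pow, mul_pow]
  rw [← map_prod]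
  have : Polynomial.C (sk (coeff κ P)) * (Polynomial.C (B ^ κ none) * Polynomial.X ^ κ none *
      Polynomial.C (∏ s, y s ^ κ (some s))) =
      Polynomial.C (sk (coeff κ P) * B ^ κ none * ∏ s, y s ^ κ (some s)) * Polynomial.X ^ κ none := by
    simp only [Polynomial.C_mul]; ring
  rw [this, Polynomial.coeff_C_mul_X_pow]
  by_cases h : κ none = r
  · simp [h]
  · rw [if_neg h, if_neg (Ne.symm h)]

theorem eq_single_none {S : Type*} (κ : Option S →₀ ℕ) (h : ∀ s, κ (some s) = 0) :
    κ = Finsupp.single none (κ none) := by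
  ext j
  cases j with
  | none => simp
  | some s => simp [h s]

theorem indep_abs {k M S : Type*} [Field k] [Field M] [Fintype S] {sk : k →+* k} {sM : M →+* M}
    {i : k →+* M} (hi : ∀ c, i (sk c) = sM (i c)) {p Q : ℕ} (hp : p.Prime) [CharP k p] (hQ : 0 < Q)
    {b : k} (hb : b ≠ 0) {n : S → ℕ} (hn : Function.Injective n) (hn0 : ∀ s, 0 < n s)
    (hnp : ∀ s, ¬ p ∣ n s)
    {H : S → k} {u : M} (hu : u ≠ 0) (hσu : sM u = i b ^ Q * u) {z : S → M}
    (hz : ∀ s, sM (z s) = i b ^ n s * (z s - i (H s)))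
    (M1 : ∀ d : M, d ≠ 0 → ∀ e : ℕ, sM d = i b ^ e * d → Q ∣ e)
    (hfix : ∀ d : M, sM d = d → ∃ c, i c = d)
    (R0 : ∀ g : k, ∀ e, 0 < e → sk g = b ^ e * g → g = 0)
    (R1 : ∀ (R : k) (s : S) (l : ℕ), sk R ≠ b ^ (n s * p ^ l) * (R - H s ^ p ^ l))
    (P : MvPolynomial (Option S) k) (hP : P.eval₂ i (fun j => Option.elim j u z) = 0) : P = 0 := by
  classical
  by_contra hP0
  set x : Option S → M := fun j => Option.elim j u z with hxd
  set w : Option S → ℕ := fun j => Option.elim j Q n with hwd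
  set H' : Option S → k := fun j => Option.elim j 0 H with hHd
  have hw : ∀ j, 0 < w j := by
    intro j
    cases j with
    | none => exact hQ
    | some s => exact hn0 s
  have hx : ∀ j, sM (x j) = i b ^ w j * (x j - i (H' j)) := by
    intro j
    cases j with
    | none => simp [hxd, hwd, hHd, hσu]
    | some s => exact hz s
  have hib : i b ≠ 0 := by simpa using hb
  obtain ⟨m, P, hP1, hPE, hPW, hmin, heig⟩ := exists_min hi hw hx P hP0 hP
  -- Hasse derivatives
  have hC : ∀ (s : S) (a : ℕ), 0 < a → hd (some s) a P ≠ 0 → ∃ (r : ℕ) (γ : k),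
      sk γ = γ ∧ hd (some s) a P = monomial (Finsupp.single none r) γ ∧ Q * r + n s * a = m := by
    intro s a ha h0
    obtain ⟨h1, h2, h3⟩ := hd_eig hb hPW heig (some s) a h0
    have hws : w (some s) = n s := rfl
    rw [hws] at h1 h2 h3
    have hpos : 0 < n s * a := Nat.mul_pos (hn0 s) ha
    set D := hd (some s) a P with hD
    have hED : eval₂Hom i x D ≠ 0 := fun h => h0 (hmin D (h2.mono w (by omega)) h)
    have hσ := eval_st hi hx D
    rw [h3, map_mul] at hσ
    simp only [coe_eval₂Hom, eval₂_C, map_pow] at hσ hED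
    obtain ⟨r, hr⟩ := M1 _ hED _ hσ.symm
    rw [hr] at hσ h2
    have hur : u ^ r ≠ 0 := pow_ne_zero _ hu
    obtain ⟨γ, hγ⟩ := hfix (eval₂ i x D / u ^ r) (by
      rw [map_div₀, ← hσ, map_pow, hσu, mul_pow, ← pow_mul]
      have := pow_ne_zero (Q * r) hib
      field_simp)
    refine ⟨r, γ, ?_, ?_, by omega⟩
    · apply i.injective
      rw [hi, hγ, map_div₀, ← hσ, map_pow, hσu, mul_pow, ← pow_mul]
      have := pow_ne_zero (Q * r) hib
      field_simp
    · rw [← sub_eq_zero]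
      refine hmin _ (Wl.mono w (Wl.sub w h2 ?_) (by omega)) ?_
      · have := Wl.monomial w (Finsupp.single none r) γ
        rw [Finsupp.weight_single] at this
        have h5 : r • w none = Q * r := mul_comm _ _
        rwa [h5] at this
      · simp only [coe_eval₂Hom, eval₂_sub, eval₂_monomial, hγ]
        simp [hxd, hur]
  have hsupp : ∀ κ, coeff κ P ≠ 0 → ∀ s, κ (some s) ≠ 0 → ∃ l,
      κ = Finsupp.single none (κ none) + Finsupp.single (some s) (p ^ l) ∧
      Q * κ none + n s * p ^ l = m ∧ sk (coeff κ P) = coeff κ P := by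
    intro κ hκ s hs
    have key : ∀ a, 0 < a → a ≤ κ (some s) → ¬ p ∣ (κ (some s)).choose a →
        ∃ (r : ℕ) (γ : k), sk γ = γ ∧ hd (some s) a P = monomial (Finsupp.single none r) γ ∧ Q * r + n s * a = m ∧
        κ - Finsupp.single (some s) a = Finsupp.single none r ∧
        coeff (κ - Finsupp.single (some s) a) (hd (some s) a P) = (κ (some s)).choose a * coeff κ P := by
      intro a ha hle hnd
      have e1 : κ - Finsupp.single (some s) a + Finsupp.single (some s) a = κ := by
        apply tsub_add_cancel_of_le
        rw [Finsupp.single_le_iff]; exact hle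
      have e2 := coeff_hd (some s) a P (κ - Finsupp.single (some s) a)
      rw [e1] at e2
      have e3 : (κ - Finsupp.single (some s) a) (some s) + a = κ (some s) := by
        simp; omega
      rw [e3] at e2
      have e4 : ((κ (some s)).choose a : k) ≠ 0 := by rwa [Ne, CharP.cast_eq_zero_iff k p]
      have e5 : coeff (κ - Finsupp.single (some s) a) (hd (some s) a P) ≠ 0 := by
        rw [e2]; exact mul_ne_zero e4 hκ
      obtain ⟨r, γ, h1, h2, h3⟩ := hC s a ha (fun h => e5 (by rw [h]; simp))
      refine ⟨r, γ, h1, h2, h3, ?_, e2⟩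
      rw [h2, coeff_monomial] at e5
      split_ifs at e5 with h
      · exact h.symm
      · exact absurd rfl e5
    obtain ⟨l, hl⟩ := pow_of_choose p hp (κ (some s)) (Nat.pos_of_ne_zero hs) (by
      intro j hj hj2
      by_contra hnd
      obtain ⟨r, γ, _, _, _, h4, _⟩ := key j hj hj2.le hnd
      have := DFunLike.congr_fun h4 (some s)
      simp at this
      omega)
    obtain ⟨r, γ, h1, h2, h3, h4, h5⟩ := key _ (Nat.pos_of_ne_zero hs) le_rfl
      (by rw [Nat.choose_self]; exact hp.one_lt.ne' ∘ Nat.dvd_one.1)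
    have hr : κ none = r := by
      have := DFunLike.congr_fun h4 none
      simpa using this
    refine ⟨l, ?_, by rw [hr, ← hl]; exact h3, ?_⟩
    · rw [hr, ← h4, ← hl]
      symm
      apply tsub_add_cancel_of_le
      rw [Finsupp.single_le_iff]
    · rw [h4, h2, coeff_monomial, if_pos rfl, Nat.choose_self, Nat.cast_one, one_mul] at h5
      rw [← h5, h1]
  -- specialization
  have hspec : ∀ r, (∑ κ ∈ P.support, if κ none = r then sk (coeff κ P) * (b ^ Q) ^ r *
      ∏ s, (- (b ^ n s * H s)) ^ κ (some s) else 0) = b ^ m * coeff (Finsupp.single none r) P := by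
    intro r
    rw [← coeff_spec sk]
    have e1 : ∀ P : MvPolynomial (Option S) k, eval₂ (Polynomial.C.comp sk) (fun j => Option.elim j (Polynomial.C (b ^ Q) * Polynomial.X)
      (fun s => Polynomial.C (- (b ^ n s * H s)))) P = eval₂Hom Polynomial.C (fun j => Option.elim j Polynomial.X (fun _ => (0 : Polynomial k)))
        (st w sk b H' P) := by
      intro P
      rw [← coe_eval₂Hom, ← RingHom.comp_apply]
      congr 1
      refine MvPolynomial.ringHom_ext (fun c => ?_) (fun j => ?_)
      · simp [st_C]
      · cases j with
        | none => simp [st_X, hwd, hHd]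
        | some s => simp [st_X, hwd, hHd]
    have e2 := coeff_spec (RingHom.id k) 1 (fun _ : S => 0) P r
    simp only [Polynomial.C_1, one_mul, Polynomial.C_0, RingHom.comp_id] at e2
    rw [e1, heig, map_mul, coe_eval₂Hom, eval₂_C, Polynomial.coeff_C_mul, e2]
    congr 1
    have e3 : ∀ κ ∈ P.support, (if κ none = r then (RingHom.id k) (coeff κ P) * 1 ^ r *
        ∏ s : S, (0 : k) ^ κ (some s) else 0) = if κ = Finsupp.single none r then coeff κ P else 0 := by
      intro κ _
      by_cases h : κ = Finsupp.single none r
      · rw [if_pos h, if_pos (by rw [h]; simp)]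
        rw [h]; simp
      · rw [if_neg h]
        split_ifs with h1
        · obtain ⟨s, hs⟩ : ∃ s, κ (some s) ≠ 0 := by
            by_contra! h2
            exact h (by rw [← h1]; exact eq_single_none κ h2)
          rw [Finset.prod_eq_zero (Finset.mem_univ s) (zero_pow hs), mul_zero]
        · rfl
    rw [Finset.sum_congr rfl e3, Finset.sum_ite_eq']
    split_ifs with h
    · rfl
    · exact (notMem_support_iff.1 h).symm
  by_cases hX : ∃ κ s, coeff κ P ≠ 0 ∧ κ (some s) ≠ 0
  · obtain ⟨κ1, s, h1, h2⟩ := hX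
    obtain ⟨l, h3, h4, h5⟩ := hsupp κ1 h1 s h2
    set r := κ1 none with hr
    set κ0 : Option S →₀ ℕ := Finsupp.single none r with hκ0
    have hne : κ0 ≠ κ1 := by
      intro h
      have := DFunLike.congr_fun h (some s)
      simp [hκ0] at this
      exact h2 this.symm
    have h6 := hspec r
    have hsub : (∑ κ ∈ P.support, if κ none = r then sk (coeff κ P) * (b ^ Q) ^ r *
      ∏ s, (- (b ^ n s * H s)) ^ κ (some s) else 0) = ∑ κ ∈ {κ0, κ1}, if κ none = r then sk (coeff κ P) * (b ^ Q) ^ r *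
      ∏ s, (- (b ^ n s * H s)) ^ κ (some s) else 0 := by
      have g1 : ∀ κ ∉ P.support, (if κ none = r then sk (coeff κ P) * (b ^ Q) ^ r *
          ∏ s, (- (b ^ n s * H s)) ^ κ (some s) else 0) = 0 := by
        intro κ hκ
        rw [notMem_support_iff.1 hκ]; simp
      have g2 : ∀ κ ∉ ({κ0, κ1} : Finset (Option S →₀ ℕ)), (if κ none = r then sk (coeff κ P) * (b ^ Q) ^ r *
          ∏ s, (- (b ^ n s * H s)) ^ κ (some s) else 0) = 0 := by
        intro κ hκ
        by_cases hs : κ ∈ P.support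
        swap
        · exact g1 κ hs
        rw [if_neg]
        intro hκr
        apply hκ
        by_cases hall : ∀ s, κ (some s) = 0
        · rw [eq_single_none κ hall, hκr]; simp [hκ0]
        · push Not at hall
          obtain ⟨s', hs'⟩ := hall
          obtain ⟨l', a1, a2, _⟩ := hsupp κ (mem_support_iff.1 hs) s' hs'
          rw [hκr] at a1 a2
          have a3 : n s' * p ^ l' = n s * p ^ l := by omega
          have a4 : l' = l := by
            rcases lt_trichotomy l' l with h | h | h
            · exfalso
              obtain ⟨c, rfl⟩ := Nat.exists_eq_add_of_lt h
              refine hnp s' ⟨n s * p ^ c, ?_⟩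
              apply Nat.eq_of_mul_eq_mul_right (pow_pos hp.pos l')
              rw [a3, pow_succ, pow_add]; ring
            · exact h
            · exfalso
              obtain ⟨c, rfl⟩ := Nat.exists_eq_add_of_lt h
              refine hnp s ⟨n s' * p ^ c, ?_⟩
              apply Nat.eq_of_mul_eq_mul_right (pow_pos hp.pos l)
              rw [← a3, pow_succ, pow_add]; ring
          subst a4
          have a5 : s' = s := hn (Nat.eq_of_mul_eq_mul_right (pow_pos hp.pos l') a3)
          subst a5
          rw [a1, ← h3]; simp
      have g3 := Finset.sum_subset (Finset.subset_union_left (s₁ := P.support) (s₂ := {κ0, κ1})) (fun κ _ hκ => g1 κ hκ)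
      have g4 := Finset.sum_subset (Finset.subset_union_right (s₁ := P.support) (s₂ := {κ0, κ1})) (fun κ _ hκ => g2 κ hκ)
      rw [g3, g4]
    rw [hsub, Finset.sum_pair hne, if_pos (by simp [hκ0]), if_pos rfl] at h6
    have p0 : ∏ s, (- (b ^ n s * H s)) ^ κ0 (some s) = 1 := by simp [hκ0]
    have p1 : ∏ s, (- (b ^ n s * H s)) ^ κ1 (some s) = - (b ^ (n s * p ^ l) * H s ^ p ^ l) := by
      rw [Finset.prod_eq_single s]
      · have this0 : κ1 (some s) = p ^ l := by
          rw [h3]; simp [hκ0]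
        have := Fact.mk hp
        rw [this0, neg_pow, neg_one_pow_char_pow k p l, mul_pow, ← pow_mul]; ring
      · intro s' _ hs'
        have : κ1 (some s') = 0 := by
          rw [h3]; simp [Finsupp.single_apply, hs'.symm, hκ0]
        rw [this, pow_zero]
      · intro h; exact absurd (Finset.mem_univ _) h
    rw [p0, p1, h5, ← h4, ← pow_mul, pow_add, mul_one] at h6
    refine R1 (- coeff κ0 P / coeff κ1 P) s l ?_
    have hbr : b ^ (Q * r) ≠ 0 := pow_ne_zero _ hb
    have h7 : sk (coeff κ0 P) = b ^ (n s * p ^ l) * (coeff κ0 P + coeff κ1 P * H s ^ p ^ l) := by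
      apply mul_right_cancel₀ hbr
      linear_combination h6
    rw [map_div₀, map_neg, h7, h5]
    field_simp
    ring
  · push Not at hX
    have g0 : ∀ κ, coeff κ P ≠ 0 → Q * κ none = m := by
      intro κ hκ
      have hκe := eq_single_none κ (fun s => hX κ s hκ)
      have h6 := hspec (κ none)
      rw [Finset.sum_eq_single κ] at h6
      · rw [if_pos rfl, ← hκe, ← pow_mul] at h6
        have p0 : ∏ s, (- (b ^ n s * H s)) ^ κ (some s) = 1 :=
          Finset.prod_eq_one fun s _ => by rw [hX κ s hκ, pow_zero]
        have hle := hPW κ hκ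
        rw [hκe, Finsupp.weight_single] at hle
        have h5 : κ none • w none = Q * κ none := mul_comm _ _
        rw [h5] at hle
        by_contra hne
        refine hκ (R0 _ (m - Q * κ none) (by omega) ?_)
        have hbr : b ^ (Q * κ none) ≠ 0 := pow_ne_zero _ hb
        apply mul_right_cancel₀ hbr
        rw [p0, mul_one] at h6
        rw [h6, mul_right_comm, ← pow_add]
        congr 2; omega
      · intro μ hμ hne
        rw [if_neg]
        intro h
        have := eq_single_none μ (fun s => hX μ s (mem_support_iff.1 hμ))
        exact hne (by rw [this, h, ← hκe])
      · intro h
        rw [notMem_support_iff.1 h]; simp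
    obtain ⟨κ, hκ⟩ := ne_zero_iff.1 hP1
    have hPm : P = monomial κ (coeff κ P) := by
      ext μ
      rw [coeff_monomial]
      split_ifs with h
      · rw [h]
      · by_contra hμ
        apply h
        rw [eq_single_none κ (fun s => hX κ s hκ), eq_single_none μ (fun s => hX μ s hμ)]
        have := (g0 κ hκ).trans (g0 μ hμ).symm
        rw [Nat.eq_of_mul_eq_mul_left hQ this]
    rw [hPm, coe_eval₂Hom, eval₂_monomial, eq_single_none κ (fun s => hX κ s hκ)] at hPE
    simp only [pow_zero, Finsupp.prod_single_index, mul_eq_zero, map_eq_zero] at hPE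
    rcases hPE with h | h
    · rw [← eq_single_none κ (fun s => hX κ s hκ)] at h
      exact hκ h
    · exact hu (eq_zero_of_pow_eq_zero h)
end indep
end CY

namespace CY

section ratsol
open Polynomial
variable {F : Type*} [Field F] (Q : ℕ) (t : F)

theorem algRat_inj : Function.Injective (algebraMap F[X] (RatFunc F)) := RatFunc.algebraMap_injective F

/-- `X ↦ X^Q` on rational functions. -/
noncomputable def skr (F : Type*) [Field F] (Q : ℕ) (hQ : 1 < Q) : RatFunc F →+* RatFunc F :=
  IsFractionRing.map (A := F[X]) (B := F[X]) (j := (expand F Q : F[X] →+* F[X]))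
    (expand_injective (by omega))

theorem skr_alg (hQ : 1 < Q) (f : F[X]) :
    skr F Q hQ (algebraMap F[X] (RatFunc F) f) = algebraMap F[X] (RatFunc F) (expand F Q f) := by
  simp [skr, IsFractionRing.map]

theorem rat_sol (hQ : 1 < Q) (e : ℕ) (he : 0 < e) (H : F[X]) (R : RatFunc F)
    (hR : skr F Q hQ R = (algebraMap F[X] (RatFunc F) (C t - X ^ Q)) ^ e * (R - algebraMap F[X] (RatFunc F) H)) :
    ∃ U : F[X], R = algebraMap F[X] (RatFunc F) U ∧ expand F Q U = (C t - X ^ Q) ^ e * (U - H) ∧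
      U.eval t = 0 := by
  have hinj := algRat_inj (F := F)
  have hc : algebraMap F[X] (RatFunc F) R.denom ≠ 0 := by
    rw [Ne, map_eq_zero_iff _ hinj]; exact R.denom_ne_zero
  have hc2 : algebraMap F[X] (RatFunc F) (expand F Q R.denom) ≠ 0 := by
    rw [Ne, map_eq_zero_iff _ hinj, expand_eq_zero (by omega)]; exact R.denom_ne_zero
  have hRe := R.num_div_denom
  have h1 : expand F Q R.num * R.denom = (C t - X ^ Q) ^ e * (R.num - H * R.denom) * expand F Q R.denom := by
    apply hinj
    have hL : skr F Q hQ R = algebraMap F[X] (RatFunc F) (expand F Q R.num) /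
        algebraMap F[X] (RatFunc F) (expand F Q R.denom) := by
      conv_lhs => rw [← hRe]
      rw [map_div₀, skr_alg, skr_alg]
    have hL2 : R - algebraMap F[X] (RatFunc F) H = (algebraMap F[X] (RatFunc F) R.num -
        algebraMap F[X] (RatFunc F) H * algebraMap F[X] (RatFunc F) R.denom) /
        algebraMap F[X] (RatFunc F) R.denom := by
      rw [sub_div, mul_div_cancel_right₀ _ hc, hRe]
    rw [hL, hL2, div_eq_iff hc2] at hR
    simp only [map_mul, map_pow, map_sub] at hR ⊢
    rw [hR]
    field_simp
  have h2 : expand F Q R.denom ∣ R.denom := by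
    have h3 : IsCoprime (expand F Q R.denom) (expand F Q R.num) :=
      (R.isCoprime_num_denom.symm.map (expand F Q : F[X] →+* F[X]))
    exact h3.dvd_of_dvd_mul_left (Dvd.intro_left _ h1.symm)
  have h3 : R.denom.natDegree = 0 := by
    have := natDegree_le_of_dvd h2 R.denom_ne_zero
    rw [natDegree_expand] at this
    by_contra h
    have : 0 < R.denom.natDegree := by omega
    nlinarith
  have h4 : R.denom = 1 := by
    exact R.monic_denom.natDegree_eq_zero.1 h3
  have h5 : expand F Q R.num = (C t - X ^ Q) ^ e * (R.num - H) := by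
    rw [h4] at h1; simpa using h1
  refine ⟨R.num, ?_, h5, ?_⟩
  · rw [h4, map_one, div_one] at hRe
    exact hRe.symm
  · have h6 : expand F Q (X - C t) ∣ expand F Q R.num := by
      rw [h5]
      refine Dvd.dvd.mul_right (dvd_pow ?_ he.ne') _
      rw [map_sub, expand_X, expand_C]
      exact ⟨-1, by ring⟩
    have h7 := modByMonic_add_div R.num (X - C t)
    rw [modByMonic_X_sub_C_eq_C_eval] at h7
    have h8 : expand F Q (X - C t) ∣ C (R.num.eval t) := by
      have := congrArg (expand F Q) h7
      rw [map_add, map_mul, expand_C] at this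
      rw [← this] at h6
      exact (dvd_add_left (Dvd.intro _ rfl)).1 h6
    by_contra h9
    have := natDegree_le_of_dvd h8 (by rwa [Ne, C_eq_zero])
    rw [natDegree_expand, natDegree_X_sub_C, natDegree_C] at this
    omega

theorem sol_zero (ht : Function.Injective (fun j : ℕ => t ^ Q ^ j)) (e : ℕ) (U : F[X])
    (hU : expand F Q U = (C t - X ^ Q) ^ e * U) (h0 : U.eval t = 0) : U = 0 := by
  have h1 : ∀ j, U.eval (t ^ Q ^ j) = 0 := by
    intro j
    induction j with
    | zero => simpa using h0
    | succ j ih =>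
      have := congrArg (fun f => f.eval (t ^ Q ^ j)) hU
      simp only [expand_eval, eval_mul, ih, mul_zero] at this
      rwa [pow_succ, pow_mul]
  refine Polynomial.eq_zero_of_infinite_isRoot U ?_
  exact (Set.infinite_range_of_injective ht).mono (by rintro _ ⟨j, rfl⟩; exact h1 j)

theorem sol_int (hQ : 1 < Q) (B : Subring F) (ht : t ∈ B) (e : ℕ) (he : ¬ (Q - 1) ∣ e) : ∀ (d : ℕ) (U : F[X]),
    U.natDegree ≤ d → (∀ k, ((C t - X ^ Q) ^ e * U - expand F Q U).coeff k ∈ B) → ∀ k, U.coeff k ∈ B := by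
  have hmon : ((X : F[X]) ^ Q - C t).Monic := monic_X_pow_sub_C t (by omega)
  have hdeg : ((X : F[X]) ^ Q - C t).natDegree = Q := natDegree_X_pow_sub_C
  have hlift : ∀ (c : F) (d : ℕ), c ∈ B → ∀ k, ((C t - X ^ Q) ^ e * (C c * X ^ d) - expand F Q (C c * X ^ d)).coeff k ∈ B := by
    intro c d hc k
    have : (C t - X ^ Q) ^ e * (C c * X ^ d) - expand F Q (C c * X ^ d) ∈ Polynomial.liftsRing B.subtype := by
      have hC : ∀ c ∈ B, (C c : F[X]) ∈ Polynomial.liftsRing B.subtype := fun c hc => ⟨C ⟨c, hc⟩, by simp⟩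
      have hX : (X : F[X]) ∈ Polynomial.liftsRing B.subtype := ⟨X, by simp⟩
      simp only [map_mul, expand_C, map_pow, expand_X]
      exact sub_mem (mul_mem (pow_mem (sub_mem (hC t ht) (pow_mem hX _)) _) (mul_mem (hC c hc) (pow_mem hX _)))
        (mul_mem (hC c hc) (pow_mem (pow_mem hX _) _))
    obtain ⟨g, hg⟩ := this
    rw [← hg]
    simp
  have hneg : ∀ U : F[X], (C t - X ^ Q) ^ e * U = C ((-1) ^ e) * ((X ^ Q - C t) ^ e * U) := by
    intro U
    rw [← neg_sub, neg_pow, C_pow, C_neg, C_1]; ring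
  have hB1 : ∀ x : F, (-1) ^ e * x ∈ B → x ∈ B := by
    intro x hx
    have : x = (-1) ^ e * ((-1) ^ e * x) := by rw [← mul_assoc, ← mul_pow]; simp
    rw [this]
    exact mul_mem (pow_mem (neg_mem (one_mem B)) e) hx
  have hlead : ∀ U : F[X], (∀ k, ((C t - X ^ Q) ^ e * U - expand F Q U).coeff k ∈ B) → U ≠ 0 → U.leadingCoeff ∈ B := by
    intro U hU hU0
    have n1 : ((X ^ Q - C t) ^ e * U).natDegree = Q * e + U.natDegree := by
      rw [(hmon.pow e).natDegree_mul' hU0, hmon.natDegree_pow, hdeg, mul_comm]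
    have l1 : ((X ^ Q - C t) ^ e * U).coeff (Q * e + U.natDegree) = U.leadingCoeff := by
      rw [← n1, coeff_natDegree, leadingCoeff_mul, (hmon.pow e).leadingCoeff, one_mul]
    have n2 : (expand F Q U).natDegree = U.natDegree * Q := natDegree_expand _ _
    have l2 : (expand F Q U).coeff (U.natDegree * Q) = U.leadingCoeff := by
      rw [coeff_expand_mul (by omega)]; rfl
    rcases lt_trichotomy (Q * e + U.natDegree) (U.natDegree * Q) with h | h | h
    · have := hU (U.natDegree * Q)
      rw [coeff_sub, hneg, coeff_C_mul, coeff_eq_zero_of_natDegree_lt (by omega), mul_zero, zero_sub, l2] at this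
      simpa using this
    · exfalso
      apply he
      have h1 : Q - 1 ∣ Q * e := by
        refine ⟨U.natDegree, ?_⟩
        rw [Nat.sub_mul, one_mul, mul_comm Q U.natDegree]; omega
      refine Nat.Coprime.dvd_of_dvd_mul_left ?_ h1
      rw [Nat.coprime_comm]
      exact Nat.coprime_self_sub_right (by omega) |>.2 (Nat.coprime_one_right _)
    · have := hU (Q * e + U.natDegree)
      rw [coeff_sub, hneg, coeff_C_mul, l1, coeff_eq_zero_of_natDegree_lt (by omega), sub_zero] at this
      exact hB1 _ this
  intro d
  induction d with
  | zero =>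
    intro U hd hU k
    rw [eq_C_of_natDegree_le_zero hd] at hU ⊢
    by_cases h0 : U.coeff 0 = 0
    · rw [h0]; simp
    · have := hlead _ hU (by rwa [Ne, C_eq_zero])
      rw [leadingCoeff_C] at this
      rw [coeff_C]; split_ifs
      · exact this
      · exact zero_mem B
  | succ d ih =>
    intro U hd hU k
    by_cases h0 : U = 0
    · rw [h0]; simp
    have hl := hlead U hU h0
    by_cases hd0 : U.natDegree = 0
    · rw [eq_C_of_natDegree_le_zero hd0.le] at hl ⊢
      rw [leadingCoeff_C] at hl
      rw [coeff_C]; split_ifs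
      · exact hl
      · exact zero_mem B
    have h1 : ∀ k, U.eraseLead.coeff k ∈ B := by
      apply ih
      · have := eraseLead_natDegree_le U
        omega
      · intro k
        have h3 := sub_mem (hU k) (hlift U.leadingCoeff U.natDegree hl k)
        have h4 : U.eraseLead = U - C U.leadingCoeff * X ^ U.natDegree := by
          rw [C_mul_X_pow_eq_monomial, self_sub_monomial_natDegree_leadingCoeff]
        rw [← coeff_sub] at h3
        rw [h4]
        have h5 : (C t - X ^ Q) ^ e * (U - C U.leadingCoeff * X ^ U.natDegree) -
            expand F Q (U - C U.leadingCoeff * X ^ U.natDegree) =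
            ((C t - X ^ Q) ^ e * U - expand F Q U) - ((C t - X ^ Q) ^ e * (C U.leadingCoeff * X ^ U.natDegree) -
              expand F Q (C U.leadingCoeff * X ^ U.natDegree)) := by
          rw [map_sub]; ring
        rw [h5]
        exact h3
    rw [← eraseLead_add_C_mul_X_pow U, coeff_add, coeff_C_mul_X_pow]
    refine add_mem (h1 k) ?_
    split_ifs
    · exact hl
    · exact zero_mem B
end ratsol
end CY

namespace CY

section fixed
open Polynomial

theorem indep_fix {F M S : Type*} [Field F] [Field M] [Algebra F M] [Fintype S] {sM : M →+* M}
    {p Q : ℕ} (hp : p.Prime) [CharP F p] (hQ : 1 < Q)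
    (hF : ∀ c : F, sM (algebraMap F M c) = algebraMap F M c)
    (hfix : ∀ d : M, sM d = d → ∃ c : F, algebraMap F M c = d)
    {t : F} {ϑ : M} (hϑ : sM ϑ = ϑ ^ Q)
    (ht : Function.Injective (fun j : ℕ => t ^ Q ^ j))
    (B : Subring F) (htB : t ∈ B)
    {n : S → ℕ} (hn : Function.Injective n) (hn0 : ∀ s, 0 < n s)
    (hnp : ∀ s, ¬ p ∣ n s) (hnQ : ∀ s l, ¬ (Q - 1) ∣ n s * p ^ l)
    {H : S → F[X]} (hH : ∀ s k, (H s).coeff k ∈ B) {u : M} (hu : u ≠ 0)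
    (hσu : sM u = (algebraMap F M t - ϑ ^ Q) ^ (Q - 1) * u) {z : S → M}
    (hz : ∀ s, sM (z s) = (algebraMap F M t - ϑ ^ Q) ^ n s * (z s - aeval ϑ (H s)))
    (M1 : ∀ d : M, d ≠ 0 → ∀ e : ℕ, sM d = (algebraMap F M t - ϑ ^ Q) ^ e * d → (Q - 1) ∣ e)
    (hz0 : ∀ s l (U : F[X]), (∀ k, U.coeff k ∈ B) → U.eval t = 0 → z s ^ p ^ l ≠ aeval ϑ U)
    (i : RatFunc F →+* M) (hi : ∀ f : F[X], i (algebraMap F[X] (RatFunc F) f) = aeval ϑ f)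
    (P : MvPolynomial (Option S) (RatFunc F)) (hP : P.eval₂ i (fun j => Option.elim j u z) = 0) : P = 0 := by
  have := Fact.mk hp
  have hcp : CharP (RatFunc F) p := charP_of_injective_ringHom (algebraMap F (RatFunc F)).injective p
  have hsa : ∀ f : F[X], sM (aeval ϑ f) = aeval ϑ (expand F Q f) := by
    intro f
    rw [expand_aeval, aeval_def, aeval_def, Polynomial.hom_eval₂, hϑ]
    congr 1
    ext c; exact hF c
  have hcompat : ∀ c, i (skr F Q hQ c) = sM (i c) := by
    intro c
    rw [← RingHom.comp_apply, ← RingHom.comp_apply]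
    congr 1
    apply IsLocalization.ringHom_ext (nonZeroDivisors F[X])
    refine RingHom.ext fun f => ?_
    simp only [RingHom.comp_apply, skr_alg, hi, hsa]
  have hib : i (algebraMap F[X] (RatFunc F) (C t - X ^ Q)) = algebraMap F M t - ϑ ^ Q := by
    rw [hi]; simp
  refine indep_abs (sk := skr F Q hQ) (sM := sM) (i := i) hcompat hp (Q := Q - 1) (by omega)
    (b := algebraMap F[X] (RatFunc F) (C t - X ^ Q)) ?_ hn hn0 hnp (H := fun s => algebraMap F[X] (RatFunc F) (H s))
    hu ?_ (z := z) ?_ ?_ ?_ ?_ ?_ P hP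
  · rw [Ne, map_eq_zero_iff _ algRat_inj]
    intro h
    have h2 := congrArg natDegree h
    rw [← neg_sub, natDegree_neg, natDegree_X_pow_sub_C, natDegree_zero] at h2
    omega
  · rw [hib, hσu]
  · intro s
    rw [hib, hi, hz]
  · intro d hd e he
    rw [hib] at he
    exact M1 d hd e he
  · intro d hd
    obtain ⟨c, hc⟩ := hfix d hd
    exact ⟨algebraMap F[X] (RatFunc F) (C c), by rw [hi, aeval_C, hc]⟩
  · intro g e he hg
    obtain ⟨U, h1, h2, h3⟩ := rat_sol Q t hQ e he 0 g (by simpa using hg)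
    rw [h1, sol_zero Q t ht e U (by simpa using h2) h3, map_zero]
  · intro R s l hR
    obtain ⟨U, h1, h2, h3⟩ := rat_sol Q t hQ (n s * p ^ l) (Nat.mul_pos (hn0 s) (pow_pos hp.pos l)) (H s ^ p ^ l) R
      (by rw [map_pow]; exact hR)
    have hUB : ∀ k, U.coeff k ∈ B := by
      refine sol_int Q t hQ B htB (n s * p ^ l) (hnQ s l) U.natDegree U le_rfl ?_
      intro k
      have hlift : (C t - X ^ Q) ^ (n s * p ^ l) * U - expand F Q U ∈ Polynomial.liftsRing B.subtype := by
        have e1 : (C t - X ^ Q) ^ (n s * p ^ l) * U - expand F Q U =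
          (C t - X ^ Q) ^ (n s * p ^ l) * H s ^ p ^ l := by rw [h2]; ring
        rw [e1]
        have hC : (C t : F[X]) ∈ Polynomial.liftsRing B.subtype := ⟨C ⟨t, htB⟩, by simp⟩
        have hX : (X : F[X]) ∈ Polynomial.liftsRing B.subtype := ⟨X, by simp⟩
        refine mul_mem (pow_mem (sub_mem hC (pow_mem hX _)) _) (pow_mem ?_ _)
        change H s ∈ Polynomial.lifts B.subtype
        rw [Polynomial.lifts_iff_coeff_lifts]
        intro k
        exact ⟨⟨_, hH s k⟩, rfl⟩
      obtain ⟨g, hg⟩ := hlift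
      rw [← hg]
      simp
    refine hz0 s l U hUB h3 ?_
    by_contra hne
    have h4 : z s ^ p ^ l - aeval ϑ U ≠ 0 := sub_ne_zero.2 hne
    have hcpM : CharP M p := charP_of_injective_ringHom (algebraMap F M).injective p
    refine hnQ s l (M1 _ h4 (n s * p ^ l) ?_)
    rw [map_sub, map_pow, hz, hsa, h2, mul_pow, sub_pow_char_pow, ← pow_mul]
    simp only [map_mul, map_pow, map_sub, aeval_C, aeval_X]
    ring
end fixed

section concrete
variable {Fq L : Type*} [Field Fq] [Fintype Fq] [NormedField L] [Algebra Fq L]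
  [Algebra (Polynomial Fq) L] [KInf Fq L]
local notation "q" => Fintype.card Fq
local notation "At" => Polynomial (Polynomial Fq)
local notation "θ" => (Polynomial.X : Polynomial Fq)

theorem low_coeff {f : PowerSeries L} (hf : f ≠ 0) :
    ∃ m, PowerSeries.coeff m f ≠ 0 ∧ ∀ k < m, PowerSeries.coeff k f = 0 := by
  classical
  have h : ∃ m, PowerSeries.coeff m f ≠ 0 := by
    by_contra! h
    exact hf (PowerSeries.ext (by simpa using h))
  exact ⟨Nat.find h, Nat.find_spec h, fun k hk => by simpa using Nat.find_min h hk⟩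

theorem M1_aux (e : ℕ) (f g : PowerSeries L) (hf : f ≠ 0) (hg : g ≠ 0)
    (h : sg Fq 1 f * g = emb Fq L (bb Fq) ^ e * f * sg Fq 1 g) : (q - 1) ∣ e := by
  obtain ⟨m, hm, hm'⟩ := low_coeff hf
  obtain ⟨k, hk, hk'⟩ := low_coeff hg
  have hb0 : PowerSeries.coeff 0 (emb Fq L (bb Fq) ^ e) = (-(algebraMap (Polynomial Fq) L θ) ^ q) ^ e := by
    rw [PowerSeries.coeff_zero_eq_constantCoeff, map_pow, ← PowerSeries.coeff_zero_eq_constantCoeff, coeff_emb]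
    rw [bb, Polynomial.coeff_sub, Polynomial.coeff_X_zero, Polynomial.coeff_C_zero, zero_sub, map_neg, map_pow]
  have e1 := coeff_mul_low (f := sg Fq 1 f) (g := g) (m := m) (n := k)
    (fun j hj => by rw [coeff_sg, hm' j hj, zero_pow (pow_pos (q_pos Fq) 1).ne']) hk'
  have e2 := coeff_mul_low (f := emb Fq L (bb Fq) ^ e) (g := f) (m := 0) (n := m)
    (fun j hj => absurd hj (Nat.not_lt_zero j)) hm'
  have e3 := coeff_mul_low (f := emb Fq L (bb Fq) ^ e * f) (g := sg Fq 1 g) (m := m) (n := k) (by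
      intro j hj
      rw [PowerSeries.coeff_mul]
      refine Finset.sum_eq_zero fun x hx => ?_
      have := Finset.HasAntidiagonal.mem_antidiagonal.1 hx
      rw [hm' x.2 (by omega), mul_zero])
    (fun j hj => by rw [coeff_sg, hk' j hj, zero_pow (pow_pos (q_pos Fq) 1).ne'])
  rw [zero_add] at e2
  rw [h, e3, e2, hb0, coeff_sg, coeff_sg, pow_one] at e1
  set x := PowerSeries.coeff m f
  set y := PowerSeries.coeff k g
  obtain ⟨a, ha⟩ := KInf.norm_val (Fq := Fq) x hm
  obtain ⟨c, hc⟩ := KInf.norm_val (Fq := Fq) y hk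
  have e4 := congrArg norm e1
  simp only [norm_mul, norm_pow, norm_neg, norm_theta, ha, hc] at e4
  have hq0 : (q : ℝ) ≠ 0 := (q_posR Fq).ne'
  have e5 : (q : ℝ) ^ ((q : ℤ) * e + a + c * q) = (q : ℝ) ^ (a * q + c) := by
    rw [zpow_add₀ hq0, zpow_add₀ hq0, zpow_add₀ hq0, zpow_mul, zpow_mul, zpow_mul]
    exact_mod_cast e4
  have e6 := zpow_right_injective₀ (q_posR Fq) (one_lt_qR Fq).ne' e5
  have e7 : ((q - 1 : ℕ) : ℤ) ∣ (e : ℤ) := by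
    rw [Nat.cast_sub (show 1 ≤ q from q_pos Fq), Nat.cast_one]
    exact ⟨a - c - e, by linear_combination e6⟩
  exact_mod_cast e7

theorem indep {S : Type*} [Fintype S] {p : ℕ} (hp : p.Prime) [CharP Fq p] {R0 : ℝ} (hR0 : (q : ℝ) < R0)
    {n : S → ℕ} (hn : Function.Injective n) (hn0 : ∀ s, 0 < n s)
    (hnp : ∀ s, ¬ p ∣ n s) (hnQ : ∀ s, ¬ (q - 1) ∣ n s)
    {H : S → At} {u : PowerSeries L} (hu : u ≠ 0)
    (hσu : sg Fq 1 u = emb Fq L (bb Fq) ^ (q - 1) * u) {z : S → PowerSeries L} {β : S → ℝ}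
    (hβ : ∀ s, Bd R0 (β s) (z s))
    (hz : ∀ s, sg Fq 1 (z s) = emb Fq L (bb Fq) ^ n s * (z s - emb Fq L (H s)))
    (hz0 : ∀ s, ev (algebraMap (Polynomial Fq) L θ) (z s) ≠ 0)
    (P : MvPolynomial (Option S) At) (hP : P.eval₂ (emb Fq L) (fun j => Option.elim j u z) = 0) : P = 0 := by
  have hpF := Fact.mk hp
  let M := FractionRing (PowerSeries L)
  let sM : M →+* M := IsFractionRing.map (A := PowerSeries L) (B := PowerSeries L) (j := sg Fq 1) (sg_injective Fq 1)
  have hsM : ∀ f : PowerSeries L, sM (algebraMap _ M f) = algebraMap _ M (sg Fq 1 f) := by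
    intro f
    simp [sM, IsFractionRing.map]
  have hinjM : Function.Injective (algebraMap (PowerSeries L) M) := IsFractionRing.injective _ _
  let F : Subfield M := sM.eqLocusField (RingHom.id M)
  have hFm : ∀ x, x ∈ F ↔ sM x = x := fun x => Iff.rfl
  let em : At →+* M := (algebraMap (PowerSeries L) M).comp (emb Fq L)
  have hem : Function.Injective em := hinjM.comp (emb_inj (Fq := Fq) (L := L))
  have hsem : ∀ f, sM (em f) = em (sp Fq 1 f) := fun f => by
    simp only [em, RingHom.comp_apply, hsM, emb_sp]
  have hmapC : ∀ f : Polynomial Fq, sp Fq 1 (f.map Polynomial.C) = f.map Polynomial.C := by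
    intro f
    ext1 k
    rw [coeff_sp, Polynomial.coeff_map, pow_one, ← Polynomial.C_pow, FiniteField.pow_card]
  let τ : Polynomial Fq →+* F := RingHom.codRestrict (em.comp (Polynomial.mapRingHom Polynomial.C)) F
    (fun f => by rw [hFm, RingHom.comp_apply, hsem, Polynomial.coe_mapRingHom, hmapC])
  have hτ : ∀ f, ((τ f : F) : M) = em (f.map Polynomial.C) := fun f => rfl
  have hτi : Function.Injective τ := by
    intro f g h
    have h1 := congrArg (fun x : F => (x : M)) h
    simp only [hτ] at h1
    exact Polynomial.map_injective _ Polynomial.C_injective (hem h1)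
  let tF : F := τ Polynomial.X
  let th : M := em (Polynomial.C Polynomial.X)
  have htF : algebraMap F M tF = em Polynomial.X := by
    change ((τ Polynomial.X : F) : M) = _
    rw [hτ, Polynomial.map_X]
  have hbM : em (bb Fq) = algebraMap F M tF - th ^ q := by
    rw [htF, bb, map_sub, Polynomial.C_pow, map_pow]
  have hψ : ∀ f : At, Polynomial.aeval th (f.map τ) = em (Polynomial.Bivariate.swap f) := by
    intro f
    have : ((Polynomial.aeval th : Polynomial F →ₐ[F] M) : Polynomial F →+* M).comp (Polynomial.mapRingHom τ) =
        em.comp (Polynomial.Bivariate.swap (R := Fq) : At →+* At) := by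
      refine Polynomial.ringHom_ext (fun a => ?_) ?_
      · simp only [RingHom.comp_apply, Polynomial.coe_mapRingHom, Polynomial.map_C]
        have e1 : ((Polynomial.aeval th : Polynomial F →ₐ[F] M) : Polynomial F →+* M) (Polynomial.C (τ a)) = ((τ a : F) : M) :=
          Polynomial.aeval_C th (τ a)
        have e2 : (Polynomial.Bivariate.swap (R := Fq) : At →+* At) (Polynomial.C a) = a.map Polynomial.C :=
          Polynomial.Bivariate.swap_C a
        rw [e1, e2, hτ]
      · have e2 : (Polynomial.Bivariate.swap (R := Fq) : At →+* At) Polynomial.X = Polynomial.C Polynomial.X :=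
          Polynomial.Bivariate.swap_Y
        rw [RingHom.comp_apply, RingHom.comp_apply, e2]
        simp [th]
    exact RingHom.congr_fun this f
  have hswapev : ∀ f : At, (Polynomial.Bivariate.swap f).eval Polynomial.X = f.eval Polynomial.X := by
    intro f
    have : (Polynomial.evalRingHom Polynomial.X).comp (Polynomial.Bivariate.swap (R := Fq) : At →+* At) =
        Polynomial.evalRingHom Polynomial.X := by
      refine Polynomial.ringHom_ext (fun a => ?_) ?_
      · have e2 : (Polynomial.Bivariate.swap (R := Fq) : At →+* At) (Polynomial.C a) = a.map Polynomial.C :=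
          Polynomial.Bivariate.swap_C a
        rw [RingHom.comp_apply, e2]
        simp [Polynomial.eval_map]
      · have e2 : (Polynomial.Bivariate.swap (R := Fq) : At →+* At) Polynomial.X = Polynomial.C Polynomial.X :=
          Polynomial.Bivariate.swap_Y
        rw [RingHom.comp_apply, e2]
        simp
    exact RingHom.congr_fun this f
  have hth : sM th = th ^ q := by
    rw [hsem, ← map_pow]
    congr 1
    ext1 k
    rw [coeff_sp, ← Polynomial.C_pow, Polynomial.coeff_C, Polynomial.coeff_C, pow_one]
    split_ifs
    · rfl
    · rw [zero_pow (q_pos Fq).ne']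
  have hXinj : Function.Injective (fun j : ℕ => (Polynomial.X : Polynomial Fq) ^ q ^ j) := by
    intro a b h
    have h1 := congrArg Polynomial.natDegree h
    simp only [Polynomial.natDegree_X_pow] at h1
    exact Nat.pow_right_injective (one_lt_q Fq) h1
  have htrans : Function.Injective (Polynomial.aeval (R := F) th) := by
    rw [injective_iff_map_eq_zero]
    intro U hU
    have h1 : ∀ j : ℕ, U.eval₂ (algebraMap F M) (th ^ q ^ j) = 0 := by
      intro j
      induction j with
      | zero => simpa [Polynomial.aeval_def] using hU
      | succ j ih =>
        have h2 := congrArg sM ih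
        rw [Polynomial.hom_eval₂, map_zero, map_pow] at h2
        have h4 : sM.comp (algebraMap F M) = algebraMap F M := by
          ext c; exact c.2
        rw [hth, h4, ← pow_mul, ← pow_succ'] at h2
        exact h2
    by_contra hne
    refine hne (Polynomial.map_injective _ (algebraMap F M).injective ?_)
    rw [Polynomial.map_zero]
    refine Polynomial.eq_zero_of_infinite_isRoot _ ?_
    refine (Set.infinite_range_of_injective (f := fun j : ℕ => th ^ q ^ j) ?_).mono ?_
    · intro a b h
      apply hXinj
      simp only [th, ← map_pow] at h
      simpa using Polynomial.C_injective (hem (by simpa using h))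
    · rintro _ ⟨j, rfl⟩
      rw [Set.mem_ofPred_eq, Polynomial.IsRoot, Polynomial.eval_map]
      exact h1 j
  let i : RatFunc F →+* M := IsFractionRing.lift (A := Polynomial F)
    (g := ((Polynomial.aeval th : Polynomial F →ₐ[F] M) : Polynomial F →+* M)) htrans
  have hi : ∀ f : Polynomial F, i (algebraMap (Polynomial F) (RatFunc F) f) = Polynomial.aeval th f := by
    intro f
    exact IsFractionRing.lift_algebraMap htrans f
  let φ : At →+* RatFunc F := (algebraMap (Polynomial F) (RatFunc F)).comp
    ((Polynomial.mapRingHom τ).comp (Polynomial.Bivariate.swap (R := Fq) : At →+* At))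
  have hφ : ∀ f : At, φ f = algebraMap (Polynomial F) (RatFunc F) ((Polynomial.Bivariate.swap f).map τ) := fun f => rfl
  have hφi : Function.Injective φ := by
    intro f g h
    rw [hφ, hφ] at h
    exact (Polynomial.Bivariate.swap (R := Fq)).injective (Polynomial.map_injective _ hτi (algRat_inj h))
  have hss : ∀ f : At, Polynomial.Bivariate.swap (Polynomial.Bivariate.swap f) = f := by
    intro f
    exact Polynomial.Bivariate.swap.left_inv f
  have hiφ : i.comp φ = em := by
    refine RingHom.ext fun f => ?_
    rw [RingHom.comp_apply, hφ, hi, hψ, hss]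
  have hcF : CharP F p := charP_of_injective_ringHom (τ.comp Polynomial.C).injective p
  refine MvPolynomial.map_injective _ hφi ?_
  rw [map_zero]
  have hppow : ∃ e, 0 < e ∧ q = p ^ e := by
    obtain ⟨e, _, he⟩ := FiniteField.card Fq p
    exact ⟨e, e.pos, he⟩
  obtain ⟨e, he0, hqe⟩ := hppow
  have hcop : Nat.Coprime (q - 1) p := by
    rw [Nat.coprime_comm, hp.coprime_iff_not_dvd]
    intro h
    have h1 : p ∣ q := by rw [hqe]; exact dvd_pow_self p he0.ne'
    have h2 : p ∣ 1 := by
      have := Nat.dvd_sub h1 h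
      rwa [Nat.sub_sub_self (q_pos Fq)] at this
    exact hp.one_lt.ne' (Nat.dvd_one.1 h2)
  refine indep_fix (sM := sM) (Q := q) hp (one_lt_q Fq) (t := tF) (ϑ := th) (fun c => c.2) (fun d hd => ⟨⟨d, hd⟩, rfl⟩) hth ?_
    τ.range ⟨_, rfl⟩ hn hn0 hnp ?_ (H := fun s => (Polynomial.Bivariate.swap (H s)).map τ) ?_
    (u := algebraMap _ M u) ?_ ?_ (z := fun s => algebraMap _ M (z s)) ?_ ?_ ?_ i hi _ ?_
  · intro a b h
    apply hXinj
    apply hτi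
    simpa [tF] using h
  · intro s l h
    exact hnQ s ((hcop.pow_right l).dvd_of_dvd_mul_right h)
  · intro s k
    rw [Polynomial.coeff_map]
    exact ⟨_, rfl⟩
  · rw [Ne, map_eq_zero_iff _ hinjM]; exact hu
  · rw [hsM, hσu, map_mul, map_pow, ← hbM]; rfl
  · intro s
    rw [hsM, hz, map_mul, map_pow, map_sub, hψ, hss, ← hbM]; rfl
  · intro d hd e he
    obtain ⟨f, g, hg, rfl⟩ := IsFractionRing.div_surjective (A := PowerSeries L) d
    have hg0 : g ≠ 0 := nonZeroDivisors.ne_zero hg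
    have hf0 : f ≠ 0 := by rintro rfl; simp at hd
    refine M1_aux (Fq := Fq) e f g hf0 hg0 (hinjM ?_)
    have hg1 : algebraMap _ M g ≠ 0 := by rwa [Ne, map_eq_zero_iff _ hinjM]
    have hg2 : algebraMap _ M (sg Fq 1 g) ≠ 0 := by
      rwa [Ne, map_eq_zero_iff _ hinjM, map_eq_zero_iff _ (sg_injective Fq 1)]
    rw [map_div₀, hsM, hsM, ← hbM, div_eq_iff hg2] at he
    rw [map_mul, map_mul, map_mul, he, map_pow]
    simp only [em, RingHom.comp_apply]
    rw [mul_right_comm, mul_assoc _ (_ / _), div_mul_cancel₀ _ hg1]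
  · intro s l U hU hU0 hzU
    have hl : U ∈ Polynomial.lifts τ := by
      rw [Polynomial.lifts_iff_coeff_lifts]
      exact hU
    obtain ⟨g, hg⟩ := (Polynomial.mem_lifts U).1 hl
    rw [← hg, hψ, ← map_pow] at hzU
    have h1 : z s ^ p ^ l = emb Fq L (Polynomial.Bivariate.swap g) := hinjM hzU
    have h2 : g.eval Polynomial.X = 0 := by
      apply hτi
      rw [map_zero, ← hU0, ← hg, Polynomial.eval_map, ← Polynomial.eval₂_hom]
    rw [← hswapev] at h2
    have hu1 := KInf.complete (L := L) Fq
    have hu2 := KInf.ultra (L := L) Fq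
    have h3 := congrArg (ev (algebraMap (Polynomial Fq) L θ)) h1
    rw [ev_emb, h2, map_zero, ev_pow (hβ s) (by rw [norm_theta]; exact hR0)] at h3
    exact hz0 s (pow_eq_zero_iff (pow_pos hp.pos l).ne' |>.1 h3)
  · rw [MvPolynomial.eval₂_map, hiφ]
    have h3 := congrArg (algebraMap _ M) hP
    rw [map_zero, MvPolynomial.hom_eval₂] at h3
    rw [← h3]
    congr 1
    funext j
    cases j <;> rfl
end concrete
end CY

namespace CY

section logder
open Polynomial

theorem geom_inv {K : Type*} [Field K] (b : K) :
    (1 - PowerSeries.C b * PowerSeries.X) * PowerSeries.mk (fun k => b ^ k) = 1 := by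
  ext k
  rw [sub_mul, one_mul, map_sub, mul_assoc, PowerSeries.coeff_C_mul, PowerSeries.coeff_mk, PowerSeries.coeff_one]
  cases k with
  | zero => simp
  | succ k => rw [PowerSeries.coeff_succ_X_mul, PowerSeries.coeff_mk]; simp [pow_succ']

theorem logder {K ι : Type*} [Field K] (T : Finset ι) (a : ι → K) :
    ((-derivative (∏ i ∈ T, (1 - C (a i)⁻¹ * X)) : K[X]) : PowerSeries K) =
      ((∏ i ∈ T, (1 - C (a i)⁻¹ * X) : K[X]) : PowerSeries K) *
        PowerSeries.mk (fun k => ∑ i ∈ T, (a i)⁻¹ ^ (k + 1)) := by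
  classical
  have h1 : (PowerSeries.mk (fun k => ∑ i ∈ T, (a i)⁻¹ ^ (k + 1)) : PowerSeries K) =
      ∑ i ∈ T, PowerSeries.C (a i)⁻¹ * PowerSeries.mk (fun k => (a i)⁻¹ ^ k) := by
    ext k
    simp [pow_succ']
  rw [h1, Finset.mul_sum, derivative_prod_finset, ← Finset.sum_neg_distrib,
    ← Polynomial.coeToPowerSeries.ringHom_apply, map_sum]
  refine Finset.sum_congr rfl fun i hi => ?_
  rw [← Finset.mul_prod_erase T _ hi]
  have h2 : ((1 - C (a i)⁻¹ * X : K[X]) : PowerSeries K) = 1 - PowerSeries.C (a i)⁻¹ * PowerSeries.X := by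
    simp
  have h3 := geom_inv (a i)⁻¹
  rw [Polynomial.coeToPowerSeries.ringHom_apply, Polynomial.coe_mul, h2]
  have h4 : ((-((∏ b ∈ T.erase i, (1 - C (a b)⁻¹ * X)) * derivative (1 - C (a i)⁻¹ * X)) : K[X]) : PowerSeries K)
     = ((∏ b ∈ T.erase i, (1 - C (a b)⁻¹ * X) : K[X]) : PowerSeries K) * PowerSeries.C (a i)⁻¹ := by
    rw [show derivative (1 - C (a i)⁻¹ * X) = - C (a i)⁻¹ by simp, mul_neg, neg_neg, Polynomial.coe_mul, Polynomial.coe_C]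
  rw [h4]
  linear_combination (-((∏ b ∈ T.erase i, (1 - C (a b)⁻¹ * X) : K[X]) : PowerSeries K) * PowerSeries.C (a i)⁻¹) * h3
end logder

section carl
variable (Fq : Type*) [Field Fq] [Fintype Fq]
local notation "q" => Fintype.card Fq
local notation "At" => Polynomial (Polynomial Fq)
local notation "θ" => (Polynomial.X : Polynomial Fq)

/-- polynomials of degree less than `d` -/
noncomputable def lowF (d : ℕ) : Finset (Polynomial Fq) :=
  Finset.univ.map ⟨fun f : Fin d → Fq => (((Polynomial.degreeLTEquiv Fq d).symm f : Polynomial.degreeLT Fq d) : Polynomial Fq),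
    fun _ _ h => (Polynomial.degreeLTEquiv Fq d).symm.injective (Subtype.ext h)⟩

/-- monic polynomials of degree `d` -/
noncomputable def monF (d : ℕ) : Finset (Polynomial Fq) :=
  (lowF Fq d).map ⟨fun f => Polynomial.X ^ d + f, add_right_injective _⟩

variable {Fq}

theorem mem_lowF {d : ℕ} {a : Polynomial Fq} : a ∈ lowF Fq d ↔ a.degree < d := by
  rw [lowF, Finset.mem_map, ← Polynomial.mem_degreeLT]
  constructor
  · rintro ⟨f, _, rfl⟩
    exact ((Polynomial.degreeLTEquiv Fq d).symm f).2
  · intro h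
    refine ⟨Polynomial.degreeLTEquiv Fq d ⟨a, h⟩, Finset.mem_univ _, ?_⟩
    change (((Polynomial.degreeLTEquiv Fq d).symm (Polynomial.degreeLTEquiv Fq d ⟨a, h⟩) : Polynomial.degreeLT Fq d) : Polynomial Fq) = a
    rw [LinearEquiv.symm_apply_apply]

theorem card_lowF (d : ℕ) : (lowF Fq d).card = q ^ d := by
  rw [lowF, Finset.card_map, Finset.card_univ]; simp

theorem card_monF (d : ℕ) : (monF Fq d).card = q ^ d := by
  rw [monF, Finset.card_map, card_lowF]

theorem mem_monF {d : ℕ} {a : Polynomial Fq} : a ∈ monF Fq d ↔ a.Monic ∧ a.natDegree = d := by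
  rw [monF, Finset.mem_map]
  constructor
  · rintro ⟨f, hf, rfl⟩
    rw [mem_lowF] at hf
    have h2 : (Polynomial.X ^ d + f).Monic := Polynomial.monic_X_pow_add hf
    refine ⟨h2, ?_⟩
    have := Polynomial.degree_add_eq_left_of_degree_lt (show f.degree < ((Polynomial.X : Polynomial Fq) ^ d).degree by simpa using hf)
    rw [Polynomial.degree_X_pow] at this
    exact Polynomial.natDegree_eq_of_degree_eq_some this
  · rintro ⟨h1, h2⟩
    refine ⟨a - Polynomial.X ^ d, ?_, add_sub_cancel _ _⟩
    rw [mem_lowF]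
    have h3 : a.degree = d := by rw [Polynomial.degree_eq_natDegree h1.ne_zero, h2]
    have := Polynomial.degree_sub_lt_left (show a.degree = (Polynomial.X ^ d : Polynomial Fq).degree by rw [h3, Polynomial.degree_X_pow]) h1.ne_zero
      (by rw [h1.leadingCoeff, Polynomial.leadingCoeff_X_pow])
    rwa [h3] at this

variable {L : Type*} [NormedField L] [Algebra Fq L]
  [Algebra (Polynomial Fq) L] [KInf Fq L]

theorem alg_pow (i : ℕ) (a : Polynomial Fq) :
    Polynomial.aeval (algebraMap (Polynomial Fq) L θ ^ q ^ i) a = algebraMap (Polynomial Fq) L a ^ q ^ i := by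
  have := KInf.tower (Fq := Fq) (L := L)
  have h : ((Polynomial.aeval (algebraMap (Polynomial Fq) L θ ^ q ^ i) : Polynomial Fq →ₐ[Fq] L) : Polynomial Fq →+* L) =
      (frk Fq L i).comp (algebraMap (Polynomial Fq) L) := by
    refine Polynomial.ringHom_ext (fun c => ?_) ?_
    · simp only [RingHom.comp_apply, frk_apply, RingHom.coe_coe, Polynomial.aeval_C]
      rw [← Polynomial.algebraMap_eq, ← IsScalarTower.algebraMap_apply, ← map_pow, FiniteField.pow_card_pow]
    · simp [frk_apply]
  have h2 := RingHom.congr_fun h a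
  simpa [frk_apply] using h2

variable (Fq L) in
/-- coefficients of the Carlitz polynomials -/
noncomputable def en (d i : ℕ) : L :=
  (∏ j ∈ (Finset.range (d + 1)).erase i, (algebraMap (Polynomial Fq) L θ ^ q ^ i - algebraMap (Polynomial Fq) L θ ^ q ^ j))⁻¹

theorem xs_inj : Function.Injective (fun i : ℕ => algebraMap (Polynomial Fq) L θ ^ q ^ i) := by
  intro a b h
  simp only [← map_pow] at h
  have h1 := congrArg Polynomial.natDegree (alg_inj (Fq := Fq) (L := L) h)
  simp only [Polynomial.natDegree_X_pow] at h1
  exact Nat.pow_right_injective (one_lt_q Fq) h1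

theorem en_val (d : ℕ) (a : Polynomial Fq) (ha : a.degree < (d + 1 : ℕ)) :
    ∑ i ∈ Finset.range (d + 1), en Fq L d i * algebraMap (Polynomial Fq) L a ^ q ^ i = algebraMap Fq L (a.coeff d) := by
  have h := Lagrange.coeff_eq_sum (s := Finset.range (d + 1)) (v := fun i : ℕ => algebraMap (Polynomial Fq) L θ ^ q ^ i)
    (xs_inj (Fq := Fq) (L := L)).injOn (P := a.map (algebraMap Fq L))
    (by rw [Polynomial.degree_map, Finset.card_range]; exact_mod_cast ha)
  rw [Finset.card_range, Nat.add_sub_cancel, Polynomial.coeff_map] at h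
  rw [h]
  refine Finset.sum_congr rfl fun i _ => ?_
  rw [Polynomial.eval_map_algebraMap, alg_pow, en, div_eq_mul_inv, mul_comm]

theorem alg_ne {a : Polynomial Fq} (h : a ≠ 0) : algebraMap (Polynomial Fq) L a ≠ 0 := by
  rwa [Ne, map_eq_zero_iff _ (alg_inj (Fq := Fq) (L := L))]

theorem en_prod (d : ℕ) : 1 - ∑ i ∈ Finset.range (d + 1), Polynomial.C (en Fq L d i) * Polynomial.X ^ q ^ i =
    ∏ a ∈ monF Fq d, (1 - Polynomial.C (algebraMap (Polynomial Fq) L a)⁻¹ * Polynomial.X) := by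
  classical
  have hinj := alg_inj (Fq := Fq) (L := L)
  have h0 : (0 : L) ∉ (monF Fq d).image (algebraMap (Polynomial Fq) L) := by
    rw [Finset.mem_image]
    rintro ⟨a, ha, h⟩
    exact alg_ne (mem_monF.1 ha).1.ne_zero h
  have hcard : (insert 0 ((monF Fq d).image (algebraMap (Polynomial Fq) L))).card = q ^ d + 1 := by
    rw [Finset.card_insert_of_notMem h0, Finset.card_image_of_injective _ hinj, card_monF]
  refine Polynomial.eq_of_degrees_lt_of_eval_finset_eq (insert 0 ((monF Fq d).image (algebraMap (Polynomial Fq) L))) ?_ ?_ ?_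
  · rw [hcard]
    rw [← Polynomial.mem_degreeLT]
    refine sub_mem ?_ (sum_mem fun i hi => ?_)
    · rw [Polynomial.mem_degreeLT, Polynomial.degree_one]; exact_mod_cast Nat.succ_pos _
    · rw [Polynomial.mem_degreeLT]
      refine (Polynomial.degree_C_mul_X_pow_le _ _).trans_lt ?_
      have : q ^ i ≤ q ^ d := Nat.pow_le_pow_right (q_pos Fq) (by have := Finset.mem_range.1 hi; omega)
      exact_mod_cast Nat.lt_succ_of_le this
  · rw [hcard]
    refine Polynomial.degree_le_natDegree.trans_lt ?_
    have h1 := Polynomial.natDegree_prod_le (monF Fq d) (fun a => (1 - Polynomial.C (algebraMap (Polynomial Fq) L a)⁻¹ * Polynomial.X))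
    have h2 : ∑ a ∈ monF Fq d, (1 - Polynomial.C (algebraMap (Polynomial Fq) L a)⁻¹ * Polynomial.X).natDegree ≤ ∑ a ∈ monF Fq d, 1 := by
      refine Finset.sum_le_sum fun a _ => ?_
      compute_degree
    rw [Finset.sum_const, card_monF, smul_eq_mul, mul_one] at h2
    exact_mod_cast Nat.lt_succ_of_le (h1.trans h2)
  · intro x hx
    rw [Finset.mem_insert, Finset.mem_image] at hx
    rcases hx with rfl | ⟨a, ha, rfl⟩
    · simp only [Polynomial.eval_sub, Polynomial.eval_one, Polynomial.eval_finsetSum, Polynomial.eval_prod,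
        Polynomial.eval_mul, Polynomial.eval_C, Polynomial.eval_pow, Polynomial.eval_X, mul_zero, sub_zero, Finset.prod_const_one]
      rw [Finset.sum_eq_zero, sub_zero]
      intro i _
      rw [zero_pow (pow_pos (q_pos Fq) i).ne', mul_zero]
    · have ha2 := mem_monF.1 ha
      have h1 := en_val (L := L) d a (by rw [Polynomial.degree_eq_natDegree ha2.1.ne_zero, ha2.2]; exact_mod_cast Nat.lt_succ_self d)
      rw [← ha2.2, Polynomial.Monic.coeff_natDegree ha2.1, map_one, ha2.2] at h1
      simp only [Polynomial.eval_sub, Polynomial.eval_one, Polynomial.eval_finsetSum, Polynomial.eval_prod,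
        Polynomial.eval_mul, Polynomial.eval_C, Polynomial.eval_pow, Polynomial.eval_X]
      rw [h1, sub_self, Finset.prod_eq_zero ha]
      rw [inv_mul_cancel₀ (alg_ne ha2.1.ne_zero), sub_self]

variable (Fq L) in
/-- power sums -/
noncomputable def Sd (d n : ℕ) : L := ∑ a ∈ monF Fq d, (algebraMap (Polynomial Fq) L a)⁻¹ ^ n

theorem deriv_en (d : ℕ) (g : ℕ → L) : Polynomial.derivative (∑ i ∈ Finset.range (d + 1), Polynomial.C (g i) * Polynomial.X ^ q ^ i) =
    Polynomial.C (g 0) := by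
  have hq0 : ((q : ℕ) : L) = 0 := by
    rw [← map_natCast (algebraMap Fq L), FiniteField.cast_card_eq_zero, map_zero]
  rw [Polynomial.derivative_sum, Finset.sum_range_succ']
  rw [Finset.sum_eq_zero]
  · simp
  · intro i _
    rw [Polynomial.derivative_C_mul, Polynomial.derivative_X_pow, pow_succ, Nat.cast_mul, hq0]
    simp

theorem Sd_rec (d k : ℕ) : Sd Fq L d (k + 1) = (if k = 0 then en Fq L d 0 else 0) +
    ∑ i ∈ Finset.range (d + 1), if q ^ i ≤ k then en Fq L d i * Sd Fq L d (k + 1 - q ^ i) else 0 := by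
  have h := logder (monF Fq d) (algebraMap (Polynomial Fq) L)
  rw [← en_prod, Polynomial.derivative_sub, deriv_en, Polynomial.derivative_one, zero_sub, neg_neg] at h
  have h2 := congrArg (PowerSeries.coeff k) h
  rw [Polynomial.coe_C, PowerSeries.coeff_C, Polynomial.coe_sub, Polynomial.coe_one, sub_mul, one_mul, map_sub,
    PowerSeries.coeff_mk, ← Polynomial.coeToPowerSeries.ringHom_apply, map_sum, Finset.sum_mul, map_sum] at h2
  rw [h2]
  change _ = Sd Fq L d (k + 1) - _ + _
  rw [sub_add, eq_comm, sub_eq_self, sub_eq_zero]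
  refine Finset.sum_congr rfl fun i _ => ?_
  rw [Polynomial.coeToPowerSeries.ringHom_apply, Polynomial.coe_mul, Polynomial.coe_C, Polynomial.coe_pow, Polynomial.coe_X,
    mul_assoc, PowerSeries.coeff_C_mul, PowerSeries.coeff_X_pow_mul']
  split_ifs with hi
  · rw [PowerSeries.coeff_mk, show k + 1 - q ^ i = k - q ^ i + 1 by omega, Sd]
  · rw [mul_zero]
end carl
end CY

namespace CY

section at1
variable (Fq : Type*) [Field Fq] [Fintype Fq]
local notation "q" => Fintype.card Fq
local notation "At" => Polynomial (Polynomial Fq)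
local notation "θ" => (Polynomial.X : Polynomial Fq)

noncomputable def GG (i : ℕ) : At := ∏ m ∈ Finset.range i, (Polynomial.X ^ q ^ i - Polynomial.C (θ ^ q ^ (m + 1)))
noncomputable def DD (i : ℕ) : Polynomial Fq := ∏ m ∈ Finset.range i, (θ ^ q ^ i - θ ^ q ^ m)
noncomputable def ell (d : ℕ) : Polynomial Fq := ∏ m ∈ Finset.range d, (θ - θ ^ q ^ (m + 1))
noncomputable def gsp (d i : ℕ) : Polynomial Fq := ∏ m ∈ Finset.range i, (θ ^ q ^ i - θ ^ q ^ (d + 1 + m))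
/-- specialisation `t = θ` after raising coefficients to the `q^d`-th power -/
noncomputable def rho (d : ℕ) : At →+* Polynomial Fq := (Polynomial.evalRingHom θ).comp (sp Fq d)

variable {Fq}

theorem Xpow_sub_ne {a b : ℕ} (h : a ≠ b) : (θ ^ q ^ a - θ ^ q ^ b) ≠ 0 := by
  intro h0
  have h1 := congrArg Polynomial.natDegree (sub_eq_zero.1 h0)
  simp only [Polynomial.natDegree_X_pow] at h1
  exact h (Nat.pow_right_injective (one_lt_q Fq) h1)

theorem DD_ne (i : ℕ) : DD Fq i ≠ 0 :=
  Finset.prod_ne_zero_iff.2 fun _ hm => Xpow_sub_ne (Finset.mem_range.1 hm).ne'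

theorem ell_ne (d : ℕ) : ell Fq d ≠ 0 :=
  Finset.prod_ne_zero_iff.2 fun m _ => by
    have := Xpow_sub_ne (Fq := Fq) (Nat.succ_ne_zero m).symm
    simpa using this

theorem rho_apply (d : ℕ) (f : At) : rho Fq d f = (sp Fq d f).eval θ := rfl

theorem sp_C (d : ℕ) (a : Polynomial Fq) : sp Fq d (Polynomial.C a) = Polynomial.C (a ^ q ^ d) := by
  ext1 n
  rw [coeff_sp, Polynomial.coeff_C, Polynomial.coeff_C]
  split_ifs
  · rfl
  · rw [zero_pow (pow_pos (q_pos Fq) d).ne']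

theorem sp_mapC (d : ℕ) (a : Polynomial Fq) : sp Fq d (a.map Polynomial.C) = a.map Polynomial.C := by
  ext1 n
  rw [coeff_sp, Polynomial.coeff_map, ← map_pow, FiniteField.pow_card_pow]

theorem sp_X (d : ℕ) : sp Fq d Polynomial.X = Polynomial.X := by
  have := sp_mapC (Fq := Fq) d Polynomial.X
  rwa [Polynomial.map_X] at this

theorem rho_C (d : ℕ) (a : Polynomial Fq) : rho Fq d (Polynomial.C a) = a ^ q ^ d := by
  rw [rho_apply, sp_C, Polynomial.eval_C]

theorem rho_mapC (d : ℕ) (a : Polynomial Fq) : rho Fq d (a.map Polynomial.C) = a := by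
  rw [rho_apply, sp_mapC, Polynomial.eval_map]
  exact Polynomial.eval₂_C_X

theorem rho_X (d : ℕ) : rho Fq d Polynomial.X = θ := by
  rw [rho_apply, sp_X, Polynomial.eval_X]

theorem rho_GG (d i : ℕ) : rho Fq d (GG Fq i) = gsp Fq d i := by
  rw [GG, gsp, map_prod]
  refine Finset.prod_congr rfl fun m _ => ?_
  rw [map_sub, map_pow, rho_X, rho_C, ← pow_mul, ← pow_add]
  congr 3; omega

theorem gsp_zero {d i : ℕ} (h : d < i) : gsp Fq d i = 0 := by
  rw [gsp, Finset.prod_eq_zero (i := i - d - 1) (by simp; omega)]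
  rw [show d + 1 + (i - d - 1) = i by omega, sub_self]

theorem frob_sub (i : ℕ) (x y : Polynomial Fq) : (x - y) ^ q ^ i = x ^ q ^ i - y ^ q ^ i := by
  have := map_sub (frk Fq (Polynomial Fq) i) x y
  simpa only [frk_apply] using this

theorem gsp_mul {d i : ℕ} (h : i ≤ d) :
    gsp Fq d i * ∏ m ∈ Finset.Ico (i + 1) (d + 1), (θ ^ q ^ i - θ ^ q ^ m) = ell Fq d ^ q ^ i := by
  have h1 : gsp Fq d i = ∏ m ∈ Finset.Ico (d + 1) (d + 1 + i), (θ ^ q ^ i - θ ^ q ^ m) := by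
    rw [Finset.prod_Ico_eq_prod_range, Nat.add_sub_cancel_left, gsp]
  have h2 : ell Fq d ^ q ^ i = ∏ m ∈ Finset.Ico (i + 1) (i + 1 + d), (θ ^ q ^ i - θ ^ q ^ m) := by
    rw [Finset.prod_Ico_eq_prod_range, Nat.add_sub_cancel_left, ell, ← Finset.prod_pow]
    refine Finset.prod_congr rfl fun m _ => ?_
    rw [frob_sub, ← pow_mul, ← pow_add]
    congr 3; omega
  rw [h1, h2, mul_comm, Finset.prod_Ico_consecutive _ (by omega) (by omega)]
  congr 2; omega

variable {L : Type*} [NormedField L] [Algebra Fq L]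
  [Algebra (Polynomial Fq) L] [KInf Fq L]

theorem en_eq {d i : ℕ} (h : i ≤ d) : en Fq L d i = algebraMap (Polynomial Fq) L (gsp Fq d i) /
    (algebraMap (Polynomial Fq) L (DD Fq i) * algebraMap (Polynomial Fq) L (ell Fq d) ^ q ^ i) := by
  classical
  have hs : (Finset.range (d + 1)).erase i = Finset.range i ∪ Finset.Ico (i + 1) (d + 1) := by
    ext m; simp; omega
  have hd : Disjoint (Finset.range i) (Finset.Ico (i + 1) (d + 1)) := by
    rw [Finset.disjoint_left]; intro m; simp; omega
  have h1 : en Fq L d i = (algebraMap (Polynomial Fq) L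
      (DD Fq i * ∏ m ∈ Finset.Ico (i + 1) (d + 1), (θ ^ q ^ i - θ ^ q ^ m)))⁻¹ := by
    rw [en, hs, Finset.prod_union hd, DD, map_mul, map_prod, map_prod]
    simp only [map_sub, map_pow]
  have h2 := gsp_mul (Fq := Fq) h
  have hP : algebraMap (Polynomial Fq) L (∏ m ∈ Finset.Ico (i + 1) (d + 1), (θ ^ q ^ i - θ ^ q ^ m)) ≠ 0 :=
    alg_ne (Finset.prod_ne_zero_iff.2 fun m hm => Xpow_sub_ne (by have := Finset.mem_Ico.1 hm; omega))
  have hg : algebraMap (Polynomial Fq) L (gsp Fq d i) ≠ 0 := alg_ne (by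
    intro h0; rw [h0, zero_mul] at h2; exact pow_ne_zero _ (ell_ne d) h2.symm)
  have hD : algebraMap (Polynomial Fq) L (DD Fq i) ≠ 0 := alg_ne (DD_ne i)
  rw [h1, ← map_pow, ← h2, map_mul, map_mul]
  field_simp

theorem en_zero (d : ℕ) : en Fq L d 0 = (algebraMap (Polynomial Fq) L (ell Fq d))⁻¹ := by
  rw [en_eq (Nat.zero_le d)]; simp [gsp, DD]

variable (Fq) in
noncomputable def Del (I : ℕ) : Polynomial Fq := ∏ i ∈ Finset.range I, DD Fq i

theorem Del_ne (I : ℕ) : Del Fq I ≠ 0 := Finset.prod_ne_zero_iff.2 fun m _ => DD_ne m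

variable (Fq) in
/-- `Δ^{q^i} / D_i` -/
noncomputable def DeD (I i : ℕ) : Polynomial Fq := Del Fq I ^ (q ^ i - 1) * ∏ j ∈ (Finset.range I).erase i, DD Fq j

theorem DeD_mul {I i : ℕ} (h : i < I) : DeD Fq I i * DD Fq i = Del Fq I ^ q ^ i := by
  have h1 : DD Fq i * ∏ j ∈ (Finset.range I).erase i, DD Fq j = Del Fq I := Finset.mul_prod_erase _ _ (Finset.mem_range.2 h)
  rw [DeD, mul_assoc, mul_comm _ (DD Fq i), h1, ← pow_succ, Nat.sub_add_cancel (pow_pos (q_pos Fq) i)]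

variable (Fq) in
noncomputable def phi (I : ℕ) : PowerSeries At :=
  ∑ i ∈ Finset.range I, PowerSeries.C ((DeD Fq I i).map Polynomial.C * GG Fq i) * PowerSeries.X ^ q ^ i

variable (Fq) in
noncomputable def cser (I : ℕ) : PowerSeries At := PowerSeries.invOfUnit (1 - phi Fq I) 1

theorem coeff_phi_mul (I k : ℕ) (f : PowerSeries At) : PowerSeries.coeff k (phi Fq I * f) =
    ∑ i ∈ Finset.range I, if q ^ i ≤ k then ((DeD Fq I i).map Polynomial.C * GG Fq i) * PowerSeries.coeff (k - q ^ i) f else 0 := by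
  rw [phi, Finset.sum_mul, map_sum]
  refine Finset.sum_congr rfl fun i _ => ?_
  rw [mul_assoc, PowerSeries.coeff_C_mul, PowerSeries.coeff_X_pow_mul']
  split_ifs
  · rfl
  · rw [mul_zero]

theorem cser_rec (I k : ℕ) : PowerSeries.coeff k (cser Fq I) = (if k = 0 then 1 else 0) +
    ∑ i ∈ Finset.range I, if q ^ i ≤ k then ((DeD Fq I i).map Polynomial.C * GG Fq i) * PowerSeries.coeff (k - q ^ i) (cser Fq I) else 0 := by
  have h0 : PowerSeries.constantCoeff (1 - phi Fq I) = ((1 : (At)ˣ) : At) := by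
    have := coeff_phi_mul (Fq := Fq) I 0 1
    rw [mul_one, Finset.sum_eq_zero] at this
    · rw [map_sub, map_one, ← PowerSeries.coeff_zero_eq_constantCoeff, this]; simp
    · intro i _
      rw [if_neg]
      have := pow_pos (q_pos Fq) i
      omega
  have h1 := PowerSeries.mul_invOfUnit (1 - phi Fq I) 1 h0
  have h2 : cser Fq I = 1 + phi Fq I * cser Fq I := by
    rw [← h1, cser]; ring
  conv_lhs => rw [h2]
  rw [map_add, PowerSeries.coeff_one, coeff_phi_mul]

variable (Fq) in
/-- the Anderson-Thakur polynomial, up to normalisation -/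
noncomputable def AT (n : ℕ) : At := PowerSeries.coeff (n - 1) (cser Fq n)

theorem AT_aux (d n k : ℕ) (hk : k < n) :
    algebraMap (Polynomial Fq) L (rho Fq d (PowerSeries.coeff k (cser Fq n))) =
      algebraMap (Polynomial Fq) L (Del Fq n) ^ k * algebraMap (Polynomial Fq) L (ell Fq d) ^ (k + 1) * Sd Fq L d (k + 1) := by
  induction k using Nat.strong_induction_on with
  | _ k ih =>
  have hl : algebraMap (Polynomial Fq) L (ell Fq d) ≠ 0 := alg_ne (ell_ne d)
  rw [cser_rec, Sd_rec, map_add, map_add, mul_add]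
  congr 1
  · split_ifs with h
    · subst h
      rw [en_zero]; simp [hl]
    · simp
  · -- extend both sums
    have e1 : ∀ N, k < N → ∀ f : ℕ → L, ∑ i ∈ Finset.range N, (if q ^ i ≤ k then f i else 0) =
        ∑ i ∈ Finset.range (k + 1), (if q ^ i ≤ k then f i else 0) := by
      intro N hN f
      symm
      refine Finset.sum_subset (fun x hx => ?_) (fun x _ hx => ?_)
      · simp at hx ⊢; omega
      · rw [if_neg]
        have := Nat.lt_pow_self (n := x) (one_lt_q Fq)
        simp at hx; omega
    have e2 : ∑ i ∈ Finset.range (d + 1), (if q ^ i ≤ k then en Fq L d i * Sd Fq L d (k + 1 - q ^ i) else 0) =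
      ∑ i ∈ Finset.range (d + 1 + n), (if q ^ i ≤ k then (algebraMap (Polynomial Fq) L (gsp Fq d i) /
    (algebraMap (Polynomial Fq) L (DD Fq i) * algebraMap (Polynomial Fq) L (ell Fq d) ^ q ^ i)) * Sd Fq L d (k + 1 - q ^ i) else 0) := by
      rw [Finset.sum_range_add _ (d + 1) n, Finset.sum_eq_zero (s := Finset.range n), add_zero]
      · refine Finset.sum_congr rfl fun i hi => ?_
        rw [en_eq (by have := Finset.mem_range.1 hi; omega)]
      · intro i _
        rw [gsp_zero (by omega)]; simp
    rw [e2, e1 _ (by omega), map_sum, map_sum]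
    have e3 : ∀ i, algebraMap (Polynomial Fq) L (rho Fq d (if q ^ i ≤ k then ((DeD Fq n i).map Polynomial.C * GG Fq i) * PowerSeries.coeff (k - q ^ i) (cser Fq n) else 0)) =
       if q ^ i ≤ k then algebraMap (Polynomial Fq) L (rho Fq d (((DeD Fq n i).map Polynomial.C * GG Fq i) * PowerSeries.coeff (k - q ^ i) (cser Fq n))) else 0 := by
      intro i
      split_ifs <;> simp
    rw [Finset.sum_congr rfl (fun i _ => e3 i), e1 _ hk, Finset.mul_sum]
    refine Finset.sum_congr rfl fun i hi => ?_
    split_ifs with h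
    · have hpos := pow_pos (q_pos Fq) i
      rw [map_mul, map_mul, map_mul (rho Fq d), rho_mapC, rho_GG, map_mul, ih (k - q ^ i) (by omega) (by omega),
        show k + 1 - q ^ i = k - q ^ i + 1 by omega]
      have hD : algebraMap (Polynomial Fq) L (DD Fq i) ≠ 0 := alg_ne (DD_ne i)
      have hDe := congrArg (algebraMap (Polynomial Fq) L) (DeD_mul (Fq := Fq) (I := n) (i := i) (by have := Finset.mem_range.1 hi; omega))
      rw [map_mul, map_pow] at hDe
      have e4 : algebraMap (Polynomial Fq) L (Del Fq n) ^ k = algebraMap (Polynomial Fq) L (Del Fq n) ^ (k - q ^ i) *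
         (algebraMap (Polynomial Fq) L (DeD Fq n i) * algebraMap (Polynomial Fq) L (DD Fq i)) := by
        rw [hDe, ← pow_add]; congr 1; omega
      have e5 : algebraMap (Polynomial Fq) L (ell Fq d) ^ (k + 1) = algebraMap (Polynomial Fq) L (ell Fq d) ^ (k - q ^ i + 1) *
         algebraMap (Polynomial Fq) L (ell Fq d) ^ q ^ i := by
        rw [← pow_add]; congr 1; omega
      rw [e4, e5]
      field_simp
    · rw [mul_zero]

theorem AT_eval (d n : ℕ) (hn : 0 < n) :
    algebraMap (Polynomial Fq) L ((sp Fq d (AT Fq n)).eval θ) =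
      algebraMap (Polynomial Fq) L (Del Fq n) ^ (n - 1) * (algebraMap (Polynomial Fq) L (ell Fq d) ^ n * Sd Fq L d n) := by
  have := AT_aux (Fq := Fq) (L := L) d n (n - 1) (by omega)
  rw [Nat.sub_add_cancel hn] at this
  rw [← mul_assoc, ← this]; rfl

/-- degree bounds -/
def Wd (w : ℕ) (f : At) : Prop := ∀ j, (q - 1) * (f.coeff j).natDegree ≤ w

theorem Wd.mul {v w : ℕ} {f g : At} (hf : Wd v f) (hg : Wd w g) : Wd (v + w) (f * g) := by
  intro j
  rw [Polynomial.coeff_mul]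
  have h : ∀ x ∈ Finset.HasAntidiagonal.antidiagonal j, (f.coeff x.1 * g.coeff x.2).natDegree ≤ (v + w) / (q - 1) := by
    intro x _
    refine Polynomial.natDegree_mul_le.trans ?_
    have := one_lt_q Fq
    rw [Nat.le_div_iff_mul_le (by omega), mul_comm, mul_add]
    exact add_le_add (hf _) (hg _)
  have h2 := Polynomial.natDegree_sum_le_of_forall_le _ _ h
  exact (Nat.mul_le_mul_left _ h2).trans (Nat.mul_div_le _ _)

theorem Wd.add {w : ℕ} {f g : At} (hf : Wd w f) (hg : Wd w g) : Wd w (f + g) := by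
  intro j
  rw [Polynomial.coeff_add]
  have := Polynomial.natDegree_add_le (f.coeff j) (g.coeff j)
  refine (Nat.mul_le_mul_left _ this).trans ?_
  rw [← Nat.mul_max_mul_left]
  exact max_le (hf j) (hg j)

theorem Wd.mono {v w : ℕ} {f : At} (hf : Wd v f) (h : v ≤ w) : Wd w f := fun j => (hf j).trans h

theorem Wd.zero (w : ℕ) : Wd w (0 : At) := fun j => by simp

theorem Wd.mapC (a : Polynomial Fq) : Wd 0 (a.map Polynomial.C) := fun j => by
  rw [Polynomial.coeff_map, Polynomial.natDegree_C, mul_zero]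

theorem Wd.sum {ι : Type*} {w : ℕ} {s : Finset ι} {f : ι → At} (h : ∀ i ∈ s, Wd w (f i)) : Wd w (∑ i ∈ s, f i) := by
  classical
  induction s using Finset.induction_on with
  | empty => exact Wd.zero w
  | insert a s ha ih =>
    rw [Finset.sum_insert ha]
    exact (h _ (by simp)).add (ih fun i hi => h i (by simp [hi]))

theorem Wd_GG (i : ℕ) : Wd (q * q ^ i) (GG Fq i) := by
  have h : ∀ N, Wd (q * (q ^ N - 1)) (∏ m ∈ Finset.range N, (Polynomial.X ^ q ^ i - Polynomial.C (θ ^ q ^ (m + 1)))) := by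
    intro N
    induction N with
    | zero =>
      have := Wd.mapC (1 : Polynomial Fq)
      simpa using this
    | succ N ih =>
      rw [Finset.prod_range_succ]
      have h1 : Wd ((q - 1) * q ^ (N + 1)) (Polynomial.X ^ q ^ i - Polynomial.C (θ ^ q ^ (N + 1))) := by
        intro j
        refine Nat.mul_le_mul_left _ ?_
        rw [Polynomial.coeff_sub, Polynomial.coeff_X_pow, Polynomial.coeff_C]
        refine (Polynomial.natDegree_sub_le _ _).trans (max_le ?_ ?_)
        · split_ifs <;> simp
        · split_ifs <;> simp
      refine (ih.mul h1).mono ?_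
      have h2 := pow_pos (q_pos Fq) N
      have h3 := q_pos Fq
      zify [Nat.one_le_pow N q h3, Nat.one_le_pow (N + 1) q h3, h3]
      rw [pow_succ]
      apply le_of_eq; ring
  exact (h i).mono (Nat.mul_le_mul_left _ (Nat.sub_le _ _))

theorem Wd_cser (n k : ℕ) : Wd (q * k) (PowerSeries.coeff k (cser Fq n)) := by
  induction k using Nat.strong_induction_on with
  | _ k ih =>
  rw [cser_rec]
  refine Wd.add ?_ (Wd.sum fun i _ => ?_)
  · split_ifs
    · have := Wd.mapC (1 : Polynomial Fq)
      rw [Polynomial.map_one] at this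
      exact this.mono (Nat.zero_le _)
    · exact Wd.zero _
  · split_ifs with h
    · have hpos := pow_pos (q_pos Fq) i
      refine (((Wd.mapC _).mul (Wd_GG i)).mul (ih (k - q ^ i) (by omega))).mono ?_
      rw [zero_add, ← mul_add]
      exact Nat.mul_le_mul_left _ (by omega)
    · exact Wd.zero _

theorem Wd_AT (n : ℕ) : Wd (q * (n - 1)) (AT Fq n) := Wd_cser n (n - 1)
end at1
end CY

namespace CY

section lims
open Filter Topology
variable {L : Type*} [NormedField L] [CompleteSpace L] [IsUltrametricDist L]

theorem bd_lim {R : ℝ} (hR : 0 < R) {s : ℕ → PowerSeries L} {ε : ℕ → ℝ} (hε : Antitone ε)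
    (hε0 : Tendsto ε atTop (𝓝 0)) (h : ∀ N, Bd R (ε N) (s (N + 1) - s N)) :
    ∃ S, ∀ N, Bd R (ε N) (S - s N) := by
  have h1 : ∀ N M, N ≤ M → Bd R (ε N) (s M - s N) := by
    intro N M hNM
    induction M, hNM using Nat.le_induction with
    | base => rw [sub_self]; exact Bd.zero (h N).nonneg
    | succ M hM ih =>
      have := ((h M).mono hR.le le_rfl (hε hM)).add hR.le ih
      rwa [sub_add_sub_cancel] at this
  have h2 : ∀ k, ∃ x, Tendsto (fun N => PowerSeries.coeff k (s N)) atTop (𝓝 x) := by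
    intro k
    apply cauchySeq_tendsto_of_complete
    refine cauchySeq_of_le_tendsto_0' (fun N => ε N / R ^ k) ?_ ?_
    · intro N M hNM
      have := h1 N M hNM k
      rw [dist_comm, dist_eq_norm, ← map_sub, le_div_iff₀ (by positivity)]
      exact this
    · simpa using hε0.div_const (R ^ k)
  choose x hx using h2
  refine ⟨PowerSeries.mk x, fun N k => ?_⟩
  rw [map_sub, PowerSeries.coeff_mk]
  have h3 : Tendsto (fun M => ‖PowerSeries.coeff k (s M) - PowerSeries.coeff k (s N)‖ * R ^ k) atTop
    (𝓝 (‖x k - PowerSeries.coeff k (s N)‖ * R ^ k)) := (((hx k).sub_const _).norm).mul_const _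
  refine le_of_tendsto h3 ?_
  filter_upwards [eventually_ge_atTop N] with M hM
  have := h1 N M hM k
  rwa [map_sub] at this

theorem bd_eq_zero {R : ℝ} (hR : 0 < R) {x : PowerSeries L} {δ : ℕ → ℝ}
    (hδ : Tendsto δ atTop (𝓝 0)) (h : ∀ N, Bd R (δ N) x) : x = 0 := by
  ext k
  have h1 : ‖PowerSeries.coeff k x‖ * R ^ k ≤ 0 := ge_of_tendsto' hδ fun N => h N k
  have h2 : ‖PowerSeries.coeff k x‖ ≤ 0 := by
    by_contra! h3
    have : 0 < ‖PowerSeries.coeff k x‖ * R ^ k := by positivity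
    linarith
  simpa using h2

theorem ev_lim {R γ : ℝ} {a : L} (ha : ‖a‖ < R) {s : ℕ → PowerSeries L} {S : PowerSeries L} {ε : ℕ → ℝ}
    (hε0 : Tendsto ε atTop (𝓝 0)) (h : ∀ N, Bd R (ε N) (S - s N)) (hs : ∀ N, Bd R γ (s N)) :
    Tendsto (fun N => ev a (s N)) atTop (𝓝 (ev a S)) := by
  rw [tendsto_iff_norm_sub_tendsto_zero]
  refine squeeze_zero (fun _ => norm_nonneg _) (fun N => ?_) hε0
  have h1 := ev_add (h N) (hs N) ha
  rw [sub_add_cancel] at h1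
  rw [norm_sub_rev, h1, add_sub_cancel_right]
  exact norm_ev_le (h N) ha.le

variable {Fq : Type*} [Field Fq] [Fintype Fq] [Algebra Fq L]
local notation "q" => Fintype.card Fq

theorem fe_lim {R α δ : ℝ} (hR : 1 ≤ R) {s : ℕ → PowerSeries L} {S A B D : PowerSeries L} {ε : ℕ → ℝ}
    (hε : Antitone ε) (hε0 : Tendsto ε atTop (𝓝 0)) (h : ∀ N, Bd R (ε N) (S - s N))
    (hA : Bd R α A) (hD : Bd R δ D) (hs : ∀ N, A * s (N + 1) = B + D * sg Fq 1 (s N)) :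
    A * S = B + D * sg Fq 1 S := by
  have hR0 : 0 < R := by linarith
  rw [← sub_eq_zero]
  have hlim : Tendsto (fun N => α * ε N + δ * ε N ^ q) atTop (𝓝 0) := by
    have := (hε0.const_mul α).add ((hε0.pow q).const_mul δ)
    rw [zero_pow (q_pos Fq).ne'] at this
    simpa using this
  refine bd_eq_zero hR0 hlim fun N => ?_
  have e : A * S - (B + D * sg Fq 1 S) = A * (S - s (N + 1)) - D * sg Fq 1 (S - s N) := by
    rw [map_sub]; linear_combination hs N
  rw [e]
  have hε1 := (h N).nonneg
  have h1 : Bd R (α * ε N) (A * (S - s (N + 1))) := hA.mul hR0.le ((h (N + 1)).mono hR0.le le_rfl (hε (Nat.le_succ N)))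
  have h2 : Bd R (δ * ε N ^ q) (D * sg Fq 1 (S - s N)) := by
    refine hD.mul hR0.le ?_
    have h3 := (h N).sg (Fq := Fq) hR0.le 1
    rw [pow_one] at h3
    exact h3.mono hR0.le (le_self_pow₀ hR (q_pos Fq).ne') le_rfl
  exact (h1.mono hR0.le le_rfl (le_add_of_nonneg_right h2.nonneg)).sub hR0.le
    (h2.mono hR0.le le_rfl (le_add_of_nonneg_left h1.nonneg))
end lims

section fam
open Filter Topology
variable (Fq L : Type*) [Field Fq] [Fintype Fq] [NormedField L] [Algebra Fq L]
  [Algebra (Polynomial Fq) L] [KInf Fq L]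
local notation "q" => Fintype.card Fq
local notation "At" => Polynomial (Polynomial Fq)
local notation "θ" => (Polynomial.X : Polynomial Fq)

noncomputable def fac (m : ℕ) : PowerSeries L := (emb Fq L (sp Fq m (bb Fq)))⁻¹

variable {Fq L}

theorem c0_bb (m : ℕ) : PowerSeries.coeff 0 (emb Fq L (sp Fq m (bb Fq))) = -(algebraMap (Polynomial Fq) L θ ^ q ^ (m + 1)) := by
  rw [coeff_emb, sp_bb, Polynomial.coeff_sub, Polynomial.coeff_X_zero, Polynomial.coeff_C_zero, zero_sub, map_neg, map_pow]

theorem th_ne : algebraMap (Polynomial Fq) L θ ≠ 0 := alg_ne Polynomial.X_ne_zero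

theorem fac_mul (m : ℕ) : emb Fq L (sp Fq m (bb Fq)) * fac Fq L m = 1 := by
  refine PowerSeries.mul_inv_cancel _ ?_
  rw [← PowerSeries.coeff_zero_eq_constantCoeff, c0_bb, neg_ne_zero]
  exact pow_ne_zero _ th_ne

theorem sg_fac (m : ℕ) : sg Fq 1 (fac Fq L m) = fac Fq L (m + 1) := by
  have h1 := congrArg (sg Fq 1) (fac_mul (Fq := Fq) (L := L) m)
  rw [map_mul, ← emb_sp, sp_sp, map_one, add_comm 1 m] at h1
  have h2 := fac_mul (Fq := Fq) (L := L) (m + 1)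
  calc sg Fq 1 (fac Fq L m) = (emb Fq L (sp Fq (m + 1) (bb Fq)) * fac Fq L (m + 1)) * sg Fq 1 (fac Fq L m) := by rw [h2, one_mul]
    _ = (emb Fq L (sp Fq (m + 1) (bb Fq)) * sg Fq 1 (fac Fq L m)) * fac Fq L (m + 1) := by ring
    _ = _ := by rw [h1, one_mul]

theorem R_one : (1 : ℝ) ≤ (q : ℝ) ^ q := one_le_pow₀ (one_lt_qR Fq).le

theorem R_gt : (q : ℝ) < (q : ℝ) ^ q := by
  calc (q : ℝ) = (q : ℝ) ^ 1 := (pow_one _).symm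
    _ < _ := pow_lt_pow_right₀ (one_lt_qR Fq) (one_lt_q Fq)

theorem emb_spbb (m : ℕ) : emb Fq L (sp Fq m (bb Fq)) =
    PowerSeries.X - PowerSeries.C (algebraMap (Polynomial Fq) L θ ^ q ^ (m + 1)) := by
  ext k
  rw [coeff_emb, sp_bb, Polynomial.coeff_sub, map_sub, map_sub, Polynomial.coeff_X, Polynomial.coeff_C,
    PowerSeries.coeff_X, PowerSeries.coeff_C]
  congr 1
  · split_ifs with h1 h2 h2 <;> first | (exfalso; omega) | simp
  · split_ifs <;> simp

theorem Bd_X {R : ℝ} (hR : 0 ≤ R) : Bd R R (PowerSeries.X : PowerSeries L) := by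
  intro k
  rw [PowerSeries.coeff_X]
  split_ifs with h
  · simp [h]
  · simpa using hR

theorem Bd_bb (m : ℕ) : Bd ((q : ℝ) ^ q) ((q : ℝ) ^ q ^ (m + 1)) (emb Fq L (sp Fq m (bb Fq))) := by
  have := KInf.ultra (L := L) Fq
  have hR := R_one (Fq := Fq)
  have h1 : (q : ℝ) ^ q ≤ (q : ℝ) ^ q ^ (m + 1) :=
    pow_le_pow_right₀ (one_lt_qR Fq).le (Nat.le_self_pow (Nat.succ_ne_zero m) _)
  rw [emb_spbb]
  refine ((Bd_X (by linarith)).mono (by linarith) le_rfl h1).sub (by linarith) (Bd.const _ ?_)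
  rw [norm_pow, norm_theta]

theorem Bd_fac (m : ℕ) : Bd ((q : ℝ) ^ q) ((q : ℝ) ^ q ^ (m + 1))⁻¹ (fac Fq L m) := by
  have := KInf.ultra (L := L) Fq
  have hR := R_one (Fq := Fq)
  have hp : 0 < (q : ℝ) ^ q ^ (m + 1) := pow_pos (q_posR Fq) _
  refine Bd.of_mul_eq (by linarith) hp ?_ (Bd_bb m) ?_ (fac_mul m)
  · rw [c0_bb, norm_neg, norm_pow, norm_theta]
  · rw [mul_inv_cancel₀ hp.ne']; exact Bd.one

theorem norm_th_lt : ‖algebraMap (Polynomial Fq) L θ‖ < (q : ℝ) ^ q := by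
  rw [norm_theta]; exact R_gt

theorem ev_fac (m : ℕ) : ev (algebraMap (Polynomial Fq) L θ) (fac Fq L m) =
    (algebraMap (Polynomial Fq) L (θ - θ ^ q ^ (m + 1)))⁻¹ := by
  have := KInf.ultra (L := L) Fq
  have := KInf.complete (L := L) Fq
  have h := ev_mul (Bd_bb m) (Bd_fac m) (norm_th_lt (Fq := Fq) (L := L))
  rw [fac_mul, ev_one, ev_emb, sp_bb] at h
  simp only [Polynomial.eval_sub, Polynomial.eval_X, Polynomial.eval_C] at h
  exact eq_inv_of_mul_eq_one_right h.symm

theorem ev_prodT {ι : Type*} (T : Finset ι) {f : ι → PowerSeries L} {β : ι → ℝ} {R : ℝ} {a : L} (ha : ‖a‖ < R)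
    [CompleteSpace L] [IsUltrametricDist L]
    (h : ∀ i ∈ T, Bd R (β i) (f i)) : Bd R (∏ i ∈ T, β i) (∏ i ∈ T, f i) ∧ ev a (∏ i ∈ T, f i) = ∏ i ∈ T, ev a (f i) := by
  classical
  have hR : 0 ≤ R := (norm_nonneg a).trans ha.le
  induction T using Finset.induction_on with
  | empty => simpa [ev_one] using Bd.one
  | insert i T hi ih =>
    obtain ⟨h1, h2⟩ := ih fun j hj => h j (by simp [hj])
    have h3 := h i (by simp)
    rw [Finset.prod_insert hi, Finset.prod_insert hi, Finset.prod_insert hi, ev_mul h3 h1 ha, h2]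
    exact ⟨h3.mul hR h1, rfl⟩

theorem geo_anti (c : ℝ) (hc : 0 ≤ c) : Antitone (fun N : ℕ => c * ((q : ℝ)⁻¹) ^ N) := by
  intro a b h
  have h1 := one_lt_qR Fq
  exact mul_le_mul_of_nonneg_left (pow_le_pow_of_le_one (by positivity) (inv_le_one_of_one_le₀ h1.le) h) hc

theorem geo_lim (c : ℝ) : Tendsto (fun N : ℕ => c * ((q : ℝ)⁻¹) ^ N) atTop (𝓝 0) := by
  have h1 := one_lt_qR Fq
  have := (tendsto_pow_atTop_nhds_zero_of_lt_one (r := (q : ℝ)⁻¹) (by positivity) (inv_lt_one_of_one_lt₀ h1)).const_mul c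
  simpa using this

variable (Fq L) in
theorem exists_v : ∃ v : PowerSeries L, v ≠ 0 ∧ Bd ((q : ℝ) ^ q) ((q : ℝ) ^ q + 1) v ∧
    emb Fq L (bb Fq) * v = - PowerSeries.C (algebraMap (Polynomial Fq) L θ ^ q) * sg Fq 1 v ∧
    Tendsto (fun N => ∏ m ∈ Finset.range N, (1 - algebraMap (Polynomial Fq) L θ / algebraMap (Polynomial Fq) L θ ^ q ^ (m + 1))⁻¹) atTop
      (𝓝 (ev (algebraMap (Polynomial Fq) L θ) v)) := by
  have := KInf.ultra (L := L) Fq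
  have := KInf.complete (L := L) Fq
  have hR := R_one (Fq := Fq)
  have hR0 : 0 < (q : ℝ) ^ q := by linarith
  set ϑ := algebraMap (Polynomial Fq) L θ with hϑ
  let vf : ℕ → PowerSeries L := fun m => - PowerSeries.C (ϑ ^ q ^ (m + 1)) * fac Fq L m
  let s : ℕ → PowerSeries L := fun N => ∏ m ∈ Finset.range N, vf m
  have hvb : ∀ m, Bd ((q : ℝ) ^ q) 1 (vf m) := by
    intro m
    have hp : 0 < (q : ℝ) ^ q ^ (m + 1) := pow_pos (q_posR Fq) _
    have h1 : Bd ((q : ℝ) ^ q) ((q : ℝ) ^ q ^ (m + 1)) (PowerSeries.C (ϑ ^ q ^ (m + 1))) :=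
      Bd.const _ (by rw [norm_pow, norm_theta])
    have := h1.neg.mul hR0.le (Bd_fac m)
    rwa [mul_inv_cancel₀ hp.ne'] at this
  have hv1 : ∀ m, vf m - 1 = - PowerSeries.X * fac Fq L m := by
    intro m
    have h1 := fac_mul (Fq := Fq) (L := L) m
    rw [emb_spbb] at h1
    simp only [vf]
    linear_combination h1
  have hsb : ∀ N, Bd ((q : ℝ) ^ q) 1 (s N) := by
    intro N
    have := (ev_prodT (Finset.range N) (norm_th_lt (Fq := Fq) (L := L)) (fun m _ => hvb m)).1
    simpa using this
  let ε : ℕ → ℝ := fun N => (q : ℝ) ^ q * ((q : ℝ)⁻¹) ^ N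
  have hε : ∀ N, Bd ((q : ℝ) ^ q) (ε N) (s (N + 1) - s N) := by
    intro N
    have e : s (N + 1) - s N = s N * (- PowerSeries.X * fac Fq L N) := by
      simp only [s, Finset.prod_range_succ]; rw [← hv1]; ring
    rw [e]
    have h1 := (hsb N).mul hR0.le ((Bd_X (L := L) hR0.le).neg.mul hR0.le (Bd_fac N))
    refine h1.mono hR0.le le_rfl ?_
    rw [one_mul]
    simp only [ε]
    refine mul_le_mul_of_nonneg_left ?_ hR0.le
    rw [inv_pow]
    refine inv_anti₀ (pow_pos (q_posR Fq) _) (pow_le_pow_right₀ (one_lt_qR Fq).le ?_)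
    have := Nat.lt_pow_self (n := N + 1) (one_lt_q Fq)
    omega
  have hε0 : Tendsto ε atTop (𝓝 0) := geo_lim _
  have hεa : Antitone ε := geo_anti _ hR0.le
  obtain ⟨v, hv⟩ := bd_lim hR0 hεa hε0 hε
  refine ⟨v, ?_, ?_, ?_, ?_⟩
  · intro h0
    have h1 : ∀ N, PowerSeries.coeff 0 (s N) = 1 := by
      intro N
      simp only [s, PowerSeries.coeff_zero_eq_constantCoeff, map_prod]
      refine Finset.prod_eq_one fun m _ => ?_
      have h4 : PowerSeries.constantCoeff (- PowerSeries.X * fac Fq L m) = 0 := by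
        rw [map_mul, map_neg, PowerSeries.constantCoeff_X, neg_zero, zero_mul]
      rw [← hv1 m, map_sub (PowerSeries.constantCoeff (R := L)) (vf m) 1, map_one, sub_eq_zero] at h4
      exact h4
    have h2 : (1 : ℝ) ≤ 0 := by
      refine ge_of_tendsto' hε0 fun N => ?_
      have := hv N 0
      rw [h0, zero_sub, map_neg, h1, norm_neg, norm_one] at this
      simpa using this
    linarith
  · have h1 := ((hv 0).mono hR0.le le_rfl (show ε 0 ≤ (q : ℝ) ^ q + 1 by simp [ε])).add hR0.le
      ((hsb 0).mono hR0.le le_rfl (show (1 : ℝ) ≤ (q : ℝ) ^ q + 1 by linarith))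
    rwa [sub_add_cancel] at h1
  · have := fe_lim (Fq := Fq) (A := emb Fq L (bb Fq)) (B := 0) (D := - PowerSeries.C (ϑ ^ q)) hR hεa hε0 hv
      (by have := Bd_bb (Fq := Fq) (L := L) 0; rwa [sp_zero] at this) ((Bd.const _ le_rfl).neg) ?_
    · rwa [zero_add] at this
    · intro N
      simp only [s]
      rw [Finset.prod_range_succ', map_prod, zero_add]
      have e1 : ∀ m, sg Fq 1 (vf m) = vf (m + 1) := by
        intro m
        simp only [vf]
        rw [map_mul, map_neg, sg_fac]
        congr 2
        rw [pow_succ q (m + 1)]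
        ext k
        rw [coeff_sg, PowerSeries.coeff_C, PowerSeries.coeff_C]
        split_ifs
        · rw [← pow_mul, pow_one]
        · rw [zero_pow (pow_pos (q_pos Fq) 1).ne']
      rw [Finset.prod_congr rfl fun m _ => e1 m]
      have h1 := fac_mul (Fq := Fq) (L := L) 0
      rw [sp_zero] at h1
      simp only [vf, zero_add, pow_one]
      linear_combination (-PowerSeries.C (ϑ ^ q) * (∏ x ∈ Finset.range N, -PowerSeries.C (ϑ ^ q ^ (x + 1 + 1)) * fac Fq L (x + 1))) * h1
  · have h1 := ev_lim (norm_th_lt (Fq := Fq) (L := L)) hε0 hv hsb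
    convert h1 using 2 with N
    rw [(ev_prodT (Finset.range N) (norm_th_lt (Fq := Fq) (L := L)) (fun m _ => hvb m)).2]
    refine Finset.prod_congr rfl fun m _ => ?_
    have hp : ϑ ^ q ^ (m + 1) ≠ 0 := pow_ne_zero _ th_ne
    have e1 := ev_mul (R := (q : ℝ) ^ q) (f := - PowerSeries.C (ϑ ^ q ^ (m + 1))) (g := fac Fq L m) (Bd.const _ le_rfl).neg (Bd_fac m) (norm_th_lt (Fq := Fq) (L := L))
    simp only [vf]
    rw [e1, ev_fac, ← map_neg, ev_C, map_sub, map_pow, ← hϑ]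
    rw [show 1 - ϑ / ϑ ^ q ^ (m + 1) = -(ϑ - ϑ ^ q ^ (m + 1)) / ϑ ^ q ^ (m + 1) by field_simp; ring]
    rw [inv_div, div_eq_mul_inv, inv_neg]; ring

variable (Fq L) in
theorem exists_u : ∃ (u : PowerSeries L) (β : ℝ), u ≠ 0 ∧ Bd ((q : ℝ) ^ q) β u ∧
    sg Fq 1 u = emb Fq L (bb Fq) ^ (q - 1) * u ∧
    Tendsto (fun N => algebraMap (Polynomial Fq) L θ ^ q *
      (∏ m ∈ Finset.range N, (1 - algebraMap (Polynomial Fq) L θ / algebraMap (Polynomial Fq) L θ ^ q ^ (m + 1))⁻¹) ^ (q - 1)) atTop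
      (𝓝 (ev (algebraMap (Polynomial Fq) L θ) u)) := by
  have := KInf.ultra (L := L) Fq
  have := KInf.complete (L := L) Fq
  obtain ⟨v, h0, h1, h2, h3⟩ := exists_v Fq L
  have hR0 : 0 ≤ (q : ℝ) ^ q := by have := R_one (Fq := Fq); linarith
  set ϑ := algebraMap (Polynomial Fq) L θ with hϑ
  have hb := h1.pow hR0 (q - 1)
  have hc : Bd ((q : ℝ) ^ q) ‖ϑ ^ q‖ (PowerSeries.C (ϑ ^ q)) := Bd.const _ le_rfl
  refine ⟨PowerSeries.C (ϑ ^ q) * v ^ (q - 1), _, ?_, hc.mul hR0 hb, ?_, ?_⟩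
  · refine mul_ne_zero ?_ (pow_ne_zero _ h0)
    intro h
    have := congrArg PowerSeries.constantCoeff h
    rw [PowerSeries.constantCoeff_C, map_zero] at this
    exact pow_ne_zero _ th_ne this
  · have e1 : sg Fq 1 (PowerSeries.C (ϑ ^ q)) = PowerSeries.C (ϑ ^ q) ^ q := by
      rw [← map_pow (PowerSeries.C (R := L)) (ϑ ^ q) q]
      ext k
      rw [coeff_sg, PowerSeries.coeff_C, PowerSeries.coeff_C, pow_one]
      split_ifs
      · rfl
      · rw [zero_pow (q_pos Fq).ne']
    have e2 : (-1 : PowerSeries L) ^ (q - 1) = 1 := by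
      have h4 := congrArg (algebraMap Fq L) (FiniteField.pow_card_sub_one_eq_one (-1 : Fq) (by simp))
      have h5 := congrArg (PowerSeries.C (R := L)) h4
      simpa using h5
    have e3 : (PowerSeries.C (ϑ ^ q)) ^ q = PowerSeries.C (ϑ ^ q) * PowerSeries.C (ϑ ^ q) ^ (q - 1) := by
      rw [← pow_succ', Nat.sub_add_cancel (q_pos Fq)]
    rw [mul_left_comm, ← mul_pow, h2, neg_mul, neg_pow, e2, one_mul, mul_pow, map_mul, e1, e3, map_pow (sg Fq 1) v (q - 1)]
    ring
  · rw [ev_mul hc hb (norm_th_lt (Fq := Fq) (L := L)), ev_C, ev_pow h1 (norm_th_lt (Fq := Fq) (L := L))]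
    exact (h3.pow _).const_mul _
theorem exp_ineq (n i w : ℕ) (hn : 0 < n) (hw : (q - 1) * w ≤ q * (n - 1)) :
    w * q ^ i + i ≤ n * q + n * ∑ m ∈ Finset.range i, q ^ (m + 1) := by
  have hq := one_lt_q Fq
  obtain ⟨Q, hQ⟩ : ∃ Q, q = Q + 1 := ⟨q - 1, by omega⟩
  have hQ0 : 0 < Q := by omega
  obtain ⟨k, rfl⟩ : ∃ k, n = k + 1 := ⟨n - 1, by omega⟩
  have hE : ∀ i, Q * (∑ m ∈ Finset.range i, q ^ (m + 1)) + q = q ^ (i + 1) := by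
    intro i
    induction i with
    | zero => simp
    | succ i ih =>
      rw [Finset.sum_range_succ, mul_add, add_right_comm, ih, pow_succ q (i + 1)]
      nth_rw 4 [hQ]
      ring
  have hlt : Q * i ≤ q ^ (i + 1) := by
    have h1 := (Nat.lt_pow_self (n := i) hq).le
    rw [pow_succ, mul_comm]
    exact Nat.mul_le_mul h1 (by omega)
  refine Nat.le_of_mul_le_mul_left ?_ hQ0
  have h2 := hE i
  rw [show q - 1 = Q by omega, Nat.add_sub_cancel] at hw
  set E := ∑ m ∈ Finset.range i, q ^ (m + 1)
  have h3 : (Q * w) * q ^ i ≤ (q * k) * q ^ i := Nat.mul_le_mul_right _ hw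
  have h4 : q * k * q ^ i = k * q ^ (i + 1) := by rw [pow_succ]; ring
  have h5 : (k + 1) * q ^ (i + 1) ≤ Q * ((k + 1) * q + (k + 1) * E) := by
    rw [← h2]
    nlinarith [Nat.zero_le k, Nat.zero_le (k * q), Nat.mul_le_mul_right ((k + 1) * q) hQ0]
  calc Q * (w * q ^ i + i) = (Q * w) * q ^ i + Q * i := by ring
    _ ≤ k * q ^ (i + 1) + q ^ (i + 1) := by rw [← h4]; exact add_le_add h3 hlt
    _ = (k + 1) * q ^ (i + 1) := by ring
    _ ≤ _ := h5

variable (Fq L) in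
theorem exists_z (n : ℕ) (hn : 0 < n) : ∃ (z : PowerSeries L) (β : ℝ), Bd ((q : ℝ) ^ q) β z ∧
    sg Fq 1 z = emb Fq L (bb Fq) ^ n * (z - emb Fq L (AT Fq n)) ∧
    Tendsto (fun N => ∑ i ∈ Finset.range N, algebraMap (Polynomial Fq) L (Del Fq n) ^ (n - 1) * Sd Fq L i n) atTop
      (𝓝 (ev (algebraMap (Polynomial Fq) L θ) z)) := by
  have := KInf.ultra (L := L) Fq
  have := KInf.complete (L := L) Fq
  have hR := R_one (Fq := Fq)
  have hR0 : 0 < (q : ℝ) ^ q := by linarith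
  have hq0 := q_posR Fq
  let pf : ℕ → PowerSeries L := fun i => ∏ m ∈ Finset.range i, fac Fq L m
  let f : ℕ → PowerSeries L := fun i => emb Fq L (sp Fq i (AT Fq n)) * pf i ^ n
  let s : ℕ → PowerSeries L := fun N => ∑ i ∈ Finset.range N, f i
  let T := (AT Fq n).natDegree
  let w := (q * (n - 1)) / (q - 1)
  have hqq : 0 < q - 1 := by have := one_lt_q Fq; omega
  have hw : (q - 1) * w ≤ q * (n - 1) := Nat.mul_div_le _ _
  have hpf : ∀ i, Bd ((q : ℝ) ^ q) (∏ m ∈ Finset.range i, ((q : ℝ) ^ q ^ (m + 1))⁻¹) (pf i) ∧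
      ev (algebraMap (Polynomial Fq) L θ) (pf i) = (algebraMap (Polynomial Fq) L (ell Fq i))⁻¹ := by
    intro i
    have h1 := ev_prodT (Finset.range i) (norm_th_lt (Fq := Fq) (L := L)) (fun m _ => Bd_fac m)
    refine ⟨h1.1, h1.2.trans ?_⟩
    rw [Finset.prod_congr rfl fun m _ => ev_fac m, Finset.prod_inv_distrib, ell, map_prod]
  have hemb : ∀ i, Bd ((q : ℝ) ^ q) ((q : ℝ) ^ (w * q ^ i) * ((q : ℝ) ^ q) ^ T) (emb Fq L (sp Fq i (AT Fq n))) := by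
    intro i
    refine Bd_emb Fq hR _ _ _ ?_ fun k => ?_
    · exact Polynomial.natDegree_map_le
    · rw [coeff_sp, Polynomial.natDegree_pow, mul_comm]
      refine Nat.mul_le_mul_right _ ?_
      rw [Nat.le_div_iff_mul_le hqq, mul_comm]
      exact Wd_AT n k
  let ε : ℕ → ℝ := fun N => (((q : ℝ) ^ q) ^ T * (q : ℝ) ^ (n * q)) * ((q : ℝ)⁻¹) ^ N
  have hcc : 0 ≤ ((q : ℝ) ^ q) ^ T * (q : ℝ) ^ (n * q) := by positivity
  have hfb : ∀ i, Bd ((q : ℝ) ^ q) (ε i) (f i) := by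
    intro i
    refine ((hemb i).mul hR0.le ((hpf i).1.pow hR0.le n)).mono hR0.le le_rfl ?_
    simp only [ε]
    rw [Finset.prod_inv_distrib, Finset.prod_pow_eq_pow_sum, inv_pow, inv_pow, ← pow_mul (q : ℝ) _ n,
      mul_comm ((q : ℝ) ^ (w * q ^ i)), mul_assoc, mul_assoc]
    refine mul_le_mul_of_nonneg_left ?_ (by positivity)
    rw [← div_eq_mul_inv, ← div_eq_mul_inv, div_le_div_iff₀ (by positivity) (by positivity), ← pow_add, ← pow_add]
    refine pow_le_pow_right₀ (one_lt_qR Fq).le ?_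
    have := exp_ineq (Fq := Fq) n i w hn hw
    rw [mul_comm _ n]
    exact this
  have hε0 : Tendsto ε atTop (𝓝 0) := geo_lim _
  have hεa : Antitone ε := geo_anti _ hcc
  have hε : ∀ N, Bd ((q : ℝ) ^ q) (ε N) (s (N + 1) - s N) := by
    intro N
    simp only [s]
    rw [Finset.sum_range_succ, add_sub_cancel_left]
    exact hfb N
  have hsb : ∀ N, Bd ((q : ℝ) ^ q) (ε 0) (s N) := fun N =>
    Bd.sum hR0.le (by simp only [ε]; positivity) _ fun i _ => (hfb i).mono hR0.le le_rfl (hεa (Nat.zero_le i))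
  obtain ⟨z, hz⟩ := bd_lim hR0 hεa hε0 hε
  have hzb : Bd ((q : ℝ) ^ q) (ε 0) z := by
    have h1 := (hz 0).add hR0.le (hsb 0)
    rwa [sub_add_cancel] at h1
  have hbb : Bd ((q : ℝ) ^ q) ((q : ℝ) ^ q ^ (0 + 1)) (emb Fq L (bb Fq)) := by
    have := Bd_bb (Fq := Fq) (L := L) 0; rwa [sp_zero] at this
  refine ⟨z, _, hzb, ?_, ?_⟩
  · have := fe_lim (Fq := Fq) (A := emb Fq L (bb Fq) ^ n) (B := emb Fq L (bb Fq) ^ n * emb Fq L (AT Fq n)) (D := 1) hR hεa hε0 hz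
      (hbb.pow hR0.le n) Bd.one ?_
    · linear_combination - this
    · intro N
      simp only [s]
      rw [Finset.sum_range_succ', map_sum, mul_add, one_mul, add_comm, Finset.mul_sum]
      congr 1
      · simp only [f, pf, sp_zero]; simp
      · refine Finset.sum_congr rfl fun i _ => ?_
        simp only [f, pf]
        rw [Finset.prod_range_succ', map_mul, map_pow (sg Fq 1), map_prod, ← emb_sp, sp_sp, add_comm 1 i,
          Finset.prod_congr rfl fun m _ => (sg_fac (Fq := Fq) (L := L) m)]
        have h1 := fac_mul (Fq := Fq) (L := L) 0
        rw [sp_zero] at h1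
        have h2 : emb Fq L (bb Fq) ^ n * fac Fq L 0 ^ n = 1 := by rw [← mul_pow, h1, one_pow]
        rw [mul_pow]
        linear_combination (emb Fq L (sp Fq (i + 1) (AT Fq n)) * (∏ x ∈ Finset.range i, fac Fq L (x + 1)) ^ n) * h2
  · have h1 := ev_lim (norm_th_lt (Fq := Fq) (L := L)) hε0 hz hsb
    convert h1 using 2 with N
    simp only [s]
    rw [ev_sum (norm_th_lt (Fq := Fq) (L := L)) _ (fun i _ => hfb i)]
    refine Finset.sum_congr rfl fun i _ => ?_
    simp only [f]
    rw [ev_mul (hemb i) ((hpf i).1.pow hR0.le n) (norm_th_lt (Fq := Fq) (L := L)), ev_emb, AT_eval _ _ hn,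
      ev_pow (hpf i).1 (norm_th_lt (Fq := Fq) (L := L)), (hpf i).2]
    have h0 : algebraMap (Polynomial Fq) L (ell Fq i) ≠ 0 := alg_ne (ell_ne i)
    rw [inv_pow]
    field_simp
end fam
end CY

namespace CY

section euler
open Filter Topology
variable (Fq L : Type*) [Field Fq] [Fintype Fq] [NormedField L] [Algebra Fq L]
  [Algebra (Polynomial Fq) L] [KInf Fq L]
local notation "q" => Fintype.card Fq
local notation "θ" => (Polynomial.X : Polynomial Fq)

/-- coefficients of the normalised Carlitz polynomials `∏ (1 - Z / a)` -/
noncomputable def cc (d i : ℕ) : L := algebraMap (Polynomial Fq) L (gsp Fq d i) /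
    (algebraMap (Polynomial Fq) L (DD Fq i) * algebraMap (Polynomial Fq) L (ell Fq d) ^ (q ^ i - 1))

noncomputable def Ws (d : ℕ) : PowerSeries L := by
  classical
  exact 1 - PowerSeries.X * PowerSeries.mk (fun k => ∑ a ∈ (lowF Fq d).erase 0, (algebraMap (Polynomial Fq) L a)⁻¹ ^ (k + 1))

variable {Fq L}

theorem cc_en {d i : ℕ} (h : i ≤ d) : cc Fq L d i = algebraMap (Polynomial Fq) L (ell Fq d) * en Fq L d i := by
  have h0 : algebraMap (Polynomial Fq) L (ell Fq d) ≠ 0 := alg_ne (ell_ne d)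
  have h1 : algebraMap (Polynomial Fq) L (DD Fq i) ≠ 0 := alg_ne (DD_ne i)
  rw [cc, en_eq h]
  obtain ⟨k, hk⟩ : ∃ k, q ^ i = k + 1 := ⟨q ^ i - 1, (Nat.sub_add_cancel (pow_pos (q_pos Fq) i)).symm⟩
  rw [hk, Nat.add_sub_cancel, pow_succ]
  field_simp

theorem cc_zero (d : ℕ) : cc Fq L d 0 = 1 := by simp [cc, gsp, DD]

theorem q_pow_sub {i : ℕ} (h : i ≠ 0) : 0 < q ^ i - 1 := by
  have := Nat.one_lt_pow h (one_lt_q Fq); omega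

theorem Q_prod [DecidableEq (Polynomial Fq)] (d : ℕ) : ∏ a ∈ (lowF Fq d).erase 0, (1 - Polynomial.C (algebraMap (Polynomial Fq) L a)⁻¹ * Polynomial.X) =
    ∑ i ∈ Finset.range (d + 1), Polynomial.C (cc Fq L d i) * Polynomial.X ^ (q ^ i - 1) := by
  have hm : (0 : Polynomial Fq) ∈ lowF Fq d := mem_lowF.2 (by rw [Polynomial.degree_zero]; exact WithBot.bot_lt_coe _)
  have hcard : ((lowF Fq d).erase 0).card = q ^ d - 1 := by rw [Finset.card_erase_of_mem hm, card_lowF]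
  have hqd : 0 < q ^ d := pow_pos (q_pos Fq) d
  refine Polynomial.eq_of_degrees_lt_of_eval_index_eq (lowF Fq d) (v := algebraMap (Polynomial Fq) L)
    (alg_inj (Fq := Fq) (L := L)).injOn ?_ ?_ ?_
  · rw [card_lowF]
    refine lt_of_le_of_lt (Polynomial.degree_prod_le _ _) ?_
    refine lt_of_le_of_lt (Finset.sum_le_sum (g := fun _ => (1 : WithBot ℕ)) fun a _ => ?_) ?_
    · refine (Polynomial.degree_sub_le _ _).trans (max_le ?_ ?_)
      · rw [Polynomial.degree_one]; exact zero_le_one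
      · exact (Polynomial.degree_C_mul_X_le _)
    · rw [Finset.sum_const, hcard, nsmul_one]
      exact_mod_cast (by omega : q ^ d - 1 < q ^ d)
  · rw [card_lowF]
    refine lt_of_le_of_lt (Polynomial.degree_sum_le _ _) ?_
    rw [Finset.sup_lt_iff (WithBot.bot_lt_coe _)]
    intro i hi
    refine lt_of_le_of_lt (Polynomial.degree_C_mul_X_pow_le _ _) ?_
    have h1 : q ^ i ≤ q ^ d := Nat.pow_le_pow_right (q_pos Fq) (by simp at hi; omega)
    exact_mod_cast (by omega : q ^ i - 1 < q ^ d)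
  · intro a ha
    rw [Polynomial.eval_prod, Polynomial.eval_finsetSum]
    by_cases h0 : a = 0
    · subst h0
      rw [Finset.prod_eq_one fun b _ => by simp, Finset.sum_eq_single 0]
      · simp [cc_zero]
      · intro i _ hi
        simp [(q_pow_sub (Fq := Fq) hi).ne']
      · simp
    · have ha0 : algebraMap (Polynomial Fq) L a ≠ 0 := alg_ne h0
      rw [Finset.prod_eq_zero (i := a) (by simp [h0, ha]) (by simp [ha0])]
      have hd := mem_lowF.1 ha
      have h1 := en_val (L := L) d a (hd.trans (by exact_mod_cast Nat.lt_succ_self d))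
      rw [Polynomial.coeff_eq_zero_of_degree_lt hd, map_zero] at h1
      have h2 : algebraMap (Polynomial Fq) L a * ∑ i ∈ Finset.range (d + 1), Polynomial.eval (algebraMap (Polynomial Fq) L a)
          (Polynomial.C (cc Fq L d i) * Polynomial.X ^ (q ^ i - 1)) = 0 := by
        rw [← mul_zero (algebraMap (Polynomial Fq) L (ell Fq d)), ← h1, Finset.mul_sum, Finset.mul_sum]
        refine Finset.sum_congr rfl fun i hi => ?_
        rw [cc_en (by simp at hi; omega)]
        obtain ⟨k, hk⟩ : ∃ k, q ^ i = k + 1 := ⟨q ^ i - 1, (Nat.sub_add_cancel (pow_pos (q_pos Fq) i)).symm⟩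
        rw [hk, Nat.add_sub_cancel, pow_succ]
        simp
        ring
      exact ((mul_eq_zero.1 h2).resolve_left ha0).symm

theorem Q_mul (d : ℕ) : (((∑ i ∈ Finset.range (d + 1), Polynomial.C (cc Fq L d i) * Polynomial.X ^ (q ^ i - 1) : Polynomial L)) : PowerSeries L) * Ws Fq L d = 1 := by
  classical
  have h := logder ((lowF Fq d).erase 0) (algebraMap (Polynomial Fq) L)
  rw [Q_prod] at h
  set Q := ∑ i ∈ Finset.range (d + 1), Polynomial.C (cc Fq L d i) * Polynomial.X ^ (q ^ i - 1) with hQ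
  have h1 : Polynomial.X * Q = ∑ i ∈ Finset.range (d + 1), Polynomial.C (cc Fq L d i) * Polynomial.X ^ q ^ i := by
    rw [hQ, Finset.mul_sum]
    refine Finset.sum_congr rfl fun i _ => ?_
    obtain ⟨k, hk⟩ : ∃ k, q ^ i = k + 1 := ⟨q ^ i - 1, (Nat.sub_add_cancel (pow_pos (q_pos Fq) i)).symm⟩
    rw [hk, Nat.add_sub_cancel, pow_succ]; ring
  have h2 := congrArg Polynomial.derivative h1
  rw [deriv_en, cc_zero, Polynomial.derivative_mul, Polynomial.derivative_X, one_mul] at h2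
  have h3 := congrArg (fun f : Polynomial L => (f : PowerSeries L)) h2
  simp only [Polynomial.coe_add, Polynomial.coe_mul, Polynomial.coe_X, map_one, Polynomial.coe_one] at h3
  rw [Polynomial.coe_neg] at h
  have e : Ws Fq L d = 1 - PowerSeries.X * PowerSeries.mk (fun k => ∑ a ∈ (lowF Fq d).erase 0, (algebraMap (Polynomial Fq) L a)⁻¹ ^ (k + 1)) := by
    rw [Ws]
  rw [e]
  linear_combination h3 + PowerSeries.X * h

theorem W_rec (d n : ℕ) (hn : 0 < n) : PowerSeries.coeff n (Ws Fq L d) =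
    - ∑ i ∈ Finset.Icc 1 n, if q ^ i - 1 ≤ n then cc Fq L d i * PowerSeries.coeff (n - (q ^ i - 1)) (Ws Fq L d) else 0 := by
  have h := congrArg (PowerSeries.coeff n) (Q_mul (Fq := Fq) (L := L) d)
  rw [PowerSeries.coeff_one, if_neg hn.ne', ← Polynomial.coeToPowerSeries.ringHom_apply, map_sum, Finset.sum_mul, map_sum] at h
  let F : ℕ → L := fun i => if q ^ i - 1 ≤ n then cc Fq L d i * PowerSeries.coeff (n - (q ^ i - 1)) (Ws Fq L d) else 0
  have e1 : ∀ i, PowerSeries.coeff n (Polynomial.coeToPowerSeries.ringHom (Polynomial.C (cc Fq L d i) * Polynomial.X ^ (q ^ i - 1)) * Ws Fq L d) = F i := by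
    intro i
    rw [map_mul (Polynomial.coeToPowerSeries.ringHom (R := L)), map_pow (Polynomial.coeToPowerSeries.ringHom (R := L)), Polynomial.coeToPowerSeries.ringHom_apply, Polynomial.coeToPowerSeries.ringHom_apply,
      Polynomial.coe_C, Polynomial.coe_X, mul_assoc, PowerSeries.coeff_C_mul, PowerSeries.coeff_X_pow_mul']
    simp only [F]
    split_ifs <;> simp
  rw [Finset.sum_congr rfl fun i _ => e1 i] at h
  have e2 : ∑ i ∈ Finset.range (d + 1), F i = ∑ i ∈ Finset.range (d + n + 1), F i := by
    refine Finset.sum_subset (by intro x; simp; omega) fun i _ hi => ?_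
    simp only [F, cc]
    rw [gsp_zero (by simp at hi; omega)]
    simp
  have e3 : ∑ i ∈ Finset.range (n + 1), F i = ∑ i ∈ Finset.range (d + n + 1), F i := by
    refine Finset.sum_subset (by intro x; simp; omega) fun i _ hi => ?_
    simp only [F]
    rw [if_neg]
    have h2 := Nat.lt_pow_self (n := i) (one_lt_q Fq)
    simp at hi
    omega
  rw [e2, ← e3, Finset.range_eq_Ico, Finset.sum_eq_sum_Ico_succ_bot (Nat.succ_pos n)] at h
  have e4 : F 0 = PowerSeries.coeff n (Ws Fq L d) := by simp [F, cc_zero]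
  rw [e4] at h
  exact eq_neg_of_add_eq_zero_left h

theorem W_coeff (d n : ℕ) (hn : 0 < n) : PowerSeries.coeff n (Ws Fq L d) =
    - ∑ a ∈ lowF Fq d, (algebraMap (Polynomial Fq) L a)⁻¹ ^ n := by
  classical
  obtain ⟨k, rfl⟩ : ∃ k, n = k + 1 := ⟨n - 1, by omega⟩
  rw [← Finset.sum_erase (lowF Fq d) (a := 0) (by simp)]
  have e : Ws Fq L d = 1 - PowerSeries.X * PowerSeries.mk (fun k => ∑ a ∈ (lowF Fq d).erase 0, (algebraMap (Polynomial Fq) L a)⁻¹ ^ (k + 1)) := by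
    rw [Ws]
  rw [e, map_sub, PowerSeries.coeff_succ_X_mul, PowerSeries.coeff_mk, PowerSeries.coeff_one, if_neg (Nat.succ_ne_zero k), zero_sub]

theorem W_zero (d : ℕ) : PowerSeries.coeff 0 (Ws Fq L d) = 1 := by
  rw [Ws]; simp

theorem W_Sd (d n : ℕ) (hn : 0 < n) (hd : (q - 1) ∣ n) : PowerSeries.coeff n (Ws Fq L d) =
    ∑ i ∈ Finset.range d, Sd Fq L i n := by
  classical
  rw [W_coeff d n hn, neg_eq_iff_eq_neg]
  induction d with
  | zero =>
    rw [Finset.sum_range_zero, neg_zero]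
    refine Finset.sum_eq_zero fun a ha => ?_
    have h1 : a = 0 := by
      ext m
      have h2 := mem_lowF.1 ha
      rw [Polynomial.degree_lt_iff_coeff_zero] at h2
      simpa using h2 m (Nat.zero_le m)
    rw [h1, map_zero, inv_zero, zero_pow hn.ne']
  | succ d ih =>
    have hsub : lowF Fq d ⊆ lowF Fq (d + 1) := fun a ha => mem_lowF.2 ((mem_lowF.1 ha).trans (by exact_mod_cast Nat.lt_succ_self d))
    rw [← Finset.sum_sdiff hsub, ih, Finset.sum_range_succ, neg_add, add_comm, add_right_inj]
    have h1 : ∑ x ∈ (Finset.univ : Finset Fqˣ) ×ˢ monF Fq d, (algebraMap (Polynomial Fq) L (Polynomial.C (x.1 : Fq) * x.2))⁻¹ ^ n =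
        ∑ a ∈ lowF Fq (d + 1) \ lowF Fq d, (algebraMap (Polynomial Fq) L a)⁻¹ ^ n := by
      refine Finset.sum_bij (fun x _ => Polynomial.C (x.1 : Fq) * x.2) ?_ ?_ ?_ ?_
      · rintro ⟨c, a⟩ hx
        simp only [Finset.mem_product, Finset.mem_univ, true_and, mem_monF] at hx
        rw [Finset.mem_sdiff, mem_lowF, mem_lowF, Polynomial.degree_C_mul c.ne_zero, Polynomial.degree_eq_natDegree hx.1.ne_zero, hx.2]
        exact ⟨by exact_mod_cast Nat.lt_succ_self d, lt_irrefl _⟩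
      · rintro ⟨c, a⟩ hx ⟨c', a'⟩ hx' h
        simp only [Finset.mem_product, Finset.mem_univ, true_and, mem_monF] at hx hx' h
        have h2 := congrArg Polynomial.leadingCoeff h
        rw [Polynomial.leadingCoeff_mul, Polynomial.leadingCoeff_mul, hx.1, hx'.1] at h2
        simp only [Polynomial.leadingCoeff_C, mul_one] at h2
        have h3 : c = c' := Units.ext h2
        subst h3
        have h4 := mul_left_cancel₀ (by simp : Polynomial.C (c : Fq) ≠ 0) h
        rw [h4]
      · intro a ha
        rw [Finset.mem_sdiff, mem_lowF, mem_lowF, not_lt] at ha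
        have hda : a.degree = d := by
          refine le_antisymm ?_ ha.2
          have h5 := ha.1
          rw [Polynomial.degree_lt_iff_coeff_zero] at h5
          rw [Polynomial.degree_le_iff_coeff_zero]
          intro m hm
          exact h5 m (by exact_mod_cast hm)
        have ha0 : a ≠ 0 := by rintro rfl; simp at hda
        have hl : a.leadingCoeff ≠ 0 := Polynomial.leadingCoeff_ne_zero.2 ha0
        refine ⟨(Units.mk0 _ hl, Polynomial.C a.leadingCoeff⁻¹ * a), ?_, ?_⟩
        · simp only [Finset.mem_product, Finset.mem_univ, true_and, mem_monF]
          refine ⟨?_, ?_⟩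
          · rw [mul_comm]; exact Polynomial.monic_mul_leadingCoeff_inv ha0
          · rw [Polynomial.natDegree_C_mul (inv_ne_zero hl)]
            exact Polynomial.natDegree_eq_of_degree_eq_some hda
        · simp only [Units.val_mk0]
          rw [← mul_assoc, ← map_mul, mul_inv_cancel₀ hl, map_one, one_mul]
      · intro a _; rfl
    have := KInf.tower (Fq := Fq) (L := L)
    have h2 : ∀ c : Fqˣ, (algebraMap (Polynomial Fq) L (Polynomial.C (c : Fq)))⁻¹ ^ n = 1 := by
      intro c
      obtain ⟨k, rfl⟩ := hd
      rw [inv_pow, ← map_pow, ← map_pow, pow_mul, FiniteField.pow_card_sub_one_eq_one _ c.ne_zero, one_pow, map_one, map_one, inv_one]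
    rw [← h1, Finset.sum_product]
    have h3 : ∀ c ∈ (Finset.univ : Finset Fqˣ), ∑ a ∈ monF Fq d, (algebraMap (Polynomial Fq) L (Polynomial.C (c : Fq) * a))⁻¹ ^ n = Sd Fq L d n := by
      intro c _
      rw [Sd]
      refine Finset.sum_congr rfl fun a _ => ?_
      rw [map_mul, mul_inv, mul_pow, h2, one_mul]
    rw [Finset.sum_congr rfl h3, Finset.sum_const, Finset.card_univ, Fintype.card_units, nsmul_eq_mul, Nat.cast_sub (q_pos Fq)]
    have hq0 : ((q : ℕ) : L) = 0 := by
      rw [← map_natCast (algebraMap Fq L), FiniteField.cast_card_eq_zero, map_zero]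
    rw [hq0]; simp

theorem cc_lim {U : L}
    (hU : Tendsto (fun N => algebraMap (Polynomial Fq) L θ ^ q *
      (∏ m ∈ Finset.range N, (1 - algebraMap (Polynomial Fq) L θ / algebraMap (Polynomial Fq) L θ ^ q ^ (m + 1))⁻¹) ^ (q - 1)) atTop
      (𝓝 U)) (T : Subfield L) (hT : ∀ a, algebraMap (Polynomial Fq) L a ∈ T) (hUT : U ∈ T) (i : ℕ) :
    ∃ x ∈ T, Tendsto (fun d => cc Fq L d i) atTop (𝓝 x) := by
  set ϑ := algebraMap (Polynomial Fq) L θ with hϑ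
  have hth : ϑ ≠ 0 := th_ne
  have hq1 := one_lt_qR Fq
  have hsgn : (-1 : L) ^ (q - 1) = 1 := by
    have h4 := congrArg (algebraMap Fq L) (FiniteField.pow_card_sub_one_eq_one (-1 : Fq) (by simp))
    simpa using h4
  have hne : ∀ d, algebraMap (Polynomial Fq) L (ell Fq d) ≠ 0 := fun d => alg_ne (ell_ne d)
  have key : ∀ d, ϑ ^ q ^ (d + 1) / algebraMap (Polynomial Fq) L (ell Fq d) ^ (q - 1) =
      ϑ ^ q * (∏ m ∈ Finset.range d, (1 - ϑ / ϑ ^ q ^ (m + 1))⁻¹) ^ (q - 1) := by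
    intro d
    induction d with
    | zero => simp [ell]
    | succ d ih =>
      have h1 : ϑ ^ q ^ (d + 1) ≠ 0 := pow_ne_zero _ hth
      have e1 : algebraMap (Polynomial Fq) L (ell Fq (d + 1)) = algebraMap (Polynomial Fq) L (ell Fq d) * (ϑ - ϑ ^ q ^ (d + 1)) := by
        rw [ell, Finset.prod_range_succ, map_mul, ← ell, map_sub, map_pow]
      have h2 : ϑ - ϑ ^ q ^ (d + 1) ≠ 0 := by
        intro h; rw [h, mul_zero] at e1; exact hne _ e1
      have e2 : ϑ ^ q ^ (d + 1 + 1) = ϑ ^ q ^ (d + 1) * (ϑ ^ q ^ (d + 1)) ^ (q - 1) := by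
        rw [← pow_succ', Nat.sub_add_cancel (q_pos Fq), ← pow_mul, ← pow_succ]
      have e3 : (1 - ϑ / ϑ ^ q ^ (d + 1))⁻¹ = -1 * (ϑ ^ q ^ (d + 1) / (ϑ - ϑ ^ q ^ (d + 1))) := by
        rw [show 1 - ϑ / ϑ ^ q ^ (d + 1) = -((ϑ - ϑ ^ q ^ (d + 1)) / ϑ ^ q ^ (d + 1)) by field_simp; ring]
        rw [inv_neg, inv_div]; ring
      rw [Finset.prod_range_succ, mul_pow, ← mul_assoc, ← ih, e3, mul_pow (-1 : L), hsgn, one_mul, e1, e2, div_pow, mul_pow]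
      rw [mul_div_mul_comm]
  have hk : Tendsto (fun d => ϑ ^ q ^ (d + 1) / algebraMap (Polynomial Fq) L (ell Fq d) ^ (q - 1)) atTop (𝓝 U) := by
    simpa only [key] using hU
  have hinv : Tendsto (fun d : ℕ => (ϑ ^ q ^ (d + 1))⁻¹) atTop (𝓝 0) := by
    rw [tendsto_zero_iff_norm_tendsto_zero]
    refine squeeze_zero (fun _ => norm_nonneg _) (fun d => ?_) (geo_lim (Fq := Fq) 1)
    rw [norm_inv, norm_pow, norm_theta, one_mul, inv_pow]
    refine inv_anti₀ (pow_pos (q_posR Fq) _) (pow_le_pow_right₀ hq1.le ?_)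
    have := Nat.lt_pow_self (n := d + 1) (one_lt_q Fq)
    omega
  have hd : ∀ i : ℕ, Tendsto (fun d => (ϑ ^ q ^ i - ϑ ^ q ^ (d + 1)) / algebraMap (Polynomial Fq) L (ell Fq d) ^ (q - 1)) atTop (𝓝 (-U)) := by
    intro i
    have h1 := ((hk.mul hinv).const_mul (ϑ ^ q ^ i)).sub hk
    rw [mul_zero, mul_zero, zero_sub] at h1
    refine h1.congr fun d => ?_
    have h1 : ϑ ^ q ^ (d + 1) ≠ 0 := pow_ne_zero _ hth
    have := hne d
    field_simp
  have hh : ∃ x ∈ T, Tendsto (fun d => algebraMap (Polynomial Fq) L (gsp Fq d i) / algebraMap (Polynomial Fq) L (ell Fq d) ^ (q ^ i - 1)) atTop (𝓝 x) := by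
    induction i with
    | zero => exact ⟨1, T.one_mem, by simp [gsp]⟩
    | succ i ih =>
      obtain ⟨x, hx, hl⟩ := ih
      refine ⟨x ^ q * -U, T.mul_mem (T.pow_mem hx _) (T.neg_mem hUT), ?_⟩
      refine ((hl.pow q).mul (hd (i + 1))).congr fun d => ?_
      have e1 : gsp Fq d (i + 1) = gsp Fq d i ^ q * (θ ^ q ^ (i + 1) - θ ^ q ^ (d + 1)) := by
        rw [gsp, gsp, Finset.prod_range_succ', add_zero, ← Finset.prod_pow]
        congr 1
        refine Finset.prod_congr rfl fun m _ => ?_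
        have := frob_sub (Fq := Fq) 1 (θ ^ q ^ i) (θ ^ q ^ (d + 1 + m))
        rw [pow_one] at this
        rw [this, ← pow_mul, ← pow_mul, ← pow_succ, ← pow_succ, add_assoc (d + 1) m 1]
      have e2 : q ^ (i + 1) - 1 = (q ^ i - 1) * q + (q - 1) := by
        have h1 := q_pos Fq
        have h2 := pow_pos h1 i
        obtain ⟨a, ha⟩ : ∃ a, q ^ i = a + 1 := ⟨q ^ i - 1, by omega⟩
        rw [pow_succ, ha, Nat.add_sub_cancel, add_mul, one_mul]
        omega
      rw [e1, e2, map_mul, map_sub, map_pow, map_pow, map_pow, div_pow,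
        pow_add (algebraMap (Polynomial Fq) L (ell Fq d)), pow_mul (algebraMap (Polynomial Fq) L (ell Fq d)), mul_div_mul_comm]
  obtain ⟨x, hx, hl⟩ := hh
  refine ⟨x / algebraMap (Polynomial Fq) L (DD Fq i), T.div_mem hx (hT _), ?_⟩
  refine (hl.div_const _).congr fun d => ?_
  rw [cc, div_div, mul_comm]

theorem even_zeta {U : L}
    (hU : Tendsto (fun N => algebraMap (Polynomial Fq) L θ ^ q *
      (∏ m ∈ Finset.range N, (1 - algebraMap (Polynomial Fq) L θ / algebraMap (Polynomial Fq) L θ ^ q ^ (m + 1))⁻¹) ^ (q - 1)) atTop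
      (𝓝 U)) (T : Subfield L) (hT : ∀ a, algebraMap (Polynomial Fq) L a ∈ T) (hUT : U ∈ T) (n : ℕ) (hn : 0 < n) (hd : (q - 1) ∣ n) :
    ∃ x ∈ T, Tendsto (fun N => ∑ i ∈ Finset.range N, Sd Fq L i n) atTop (𝓝 x) := by
  have key : ∀ n, ∃ x ∈ T, Tendsto (fun d => PowerSeries.coeff n (Ws Fq L d)) atTop (𝓝 x) := by
    intro n
    induction n using Nat.strong_induction_on with
    | _ n ih =>
    rcases Nat.eq_zero_or_pos n with rfl | hn
    · exact ⟨1, T.one_mem, by simp only [W_zero]; exact tendsto_const_nhds⟩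
    · simp only [W_rec _ n hn]
      choose c hcT hc using fun i => cc_lim hU T hT hUT i
      choose y hyT hy using ih
      let F : ℕ → L := fun i => if h : 1 ≤ i ∧ q ^ i - 1 ≤ n then c i * y (n - (q ^ i - 1)) (by
        have := q_pow_sub (Fq := Fq) (i := i) (by omega); omega) else 0
      refine ⟨- ∑ i ∈ Finset.Icc 1 n, F i, T.neg_mem (T.sum_mem fun i _ => ?_), (tendsto_finsetSum _ fun i hi => ?_).neg⟩
      · simp only [F]
        split_ifs
        · exact T.mul_mem (hcT _) (hyT _ _)
        · exact T.zero_mem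
      · have h1 := (Finset.mem_Icc.1 hi).1
        by_cases h2 : q ^ i - 1 ≤ n
        · simp only [F, h2, h1, and_self, dif_pos, if_true]
          exact (hc i).mul (hy _ _)
        · simp only [F, h2, and_false, dif_neg, if_false, not_false_eq_true]
          exact tendsto_const_nhds
  obtain ⟨x, hx, hl⟩ := key n
  refine ⟨x, hx, hl.congr fun d => W_Sd d n hn hd⟩

theorem Sd_frob {p : ℕ} [Fact p.Prime] [CharP L p] (d n : ℕ) : Sd Fq L d (n * p) = Sd Fq L d n ^ p := by
  rw [Sd, Sd, sum_pow_char]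
  exact Finset.sum_congr rfl fun a _ => pow_mul _ _ _

theorem norm_Sd_le (d n : ℕ) : ‖Sd Fq L d n‖ ≤ ((q : ℝ)⁻¹) ^ (d * n) := by
  have := KInf.ultra (L := L) Fq
  have := q_posR Fq
  rw [Sd]
  refine IsUltrametricDist.norm_sum_le_of_forall_le_of_nonneg (by positivity) fun a ha => ?_
  obtain ⟨h1, h2⟩ := mem_monF.1 ha
  rw [norm_pow, norm_inv, KInf.norm_alg _ h1.ne_zero, h2, ← inv_pow, pow_mul]

theorem zeta_ne {n : ℕ} (hn : 0 < n) {x : L} (hx : Tendsto (fun N => ∑ i ∈ Finset.range N, Sd Fq L i n) atTop (𝓝 x)) : x ≠ 0 := by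
  have := KInf.ultra (L := L) Fq
  have hq := one_lt_qR Fq
  have hq' : (q : ℝ)⁻¹ < 1 := inv_lt_one_of_one_lt₀ hq
  have h0 : Sd Fq L 0 n = 1 := by
    have : monF Fq 0 = {1} := by
      ext a
      rw [mem_monF, Finset.mem_singleton]
      constructor
      · rintro ⟨h1, h2⟩; exact h1.natDegree_eq_zero.1 h2
      · rintro rfl; simp
    rw [Sd, this]; simp
  have h1 : ‖x - 1‖ ≤ (q : ℝ)⁻¹ := by
    refine le_of_tendsto (hx.sub_const 1).norm ?_
    filter_upwards [eventually_ge_atTop 1] with N hN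
    obtain ⟨k, rfl⟩ : ∃ k, N = k + 1 := ⟨N - 1, by omega⟩
    rw [Finset.sum_range_succ', h0, add_sub_cancel_right]
    refine IsUltrametricDist.norm_sum_le_of_forall_le_of_nonneg (by positivity) fun i _ => ?_
    refine (norm_Sd_le _ _).trans ?_
    exact pow_le_of_le_one (by positivity) hq'.le (Nat.mul_pos (Nat.succ_pos i) hn).ne'
  rintro rfl
  rw [zero_sub, norm_neg, norm_one] at h1
  linarith
end euler
end CY

namespace CY

section trd
variable {K C : Type*} [Field K] [Field C] [Algebra K C]

open scoped IntermediateField.algebraAdjoinAdjoin in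
theorem genTrdeg_le {X E : Set C} {k : ℕ} (hX : X.encard ≤ k)
    (hE : ∀ x ∈ E, IsAlgebraic (IntermediateField.adjoin K X) x) : genTrdeg K C E ≤ k := by
  rw [genTrdeg]
  refine ciSup_le' ?_
  rintro ⟨s, hs, hind⟩
  have h1 : IntermediateField.adjoin K E ≤
      (algebraicClosure (IntermediateField.adjoin K X) C).restrictScalars K := by
    rw [IntermediateField.adjoin_le_iff]
    intro x hx
    exact mem_algebraicClosure_iff.2 (hE x hx)
  have h2 : s ⊆ (AlgebraicIndependent.matroid K C).closure X := by
    intro x hx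
    rw [AlgebraicIndependent.matroid_closure_eq]
    have h3 : IsAlgebraic (IntermediateField.adjoin K X) x := mem_algebraicClosure_iff.1 (h1 (hs hx))
    change IsAlgebraic (Algebra.adjoin K X) x
    exact h3.restrictScalars (Algebra.adjoin K X)
  have h3 : (AlgebraicIndependent.matroid K C).Indep s := hind
  have h4 := (h3.encard_le_eRk_of_subset h2).trans
    (((AlgebraicIndependent.matroid K C).eRk_closure_eq X).le.trans
      (((AlgebraicIndependent.matroid K C).eRk_le_encard X).trans hX))
  obtain ⟨hf, hn⟩ := Set.encard_le_coe_iff_finite_ncard_le.1 h4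
  have := hf.fintype
  rw [Cardinal.mk_fintype, ← Set.toFinset_card]
  rw [Set.ncard_eq_toFinset_card s hf] at hn
  have e : hf.toFinset = s.toFinset := by ext; simp
  rw [e] at hn
  exact_mod_cast hn

theorem le_genTrdeg {ι : Type*} [Fintype ι] {g : ι → C} {E : Set C} (hg : AlgebraicIndependent K g)
    (hgE : ∀ i, g i ∈ IntermediateField.adjoin K E) : (Fintype.card ι : Cardinal) ≤ genTrdeg K C E := by
  classical
  rw [genTrdeg]
  have hinj : Function.Injective g := hg.injective
  refine le_trans ?_ (le_ciSup (Cardinal.bddAbove_of_small) ⟨Set.range g, ?_, AlgebraicIndependent.to_subtype_range hg⟩)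
  · simp only
    rw [Cardinal.mk_fintype, Fintype.card_congr (Equiv.ofInjective g hinj)]
  · rintro _ ⟨i, rfl⟩; exact hgE i
end trd

section transfer
open Filter Topology
variable {Fq L C : Type*} [Field Fq] [Fintype Fq] [NormedField L] [Algebra Fq L]
  [Algebra (Polynomial Fq) L] [KInf Fq L] [NormedField C] [CompleteSpace C] [Algebra (RatFunc Fq) C]
local notation "q" => Fintype.card Fq
local notation "θ" => (Polynomial.X : Polynomial Fq)

theorem zeta_hasSum {n : ℕ} (hn : 0 < n) {x : L}
    (hx : Tendsto (fun N => ∑ i ∈ Finset.range N, Sd Fq L i n) atTop (𝓝 x)) :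
    HasSum (fun a : { a : Polynomial Fq // a.Monic } => (algebraMap (Polynomial Fq) L a.1)⁻¹ ^ n) x := by
  classical
  have := KInf.ultra (L := L) Fq
  have := KInf.complete (L := L) Fq
  have hq := one_lt_qR Fq
  have hq' : (q : ℝ)⁻¹ < 1 := inv_lt_one_of_one_lt₀ hq
  have hs : Summable (fun a : { a : Polynomial Fq // a.Monic } => (algebraMap (Polynomial Fq) L a.1)⁻¹ ^ n) := by
    refine NonarchimedeanAddGroup.summable_of_tendsto_cofinite_zero ?_
    rw [Metric.tendsto_nhds]
    intro ε hε
    obtain ⟨D, hD⟩ := exists_pow_lt_of_lt_one hε hq'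
    rw [Filter.eventually_cofinite]
    refine Set.Finite.subset ((lowF Fq D).finite_toSet.preimage (f := Subtype.val) Subtype.val_injective.injOn) ?_
    intro a ha
    simp only [Set.mem_ofPred_eq, not_lt, dist_zero_right] at ha
    rw [Set.mem_preimage, Finset.mem_coe, mem_lowF, Polynomial.degree_eq_natDegree a.2.ne_zero]
    by_contra! h
    have h' : D ≤ a.1.natDegree := by exact_mod_cast h
    rw [norm_pow, norm_inv, KInf.norm_alg _ a.2.ne_zero, ← inv_pow, ← pow_mul] at ha
    have h2 : ((q : ℝ)⁻¹) ^ (a.1.natDegree * n) ≤ ((q : ℝ)⁻¹) ^ D :=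
      pow_le_pow_of_le_one (by positivity) hq'.le (h'.trans (Nat.le_mul_of_pos_right _ hn))
    linarith
  have h1 : Tendsto (fun N => (lowF Fq N).subtype (fun a => a.Monic)) atTop atTop := by
    refine tendsto_atTop_finset_of_monotone ?_ ?_
    · intro N M h a ha
      rw [Finset.mem_subtype, mem_lowF] at ha ⊢
      exact ha.trans_le (by exact_mod_cast h)
    · intro a
      refine ⟨a.1.natDegree + 1, ?_⟩
      rw [Finset.mem_subtype, mem_lowF, Polynomial.degree_eq_natDegree a.2.ne_zero]
      exact_mod_cast Nat.lt_succ_self _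
  have h2 := hs.hasSum.comp h1
  have h3 : ∀ N, ∑ a ∈ (lowF Fq N).subtype (fun a => a.Monic), (algebraMap (Polynomial Fq) L a.1)⁻¹ ^ n = ∑ i ∈ Finset.range N, Sd Fq L i n := by
    intro N
    rw [Finset.sum_subtype_eq_sum_filter (fun a => (algebraMap (Polynomial Fq) L a)⁻¹ ^ n)]
    rw [← Finset.sum_fiberwise_of_maps_to (t := Finset.range N) (g := Polynomial.natDegree)]
    · refine Finset.sum_congr rfl fun d hd => ?_
      rw [Sd]
      refine Finset.sum_congr ?_ fun _ _ => rfl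
      ext a
      rw [Finset.mem_filter, Finset.mem_filter, mem_monF, mem_lowF]
      constructor
      · rintro ⟨⟨_, h⟩, h'⟩; exact ⟨h, h'⟩
      · rintro ⟨h, h'⟩
        refine ⟨⟨?_, h⟩, h'⟩
        rw [Polynomial.degree_eq_natDegree h.ne_zero, h']
        exact_mod_cast Finset.mem_range.1 hd
    · intro a ha
      rw [Finset.mem_filter, mem_lowF] at ha
      rw [Finset.mem_range]
      have := ha.1
      rw [Polynomial.degree_eq_natDegree ha.2.ne_zero] at this
      exact_mod_cast this
  have h4 : Tendsto (fun N => ∑ i ∈ Finset.range N, Sd Fq L i n) atTop (𝓝 (∑' a : { a : Polynomial Fq // a.Monic }, (algebraMap (Polynomial Fq) L a.1)⁻¹ ^ n)) := by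
    refine h2.congr fun N => ?_
    exact h3 N
  rw [tendsto_nhds_unique hx h4]
  exact hs.hasSum

theorem zeta_eq {j : L →+* C} (hjc : Continuous j)
    (hjA : ∀ a, j (algebraMap (Polynomial Fq) L a) = algebraMap (RatFunc Fq) C (algebraMap (Polynomial Fq) (RatFunc Fq) a))
    {n : ℕ} (hn : 0 < n) {x : L}
    (hx : Tendsto (fun N => ∑ i ∈ Finset.range N, Sd Fq L i n) atTop (𝓝 x)) : gossZeta Fq C n = j x := by
  have h := (zeta_hasSum hn hx).map j hjc
  rw [gossZeta]
  refine HasSum.tsum_eq ?_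
  convert h using 2 with a
  simp [hjA]

theorem pi_eq {j : L →+* C} (hjc : Continuous j)
    (hjA : ∀ a, j (algebraMap (Polynomial Fq) L a) = algebraMap (RatFunc Fq) C (algebraMap (Polynomial Fq) (RatFunc Fq) a))
    (hnorm : ∀ r : RatFunc Fq, r ≠ 0 →
      ‖algebraMap (RatFunc Fq) C r‖ = (Fintype.card Fq : ℝ) ^ r.intDegree)
    (r : C) (hr : r ^ (q - 1) = -(algebraMap (RatFunc Fq) C RatFunc.X)) {U : L}
    (hU : Tendsto (fun N => algebraMap (Polynomial Fq) L θ ^ q *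
      (∏ m ∈ Finset.range N, (1 - algebraMap (Polynomial Fq) L θ / algebraMap (Polynomial Fq) L θ ^ q ^ (m + 1))⁻¹) ^ (q - 1)) atTop
      (𝓝 U)) :
    (algebraMap (RatFunc Fq) C RatFunc.X * r *
              (∏' i : ℕ,
                (1 - algebraMap (RatFunc Fq) C RatFunc.X ^
                  ((1 : ℤ) - (Fintype.card Fq : ℤ) ^ (i + 1))))⁻¹) ^ (q - 1) = - j U := by
  obtain ⟨v, -, -, -, hv⟩ := exists_v Fq L
  set V := ev (algebraMap (Polynomial Fq) L θ) v
  set ϑ := algebraMap (Polynomial Fq) L θ with hϑ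
  have hth : ϑ ≠ 0 := th_ne
  have hjt : j ϑ = algebraMap (RatFunc Fq) C RatFunc.X := by rw [hϑ, hjA, RatFunc.algebraMap_X]
  have hUV : U = ϑ ^ q * V ^ (q - 1) := tendsto_nhds_unique hU ((hv.pow _).const_mul _)
  have hfac : ∀ i : ℕ, 1 - algebraMap (RatFunc Fq) C RatFunc.X ^ ((1 : ℤ) - (Fintype.card Fq : ℤ) ^ (i + 1)) = j (1 - ϑ / ϑ ^ q ^ (i + 1)) := by
    intro i
    rw [map_sub, map_div₀, map_pow, map_one, ← hjt]
    have : j ϑ ≠ 0 := by rwa [Ne, map_eq_zero]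
    rw [zpow_sub₀ this, zpow_one]
    norm_cast
  simp only [hfac]
  have hnx : ‖algebraMap (RatFunc Fq) C RatFunc.X‖ = q := by
    rw [hnorm _ RatFunc.X_ne_zero, RatFunc.intDegree_X, zpow_one]
  have hq1 := one_lt_qR Fq
  have hmul : Multipliable (fun i : ℕ => j (1 - ϑ / ϑ ^ q ^ (i + 1))) := by
    have h1 : Summable (fun i : ℕ => ‖j (-(ϑ / ϑ ^ q ^ (i + 1)))‖) := by
      refine Summable.of_nonneg_of_le (fun _ => norm_nonneg _) (fun i => ?_)
        (summable_geometric_of_lt_one (r := (q : ℝ)⁻¹) (by positivity) (inv_lt_one_of_one_lt₀ hq1))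
      rw [map_neg, norm_neg, map_div₀, map_pow, hjt, norm_div, norm_pow, hnx, div_le_iff₀ (by positivity), inv_pow]
      rw [inv_mul_eq_div, le_div_iff₀ (by positivity), ← pow_succ']
      refine pow_le_pow_right₀ hq1.le ?_
      have := Nat.lt_pow_self (n := i + 1) (one_lt_q Fq)
      omega
    have h2 := multipliable_one_add_of_summable h1
    refine h2.congr fun i => ?_
    simp [sub_eq_add_neg]
  have h1 := hmul.hasProd.tendsto_prod_nat
  set W := ∏' i : ℕ, j (1 - ϑ / ϑ ^ q ^ (i + 1))
  have h2 : Tendsto (fun N => j (∏ m ∈ Finset.range N, (1 - ϑ / ϑ ^ q ^ (m + 1))⁻¹)) atTop (𝓝 (j V)) := (hjc.tendsto V).comp hv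
  have h3 := h2.mul h1
  have h4 : ∀ N, j (∏ m ∈ Finset.range N, (1 - ϑ / ϑ ^ q ^ (m + 1))⁻¹) * ∏ m ∈ Finset.range N, j (1 - ϑ / ϑ ^ q ^ (m + 1)) = 1 := by
    intro N
    rw [← map_prod, ← map_mul, ← Finset.prod_mul_distrib, Finset.prod_eq_one, map_one]
    intro m _
    refine inv_mul_cancel₀ ?_
    intro h
    rw [sub_eq_zero, eq_div_iff (pow_ne_zero _ hth), one_mul] at h
    have h5 := xs_inj (Fq := Fq) (L := L) (a₁ := m + 1) (a₂ := 0) (by simpa using h)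
    omega
  simp only [h4] at h3
  have h5 : j V * W = 1 := tendsto_nhds_unique h3 tendsto_const_nhds |>.symm ▸ rfl
  have h6 : W⁻¹ = j V := (eq_inv_of_mul_eq_one_left h5).symm
  rw [h6, mul_pow, mul_pow, hr, hUV, map_mul, map_pow, map_pow, hjt]
  have e : algebraMap (RatFunc Fq) C RatFunc.X ^ q = algebraMap (RatFunc Fq) C RatFunc.X ^ (q - 1) * algebraMap (RatFunc Fq) C RatFunc.X := by
    rw [← pow_succ, Nat.sub_add_cancel (q_pos Fq)]
  rw [e]; ring
end transfer
end CY

namespace CY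
section mainabs
open Filter Topology
variable {Fq L C : Type*} [Field Fq] [Fintype Fq] [NormedField L] [Algebra Fq L]
  [Algebra (Polynomial Fq) L] [KInf Fq L] [NormedField C] [CompleteSpace C] [Algebra (RatFunc Fq) C]
local notation "q" => Fintype.card Fq
local notation "At" => Polynomial (Polynomial Fq)
local notation "θ" => (Polynomial.X : Polynomial Fq)

/-- Algebraic independence of the period power and the special zeta values. -/
theorem lower_ind {j : L →+* C}
    (hjA : ∀ a, j (algebraMap (Polynomial Fq) L a) = algebraMap (RatFunc Fq) C (algebraMap (Polynomial Fq) (RatFunc Fq) a))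
    {S : Type*} [Fintype S] {p : ℕ} (hp : p.Prime) [CharP Fq p] {n : S → ℕ}
    (hn : Function.Injective n) (hn0 : ∀ s, 0 < n s) (hnp : ∀ s, ¬ p ∣ n s) (hnQ : ∀ s, ¬ (q - 1) ∣ n s)
    {u : PowerSeries L} {βu : ℝ} (hu : u ≠ 0) (hbu : Bd ((q : ℝ) ^ q) βu u)
    (hσu : sg Fq 1 u = emb Fq L (bb Fq) ^ (q - 1) * u)
    {z : S → PowerSeries L} {β : S → ℝ} (hβ : ∀ s, Bd ((q : ℝ) ^ q) (β s) (z s))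
    (hz : ∀ s, sg Fq 1 (z s) = emb Fq L (bb Fq) ^ n s * (z s - emb Fq L (AT Fq (n s))))
    (hz0 : ∀ s, ev (algebraMap (Polynomial Fq) L θ) (z s) ≠ 0) :
    AlgebraicIndependent (RatFunc Fq) (fun i : Option S =>
      j (ev (algebraMap (Polynomial Fq) L θ) (Option.elim i u z))) := by
  let _ : Algebra (Polynomial Fq) C :=
    ((algebraMap (RatFunc Fq) C).comp (algebraMap (Polynomial Fq) (RatFunc Fq))).toAlgebra
  have : IsScalarTower (Polynomial Fq) (RatFunc Fq) C := IsScalarTower.of_algebraMap_eq fun _ => rfl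
  have halg : Algebra.IsAlgebraic (Polynomial Fq) (RatFunc Fq) :=
    IsLocalization.isAlgebraic _ (nonZeroDivisors (Polynomial Fq))
  have h1 := algind (Fq := Fq) (L := L) R_gt (fun i : Option S => Option.elim i u z)
    (fun i => Option.elim i βu β) (by rintro (_ | s); exacts [hbu, hβ s])
    (fun i => Option.elim i (q - 1) n) (fun i => Option.elim i 0 (fun s => AT Fq (n s)))
    (by
      rintro (_ | s)
      · simp only [Option.elim_none, map_zero, sub_zero, hσu, map_pow]
      · simp only [Option.elim_some, hz s, map_pow])
    (fun P hP => indep hp R_gt hn hn0 hnp hnQ hu hσu hβ hz hz0 P hP)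
  have h2 : AlgebraicIndependent (Polynomial Fq) (fun i : Option S =>
      j (ev (algebraMap (Polynomial Fq) L θ) (Option.elim i u z))) := by
    rw [algebraicIndependent_iff]
    intro P hP
    refine h1 P (j.injective ?_)
    rw [map_zero, ← hP, MvPolynomial.aeval_def, MvPolynomial.eval₂_comp_left]
    have e : j.comp (algebraMap (Polynomial Fq) L) = algebraMap (Polynomial Fq) C :=
      RingHom.ext fun a => hjA a
    rw [e]
    rfl
  exact h2.extendScalars (RatFunc Fq)

theorem sum_frob {p : ℕ} [Fact p.Prime] [CharP L p] {m : ℕ} {x : L}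
    (hx : Tendsto (fun N => ∑ i ∈ Finset.range N, Sd Fq L i m) atTop (𝓝 x)) :
    Tendsto (fun N => ∑ i ∈ Finset.range N, Sd Fq L i (m * p)) atTop (𝓝 (x ^ p)) := by
  refine (hx.pow p).congr fun N => ?_
  rw [sum_pow_char]
  exact Finset.sum_congr rfl fun i _ => (Sd_frob i m).symm

theorem main_abs {j : L →+* C} (hjc : Continuous j)
    (hjA : ∀ a, j (algebraMap (Polynomial Fq) L a) = algebraMap (RatFunc Fq) C (algebraMap (Polynomial Fq) (RatFunc Fq) a))
    (hnorm : ∀ r : RatFunc Fq, r ≠ 0 →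
      ‖algebraMap (RatFunc Fq) C r‖ = (Fintype.card Fq : ℝ) ^ r.intDegree)
    (r : C) (hr : r ^ (q - 1) = -(algebraMap (RatFunc Fq) C RatFunc.X)) (s : ℕ) :
      genTrdeg (RatFunc Fq) C
          (insert
            (algebraMap (RatFunc Fq) C RatFunc.X * r *
              (∏' i : ℕ,
                (1 - algebraMap (RatFunc Fq) C RatFunc.X ^
                  ((1 : ℤ) - (Fintype.card Fq : ℤ) ^ (i + 1))))⁻¹)
            ((fun n => gossZeta Fq C n) '' Set.Icc 1 s)) =
        (1 + ((Finset.Icc 1 s).filter fun n =>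
            ¬ ringChar Fq ∣ n ∧ ¬ (Fintype.card Fq - 1) ∣ n).card : ℕ) := by
  classical
  obtain ⟨u, βu, hu, hbu, hσu, hU⟩ := exists_u Fq L
  have hpi := pi_eq hjc hjA hnorm r hr hU
  set U := ev (algebraMap (Polynomial Fq) L θ) u with hUdef
  set π := algebraMap (RatFunc Fq) C RatFunc.X * r *
              (∏' i : ℕ,
                (1 - algebraMap (RatFunc Fq) C RatFunc.X ^
                  ((1 : ℤ) - (Fintype.card Fq : ℤ) ^ (i + 1))))⁻¹ with hπdef
  have hp : (ringChar Fq).Prime := CharP.char_is_prime Fq (ringChar Fq)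
  set p := ringChar Fq with hpdef
  have hpf : Fact p.Prime := ⟨hp⟩
  have hcL : CharP L p := charP_of_injective_algebraMap (algebraMap Fq L).injective p
  have hq1 := one_lt_q Fq
  -- zeta values
  have hzeta : ∀ n, 0 < n → ∃ z β, Bd ((q : ℝ) ^ q) β z ∧
      sg Fq 1 z = emb Fq L (bb Fq) ^ n * (z - emb Fq L (AT Fq n)) ∧
      ∃ x : L, x ≠ 0 ∧ Tendsto (fun N => ∑ i ∈ Finset.range N, Sd Fq L i n) atTop (𝓝 x) ∧
        gossZeta Fq C n = j x ∧
        ev (algebraMap (Polynomial Fq) L θ) z = algebraMap (Polynomial Fq) L (Del Fq n ^ (n - 1)) * x := by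
    intro n hn
    obtain ⟨z, β, hb, hs, ht⟩ := exists_z Fq L n hn
    have hD : algebraMap (Polynomial Fq) L (Del Fq n ^ (n - 1)) ≠ 0 := alg_ne (pow_ne_zero _ (Del_ne n))
    have ht2 : Tendsto (fun N => ∑ i ∈ Finset.range N, Sd Fq L i n) atTop
        (𝓝 ((algebraMap (Polynomial Fq) L (Del Fq n ^ (n - 1)))⁻¹ * ev (algebraMap (Polynomial Fq) L θ) z)) := by
      refine (ht.const_mul _).congr fun N => ?_
      rw [← Finset.mul_sum, ← map_pow (algebraMap (Polynomial Fq) L), ← mul_assoc, inv_mul_cancel₀ hD, one_mul]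
    refine ⟨z, β, hb, hs, _, zeta_ne hn ht2, ht2, zeta_eq hjc hjA hn ht2, ?_⟩
    rw [← mul_assoc, mul_inv_cancel₀ hD, one_mul]
  choose z β hb hs x hx0 hxt hxz hxe using hzeta
  set SS := (Finset.Icc 1 s).filter fun n => ¬ p ∣ n ∧ ¬ (Fintype.card Fq - 1) ∣ n with hSS
  have hSm : ∀ n : SS, (1 ≤ n.1 ∧ n.1 ≤ s) ∧ ¬ p ∣ n.1 ∧ ¬ (q - 1) ∣ n.1 := by
    intro n
    have h := Finset.mem_filter.1 n.2
    exact ⟨Finset.mem_Icc.1 h.1, h.2⟩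
  set E := insert π ((fun n => gossZeta Fq C n) '' Set.Icc 1 s) with hE
  refine le_antisymm ?_ ?_
  · let g' : Option SS → C := fun i => Option.elim i (j U) (fun n => gossZeta Fq C n.1)
    refine genTrdeg_le (X := Set.range g') ?_ ?_
    · rw [← Set.image_univ]
      refine (Set.encard_image_le _ _).trans ?_
      rw [Set.encard_univ, ENat.card_eq_coe_fintype_card, Fintype.card_option, Fintype.card_coe, add_comm]
    · set F := IntermediateField.adjoin (RatFunc Fq) (Set.range g') with hF
      have hjU : j U ∈ F := IntermediateField.subset_adjoin _ _ ⟨none, rfl⟩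
      have hz : ∀ n, 0 < n → n ≤ s → gossZeta Fq C n ∈ F := by
        intro n
        induction n using Nat.strong_induction_on with
        | _ n ih =>
          intro hn hns
          by_cases h1 : (q - 1) ∣ n
          · obtain ⟨y, hy, hyt⟩ := even_zeta hU (F.toSubfield.comap j)
              (fun a => by
                rw [Subfield.mem_comap, hjA]
                exact F.algebraMap_mem _) hjU n hn h1
            rw [zeta_eq hjc hjA hn hyt]
            exact hy
          by_cases h2 : p ∣ n
          · obtain ⟨m, rfl⟩ := h2
            have hm : 0 < m := Nat.pos_of_mul_pos_left hn
            have hlt : m < p * m := by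
              have := hp.two_le
              nlinarith
            have h3 := ih m hlt hm (by omega)
            rw [mul_comm, zeta_eq hjc hjA (Nat.mul_pos hm hp.pos) (sum_frob (hxt m hm)), map_pow, ← hxz m hm]
            exact pow_mem h3 p
          · exact IntermediateField.subset_adjoin _ _
              ⟨some ⟨n, by rw [hSS, Finset.mem_filter, Finset.mem_Icc]; exact ⟨⟨hn, hns⟩, h2, h1⟩⟩, rfl⟩
      intro y hy
      rcases hy with rfl | ⟨n, hn, rfl⟩
      · refine IsAlgebraic.of_pow (n := q - 1) (by omega) ?_
        rw [hpi]
        exact isAlgebraic_algebraMap (⟨- j U, neg_mem hjU⟩ : F)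
      · exact isAlgebraic_algebraMap (⟨gossZeta Fq C n, hz n hn.1 hn.2⟩ : F)
  · have hcard : (Fintype.card (Option SS) : Cardinal) = ((1 + SS.card : ℕ) : Cardinal) := by
      rw [Fintype.card_option, Fintype.card_coe, add_comm]
    rw [← hcard]
    have hind := lower_ind (j := j) hjA (S := SS) hp (n := fun n => n.1) Subtype.val_injective
      (fun n => (hSm n).1.1) (fun n => (hSm n).2.1) (fun n => (hSm n).2.2) hu hbu hσu
      (z := fun n => z n.1 (hSm n).1.1) (β := fun n => β n.1 (hSm n).1.1) (fun n => hb _ _)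
      (fun n => hs _ _) (fun n => by
        rw [hxe]
        exact mul_ne_zero (alg_ne (pow_ne_zero _ (Del_ne _))) (hx0 _ _))
    refine le_genTrdeg hind ?_
    rintro (_ | n)
    · have h1 : π ∈ IntermediateField.adjoin (RatFunc Fq) E :=
        IntermediateField.subset_adjoin _ _ (Set.mem_insert _ _)
      have h2 : j U = - π ^ (q - 1) := by rw [hpi, neg_neg]
      simp only [Option.elim_none]
      rw [← hUdef, h2]
      exact neg_mem (pow_mem h1 _)
    · simp only [Option.elim_some]
      rw [hxe, map_mul, ← hxz, hjA]
      refine mul_mem (IntermediateField.algebraMap_mem _ _) (IntermediateField.subset_adjoin _ _ ?_)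
      exact Set.mem_insert_of_mem _ ⟨n.1, (hSm n).1, rfl⟩
end mainabs
end CY

namespace CY
section final
open Filter Topology
variable {Fq C : Type*} [Field Fq] [Fintype Fq] [NormedField C] [CompleteSpace C] [Algebra (RatFunc Fq) C]
local notation "q" => Fintype.card Fq

theorem ultraC (hnorm : ∀ r : RatFunc Fq, r ≠ 0 →
      ‖algebraMap (RatFunc Fq) C r‖ = (Fintype.card Fq : ℝ) ^ r.intDegree) : IsUltrametricDist C := by
  refine IsUltrametricDist.isUltrametricDist_of_forall_norm_natCast_le_one fun n => ?_
  have e : (n : C) = algebraMap (RatFunc Fq) C (n : RatFunc Fq) := by simp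
  rw [e]
  by_cases h : (n : RatFunc Fq) = 0
  · rw [h, map_zero, norm_zero]; exact zero_le_one
  · rw [hnorm _ h]
    have : (n : RatFunc Fq) = RatFunc.C (n : Fq) := by simp
    rw [this, RatFunc.intDegree_C, zpow_zero]

/-- The closure of the rational functions in `C`. -/
noncomputable abbrev LL (Fq C : Type*) [Field Fq] [NormedField C] [Algebra (RatFunc Fq) C] : Subfield C :=
  (algebraMap (RatFunc Fq) C).fieldRange.topologicalClosure

theorem mem_LL {Fq C : Type*} [Field Fq] [NormedField C] [Algebra (RatFunc Fq) C] (x : RatFunc Fq) : algebraMap (RatFunc Fq) C x ∈ LL Fq C :=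
  Subfield.le_topologicalClosure _ ⟨x, rfl⟩

noncomputable def toLL (Fq C : Type*) [Field Fq] [NormedField C] [Algebra (RatFunc Fq) C] :
    RatFunc Fq →+* LL Fq C :=
  (algebraMap (RatFunc Fq) C).codRestrict (LL Fq C) mem_LL

theorem final (hnorm : ∀ r : RatFunc Fq, r ≠ 0 →
      ‖algebraMap (RatFunc Fq) C r‖ = (Fintype.card Fq : ℝ) ^ r.intDegree)
    (r : C) (hr : r ^ (Fintype.card Fq - 1) = -(algebraMap (RatFunc Fq) C RatFunc.X)) (s : ℕ) :
      genTrdeg (RatFunc Fq) C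
          (insert
            (algebraMap (RatFunc Fq) C RatFunc.X * r *
              (∏' i : ℕ,
                (1 - algebraMap (RatFunc Fq) C RatFunc.X ^
                  ((1 : ℤ) - (Fintype.card Fq : ℤ) ^ (i + 1))))⁻¹)
            ((fun n => gossZeta Fq C n) '' Set.Icc 1 s)) =
        (1 + ((Finset.Icc 1 s).filter fun n =>
            ¬ ringChar Fq ∣ n ∧ ¬ (Fintype.card Fq - 1) ∣ n).card : ℕ) := by
  have hu := ultraC hnorm
  let _ : NormedField (LL Fq C) := SubfieldClass.toNormedField (LL Fq C)
  let _ : Algebra (Polynomial Fq) (LL Fq C) := ((toLL Fq C).comp (algebraMap (Polynomial Fq) (RatFunc Fq))).toAlgebra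
  let _ : Algebra Fq (LL Fq C) :=
    (((toLL Fq C).comp (algebraMap (Polynomial Fq) (RatFunc Fq))).comp (Polynomial.C)).toAlgebra
  have hcl : IsClosed ((LL Fq C : Subfield C) : Set C) := Subfield.isClosed_topologicalClosure _
  have hK : KInf Fq (LL Fq C) :=
    { complete := hcl.completeSpace_coe
      ultra := ⟨fun x y z => hu.dist_triangle_max x.1 y.1 z.1⟩
      tower := IsScalarTower.of_algebraMap_eq fun _ => rfl
      norm_alg := by
        intro a ha
        have h1 : ‖algebraMap (Polynomial Fq) (LL Fq C) a‖ =
          ‖algebraMap (RatFunc Fq) C (algebraMap (Polynomial Fq) (RatFunc Fq) a)‖ := rfl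
        rw [h1, hnorm _ (by simpa using ha), RatFunc.intDegree_polynomial, zpow_natCast]
      norm_val := by
        intro x hx
        have hx' : (x : C) ≠ 0 := by simpa using hx
        have hxc : (x : C) ∈ closure (Set.range (algebraMap (RatFunc Fq) C)) := x.2
        obtain ⟨_, ⟨y, rfl⟩, hy⟩ := Metric.mem_closure_iff.1 hxc ‖(x : C)‖ (norm_pos_iff.2 hx')
        rw [dist_eq_norm] at hy
        have h1 : ‖algebraMap (RatFunc Fq) C y‖ = ‖(x : C)‖ := by
          have h2 := IsUltrametricDist.norm_eq_of_add_norm_lt_max (x := (x : C)) (y := - algebraMap (RatFunc Fq) C y)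
            (by rw [← sub_eq_add_neg]; exact hy.trans_le (le_max_left _ _))
          rw [h2, norm_neg]
        have hy0 : y ≠ 0 := by
          rintro rfl
          rw [map_zero, norm_zero] at h1
          exact hx' (norm_eq_zero.1 h1.symm)
        exact ⟨y.intDegree, by rw [← hnorm y hy0, h1]; rfl⟩ }
  exact main_abs (L := LL Fq C) (j := (LL Fq C).subtype) continuous_subtype_val (fun _ => rfl) hnorm r hr s
end final
end CY

/-- **Theorem of Chang and Yu** (algebraic relations among Carlitz–Goss zeta
values).  Let `q = p^e` be a prime power, `A = 𝔽_q[θ]`, `K = 𝔽_q(θ)`, and `C`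
the completion of an algebraic closure of `K_∞ = 𝔽_q((1/θ))` (modelled as a
complete, algebraically closed normed field extension of `K` with
`‖a‖ = q^{deg_θ a}` on `K`).  Let `π̃ = θ(−θ)^{1/(q−1)} ∏_{i≥1}(1−θ^{1−qⁱ})^{−1}`
be a fundamental period of the Carlitz module (`r` being a chosen `(q−1)`-th
root of `−θ`).  All algebraic dependence relations over `K` among
`ζ(1), ζ(2), …` are generated by the Bernoulli–Carlitz relations and the
Frobenius relations `ζ(mp^k) = ζ(m)^{p^k}`; equivalently, for every `s ≥ 1`
the transcendence degree over `K` of `K(π̃, ζ(1), …, ζ(s))` equals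
`1 + #{1 ≤ n ≤ s : p ∤ n and (q−1) ∤ n}`. -/
theorem stmt_18 (Fq : Type*) [Field Fq] [Fintype Fq]
    (C : Type*) [NormedField C] [CompleteSpace C] [IsAlgClosed C]
    [Algebra (RatFunc Fq) C]
    (hnorm : ∀ r : RatFunc Fq, r ≠ 0 →
      ‖algebraMap (RatFunc Fq) C r‖ = (Fintype.card Fq : ℝ) ^ r.intDegree)
    (r : C) (hr : r ^ (Fintype.card Fq - 1) = -(algebraMap (RatFunc Fq) C RatFunc.X)) :
    ∀ s : ℕ, 1 ≤ s →
      genTrdeg (RatFunc Fq) C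
          (insert
            (algebraMap (RatFunc Fq) C RatFunc.X * r *
              (∏' i : ℕ,
                (1 - algebraMap (RatFunc Fq) C RatFunc.X ^
                  ((1 : ℤ) - (Fintype.card Fq : ℤ) ^ (i + 1))))⁻¹)
            ((fun n => gossZeta Fq C n) '' Set.Icc 1 s)) =
        (1 + ((Finset.Icc 1 s).filter fun n =>
            ¬ ringChar Fq ∣ n ∧ ¬ (Fintype.card Fq - 1) ∣ n).card : ℕ) := by
  intro s _
  exact CY.final hnorm r hr s
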